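/- Let 2 < λ ≤ 8 (equivalently λ = 2/α with 1/4 ≤ α < 1) and let u be a solution of the mean field equation Δu = λ(1−e^u) on S². If u(x₁, x₂, x₃) = u(ε₁x₁, ε₂x₂, ε₃x₃) for all (x₁,x₂,x₃) ∈ S² and all signs ε₁, ε₂, ε₃ ∈ {−1, +1}, then there exists i ∈ {1,2,3} such that u depends only on the coordinate x_i, i.e. u(x) = u(x') for all x, x' ∈ S² with x_i = x'_i. -/

import Mathlib

open Real MeasureTheory

noncomputable section

/-- Euclidean Laplacian on ℝ² via the second iterated derivative. -/
def lap (w : ℝ × ℝ → ℝ) (y : ℝ × ℝ) : ℝ :=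
  iteratedFDeriv ℝ 2 w y ![(1, 0), (1, 0)] + iteratedFDeriv ℝ 2 w y ![(0, 1), (0, 1)]

/-- The unit sphere S² ⊂ ℝ³ (vectors encoded as functions `Fin 3 → ℝ`). -/
def sphere3 : Set (Fin 3 → ℝ) := {x | x 0 ^ 2 + x 1 ^ 2 + x 2 ^ 2 = 1}

/-- Inverse stereographic projection from the north pole. -/
def stereoN (y : ℝ × ℝ) : Fin 3 → ℝ :=
  ![2 * y.1 / (1 + y.1 ^ 2 + y.2 ^ 2), 2 * y.2 / (1 + y.1 ^ 2 + y.2 ^ 2),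
    (y.1 ^ 2 + y.2 ^ 2 - 1) / (1 + y.1 ^ 2 + y.2 ^ 2)]

/-- South-pole parametrization of the sphere. -/
def stereoS (y : ℝ × ℝ) : Fin 3 → ℝ :=
  ![2 * y.1 / (1 + y.1 ^ 2 + y.2 ^ 2), 2 * y.2 / (1 + y.1 ^ 2 + y.2 ^ 2),
    (1 - y.1 ^ 2 - y.2 ^ 2) / (1 + y.1 ^ 2 + y.2 ^ 2)]

/-- `u` is a solution of the mean field equation `Δu = lam (1 - e^u)` on `S²`,
expressed in the two stereographic charts. -/
def IsMFSolution (lam : ℝ) (u : (Fin 3 → ℝ) → ℝ) : Prop :=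
  ContinuousOn u sphere3 ∧
  ContDiff ℝ 2 (fun y => u (stereoN y)) ∧
  ContDiff ℝ 2 (fun y => u (stereoS y)) ∧
  (∀ y : ℝ × ℝ, lap (fun z => u (stereoN z)) y =
    4 * lam * (1 - Real.exp (u (stereoN y))) / (1 + y.1 ^ 2 + y.2 ^ 2) ^ 2) ∧
  (∀ y : ℝ × ℝ, lap (fun z => u (stereoS z)) y =
    4 * lam * (1 - Real.exp (u (stereoS y))) / (1 + y.1 ^ 2 + y.2 ^ 2) ^ 2)

/-- `u` is axially symmetric on `S²`: constant on the level sets of `⟨·, e⟩`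
for some unit vector `e`. -/
def AxiallySymmetric (u : (Fin 3 → ℝ) → ℝ) : Prop :=
  ∃ e : Fin 3 → ℝ, e 0 ^ 2 + e 1 ^ 2 + e 2 ^ 2 = 1 ∧
    ∀ x ∈ sphere3, ∀ x' ∈ sphere3,
      x 0 * e 0 + x 1 * e 1 + x 2 * e 2 = x' 0 * e 0 + x' 1 * e 1 + x' 2 * e 2 →
      u x = u x'

/-- Surface integral over `S²`, written in the north-pole stereographic chart. -/
def sphereIntegral (f : (Fin 3 → ℝ) → ℝ) : ℝ :=
  ∫ y : ℝ × ℝ, f (stereoN y) * (4 / (1 + y.1 ^ 2 + y.2 ^ 2) ^ 2)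

open scoped ContDiff

/-! ### Elementary calculus on `ℝ × ℝ` -/

/-- First partial derivative. -/
def D1 (f : ℝ × ℝ → ℝ) (p : ℝ × ℝ) : ℝ := fderiv ℝ f p (1, 0)

/-- Second partial derivative. -/
def D2 (f : ℝ × ℝ → ℝ) (p : ℝ × ℝ) : ℝ := fderiv ℝ f p (0, 1)

@[fun_prop]
theorem contDiff_D1 {f : ℝ × ℝ → ℝ} (hf : ContDiff ℝ ∞ f) : ContDiff ℝ ∞ (D1 f) := by
  unfold D1
  exact (hf.fderiv_right (m := ∞) (by simp)).clm_apply contDiff_const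

@[fun_prop]
theorem contDiff_D2 {f : ℝ × ℝ → ℝ} (hf : ContDiff ℝ ∞ f) : ContDiff ℝ ∞ (D2 f) := by
  unfold D2
  exact (hf.fderiv_right (m := ∞) (by simp)).clm_apply contDiff_const

theorem sm_diff {f : ℝ × ℝ → ℝ} (hf : ContDiff ℝ ∞ f) : Differentiable ℝ f :=
  hf.differentiable (by simp)

theorem fderiv_eq_D {f : ℝ × ℝ → ℝ} (p v : ℝ × ℝ) :
    fderiv ℝ f p v = v.1 * D1 f p + v.2 * D2 f p := by
  have : v = v.1 • ((1 : ℝ), (0 : ℝ)) + v.2 • ((0 : ℝ), (1 : ℝ)) := by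
    ext <;> simp
  conv_lhs => rw [this]
  rw [map_add, map_smul, map_smul]
  rfl

theorem D1_const (c : ℝ) : D1 (fun _ => c) = fun _ => 0 := by
  ext p; simp [D1]

theorem D2_const (c : ℝ) : D2 (fun _ => c) = fun _ => 0 := by
  ext p; simp [D2]

theorem D1_fst : D1 (fun p => p.1) = fun _ => 1 := by
  ext p; simp only [D1]
  rw [show (fun p : ℝ × ℝ => p.1) = Prod.fst from rfl, fderiv_fst]; simp

theorem D2_fst : D2 (fun p => p.1) = fun _ => 0 := by
  ext p; simp only [D2]
  rw [show (fun p : ℝ × ℝ => p.1) = Prod.fst from rfl, fderiv_fst]; simp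

theorem D1_snd : D1 (fun p => p.2) = fun _ => 0 := by
  ext p; simp only [D1]
  rw [show (fun p : ℝ × ℝ => p.2) = Prod.snd from rfl, fderiv_snd]; simp

theorem D2_snd : D2 (fun p => p.2) = fun _ => 1 := by
  ext p; simp only [D2]
  rw [show (fun p : ℝ × ℝ => p.2) = Prod.snd from rfl, fderiv_snd]; simp

section rules
variable {f g : ℝ × ℝ → ℝ}

theorem D1_add (hf : ContDiff ℝ ∞ f) (hg : ContDiff ℝ ∞ g) :
    D1 (fun x => f x + g x) = fun x => D1 f x + D1 g x := by
  ext p; simp only [D1]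
  rw [fderiv_fun_add (sm_diff hf p) (sm_diff hg p)]; rfl

theorem D2_add (hf : ContDiff ℝ ∞ f) (hg : ContDiff ℝ ∞ g) :
    D2 (fun x => f x + g x) = fun x => D2 f x + D2 g x := by
  ext p; simp only [D2]
  rw [fderiv_fun_add (sm_diff hf p) (sm_diff hg p)]; rfl

theorem D1_sub (hf : ContDiff ℝ ∞ f) (hg : ContDiff ℝ ∞ g) :
    D1 (fun x => f x - g x) = fun x => D1 f x - D1 g x := by
  ext p; simp only [D1]
  rw [fderiv_fun_sub (sm_diff hf p) (sm_diff hg p)]; rfl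

theorem D2_sub (hf : ContDiff ℝ ∞ f) (hg : ContDiff ℝ ∞ g) :
    D2 (fun x => f x - g x) = fun x => D2 f x - D2 g x := by
  ext p; simp only [D2]
  rw [fderiv_fun_sub (sm_diff hf p) (sm_diff hg p)]; rfl

theorem D1_neg : D1 (fun x => - f x) = fun x => - D1 f x := by
  ext p; simp only [D1]
  rw [fderiv_fun_neg]; rfl

theorem D2_neg : D2 (fun x => - f x) = fun x => - D2 f x := by
  ext p; simp only [D2]
  rw [fderiv_fun_neg]; rfl

theorem D1_mul (hf : ContDiff ℝ ∞ f) (hg : ContDiff ℝ ∞ g) :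
    D1 (fun x => f x * g x) = fun x => f x * D1 g x + g x * D1 f x := by
  ext p; simp only [D1]
  rw [fderiv_fun_mul (sm_diff hf p) (sm_diff hg p)]; rfl

theorem D2_mul (hf : ContDiff ℝ ∞ f) (hg : ContDiff ℝ ∞ g) :
    D2 (fun x => f x * g x) = fun x => f x * D2 g x + g x * D2 f x := by
  ext p; simp only [D2]
  rw [fderiv_fun_mul (sm_diff hf p) (sm_diff hg p)]; rfl

theorem D1_pow (n : ℕ) (hf : ContDiff ℝ ∞ f) :
    D1 (fun x => f x ^ n) = fun x => n * f x ^ (n - 1) * D1 f x := by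
  ext p; simp only [D1]
  rw [((sm_diff hf p).hasFDerivAt.pow n).fderiv]; simp

theorem D2_pow (n : ℕ) (hf : ContDiff ℝ ∞ f) :
    D2 (fun x => f x ^ n) = fun x => n * f x ^ (n - 1) * D2 f x := by
  ext p; simp only [D2]
  rw [((sm_diff hf p).hasFDerivAt.pow n).fderiv]; simp

theorem D1_exp (hf : ContDiff ℝ ∞ f) :
    D1 (fun x => Real.exp (f x)) = fun x => Real.exp (f x) * D1 f x := by
  ext p; simp only [D1]
  rw [((sm_diff hf p).hasFDerivAt.exp).fderiv]; simp

theorem D2_exp (hf : ContDiff ℝ ∞ f) :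
    D2 (fun x => Real.exp (f x)) = fun x => Real.exp (f x) * D2 f x := by
  ext p; simp only [D2]
  rw [((sm_diff hf p).hasFDerivAt.exp).fderiv]; simp

theorem fderiv_D_comm (hf : ContDiff ℝ ∞ f) (p : ℝ × ℝ) : D1 (D2 f) p = D2 (D1 f) p := by
  have hd : DifferentiableAt ℝ (fderiv ℝ f) p :=
    (hf.fderiv_right (m := ∞) (by simp)).differentiable (by simp) p
  have h1 : ∀ v w : ℝ × ℝ, fderiv ℝ (fun q => fderiv ℝ f q v) p w
      = fderiv ℝ (fderiv ℝ f) p w v := by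
    intro v w
    rw [fderiv_clm_apply hd (differentiableAt_const v)]
    simp
  have hs : IsSymmSndFDerivAt ℝ f p := by
    apply ContDiffAt.isSymmSndFDerivAt (n := ∞) hf.contDiffAt
    simp
    exact WithTop.coe_le_coe.2 le_top
  have := hs.eq (1, 0) (0, 1)
  unfold D1 D2
  rw [h1, h1]
  exact this

theorem D12_comm (hf : ContDiff ℝ ∞ f) : D1 (D2 f) = D2 (D1 f) := by
  ext p; exact fderiv_D_comm hf p

theorem lap_eq (hf : ContDiff ℝ ∞ f) (p : ℝ × ℝ) : lap f p = D1 (D1 f) p + D2 (D2 f) p := by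
  have hd : DifferentiableAt ℝ (fderiv ℝ f) p :=
    (hf.fderiv_right (m := ∞) (by simp)).differentiable (by simp) p
  have h1 : ∀ v w : ℝ × ℝ, fderiv ℝ (fun q => fderiv ℝ f q v) p w
      = fderiv ℝ (fderiv ℝ f) p w v := by
    intro v w
    rw [fderiv_clm_apply hd (differentiableAt_const v)]
    simp
  unfold lap D1 D2
  rw [iteratedFDeriv_two_apply, iteratedFDeriv_two_apply, h1, h1]
  simp

end rules

/-! ### The conformal factor -/

/-- `1 / (1 + |y|²)` -/
def tau (p : ℝ × ℝ) : ℝ := (1 + p.1 ^ 2 + p.2 ^ 2)⁻¹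

theorem sig_pos (p : ℝ × ℝ) : 0 < 1 + p.1 ^ 2 + p.2 ^ 2 := by positivity

theorem tau_pos (p : ℝ × ℝ) : 0 < tau p := inv_pos.2 (sig_pos p)

theorem tau_mul (p : ℝ × ℝ) : tau p * (1 + p.1 ^ 2 + p.2 ^ 2) = 1 :=
  inv_mul_cancel₀ (sig_pos p).ne'

@[fun_prop]
theorem contDiff_tau : ContDiff ℝ ∞ tau := by
  unfold tau
  exact ContDiff.inv (by fun_prop) (fun p => (sig_pos p).ne')

theorem D1_tau : D1 tau = fun p => -(2 * p.1 * tau p ^ 2) := by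
  have h : (fun p : ℝ × ℝ => tau p * (1 + p.1 ^ 2 + p.2 ^ 2)) = fun _ => 1 := by
    ext p; exact tau_mul p
  have h2 : D1 (fun p : ℝ × ℝ => tau p * (1 + p.1 ^ 2 + p.2 ^ 2)) = fun _ => 0 := by
    rw [h, D1_const]
  simp (disch := fun_prop) only [D1_mul, D1_add, D1_pow, D1_const, D1_fst, D1_snd] at h2
  ext p
  have h3 := congrFun h2 p
  have h4 := tau_mul p
  norm_num at h3
  linear_combination tau p * h3 - D1 tau p * h4

theorem D2_tau : D2 tau = fun p => -(2 * p.2 * tau p ^ 2) := by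
  have h : (fun p : ℝ × ℝ => tau p * (1 + p.1 ^ 2 + p.2 ^ 2)) = fun _ => 1 := by
    ext p; exact tau_mul p
  have h2 : D2 (fun p : ℝ × ℝ => tau p * (1 + p.1 ^ 2 + p.2 ^ 2)) = fun _ => 0 := by
    rw [h, D2_const]
  simp (disch := fun_prop) only [D2_mul, D2_add, D2_pow, D2_const, D2_fst, D2_snd] at h2
  ext p
  have h3 := congrFun h2 p
  have h4 := tau_mul p
  norm_num at h3
  linear_combination tau p * h3 - D2 tau p * h4

open scoped ContDiff

/-- `4/(1+|y|²)²`. -/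
def rho (p : ℝ × ℝ) : ℝ := 4 * tau p ^ 2

theorem rho_pos (p : ℝ × ℝ) : 0 < rho p := by unfold rho; have := tau_pos p; positivity

@[fun_prop]
theorem contDiff_rho : ContDiff ℝ ∞ rho := by unfold rho; fun_prop

theorem D1_rho : D1 rho = fun p => -(4 * p.1 * tau p) * rho p := by
  unfold rho
  simp (disch := fun_prop) only [D1_mul, D1_pow, D1_const, D1_tau]
  ext p; simp; ring

theorem D2_rho : D2 rho = fun p => -(4 * p.2 * tau p) * rho p := by
  unfold rho
  simp (disch := fun_prop) only [D2_mul, D2_pow, D2_const, D2_tau]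
  ext p; simp; ring

/-- Flat Laplacian via partial derivatives. -/
def Lap (f : ℝ × ℝ → ℝ) (p : ℝ × ℝ) : ℝ := D1 (D1 f) p + D2 (D2 f) p

/-- inversion in the unit circle -/
def inv2 (p : ℝ × ℝ) : ℝ × ℝ := (p.1 / (p.1 ^ 2 + p.2 ^ 2), p.2 / (p.1 ^ 2 + p.2 ^ 2))

/-- Smooth planar solutions with all reflection symmetries. -/
structure PS (lam : ℝ) (u : ℝ × ℝ → ℝ) : Prop where
  sm : ContDiff ℝ ∞ u
  pde : ∀ p, Lap u p = lam * rho p * (1 - Real.exp (u p))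
  ev1 : ∀ p : ℝ × ℝ, u (-p.1, p.2) = u p
  ev2 : ∀ p : ℝ × ℝ, u (p.1, -p.2) = u p
  inv : ∀ p : ℝ × ℝ, p ≠ 0 → u (inv2 p) = u p

/-- Solutions of the linearized equation. -/
structure LS (lam : ℝ) (u f : ℝ × ℝ → ℝ) : Prop where
  sm : ContDiff ℝ ∞ f
  pde : ∀ p, Lap f p + lam * rho p * Real.exp (u p) * f p = 0

def phi1 (u : ℝ × ℝ → ℝ) (p : ℝ × ℝ) : ℝ :=
  -(p.1 * p.2 * D1 u p) - 2⁻¹ * (1 - p.1 ^ 2 + p.2 ^ 2) * D2 u p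
def phi2 (u : ℝ × ℝ → ℝ) (p : ℝ × ℝ) : ℝ :=
  2⁻¹ * (1 + p.1 ^ 2 - p.2 ^ 2) * D1 u p + p.1 * p.2 * D2 u p
def phi3 (u : ℝ × ℝ → ℝ) (p : ℝ × ℝ) : ℝ := p.1 * D2 u p - p.2 * D1 u p

theorem phi_rel (u : ℝ × ℝ → ℝ) (p : ℝ × ℝ) :
    2 * p.1 * phi1 u p + 2 * p.2 * phi2 u p + (1 - p.1 ^ 2 - p.2 ^ 2) * phi3 u p = 0 := by
  unfold phi1 phi2 phi3; ring

theorem pde_D {lam : ℝ} {u : ℝ × ℝ → ℝ} (hs : ContDiff ℝ ∞ u)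
    (h : ∀ p, Lap u p = lam * rho p * (1 - Real.exp (u p))) (p : ℝ × ℝ) :
    (D1 (D1 (D1 u)) p + D2 (D2 (D1 u)) p =
      lam * rho p * (-(4 * p.1 * tau p) * (1 - Real.exp (u p)) - Real.exp (u p) * D1 u p)) ∧
    (D2 (D1 (D1 u)) p + D2 (D2 (D2 u)) p =
      lam * rho p * (-(4 * p.2 * tau p) * (1 - Real.exp (u p)) - Real.exp (u p) * D2 u p)) := by
  have h0 : (fun p => D1 (D1 u) p + D2 (D2 u) p) =
    fun p => lam * rho p * (1 - Real.exp (u p)) := by ext p; exact h p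
  have h1 := congrArg D1 h0
  have h2 := congrArg D2 h0
  simp (disch := fun_prop) only [D1_mul, D1_add, D1_sub, D1_const, D1_rho, D1_exp, D12_comm] at h1
  simp (disch := fun_prop) only [D2_mul, D2_add, D2_sub, D2_const, D2_rho, D2_exp] at h2
  have e1 := congrFun h1 p
  have e2 := congrFun h2 p
  constructor
  · rw [e1]; ring
  · rw [e2]; ring

theorem LS_phi3 {lam : ℝ} {u : ℝ × ℝ → ℝ} (h : PS lam u) : LS lam u (phi3 u) := by
  have hs := h.sm
  refine ⟨by unfold phi3; fun_prop, fun p => ?_⟩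
  obtain ⟨e1, e2⟩ := pde_D hs h.pde p
  unfold Lap phi3
  simp (disch := fun_prop) only [D1_mul, D1_add, D1_sub, D1_const, D1_fst, D1_snd, D12_comm,
    D2_mul, D2_add, D2_sub, D2_const, D2_fst, D2_snd]
  linear_combination p.1 * e2 - p.2 * e1

theorem LS_phi1 {lam : ℝ} {u : ℝ × ℝ → ℝ} (h : PS lam u) : LS lam u (phi1 u) := by
  have hs := h.sm
  refine ⟨by unfold phi1; fun_prop, fun p => ?_⟩
  obtain ⟨e1, e2⟩ := pde_D hs h.pde p
  have e0 := h.pde p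
  unfold Lap at e0
  have ht := tau_mul p
  unfold Lap phi1
  simp (disch := fun_prop) only [D1_mul, D1_add, D1_sub, D1_const, D1_fst, D1_snd, D12_comm,
    D2_mul, D2_add, D2_sub, D2_const, D2_fst, D2_snd, D1_pow, D2_pow, D1_neg, D2_neg]
  norm_num
  linear_combination (-(p.1 * p.2)) * e1 - 2⁻¹ * (1 - p.1 ^ 2 + p.2 ^ 2) * e2 - 2 * p.2 * e0
    + 2 * p.2 * lam * rho p * (1 - Real.exp (u p)) * ht

theorem LS_phi2 {lam : ℝ} {u : ℝ × ℝ → ℝ} (h : PS lam u) : LS lam u (phi2 u) := by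
  have hs := h.sm
  refine ⟨by unfold phi2; fun_prop, fun p => ?_⟩
  obtain ⟨e1, e2⟩ := pde_D hs h.pde p
  have e0 := h.pde p
  unfold Lap at e0
  have ht := tau_mul p
  unfold Lap phi2
  simp (disch := fun_prop) only [D1_mul, D1_add, D1_sub, D1_const, D1_fst, D1_snd, D12_comm,
    D2_mul, D2_add, D2_sub, D2_const, D2_fst, D2_snd, D1_pow, D2_pow, D1_neg, D2_neg]
  norm_num
  linear_combination ((p.1 * p.2)) * e2 + 2⁻¹ * (1 + p.1 ^ 2 - p.2 ^ 2) * e1 + 2 * p.1 * e0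
    - 2 * p.1 * lam * rho p * (1 - Real.exp (u p)) * ht

open scoped ContDiff

theorem hasFDerivAt_D {f : ℝ × ℝ → ℝ} {p : ℝ × ℝ} (hf : DifferentiableAt ℝ f p) :
    HasFDerivAt f (D1 f p • ContinuousLinearMap.fst ℝ ℝ ℝ + D2 f p • ContinuousLinearMap.snd ℝ ℝ ℝ)
      p := by
  convert hf.hasFDerivAt using 1
  ext <;> simp [D1, D2]

theorem D_comp {f a b : ℝ × ℝ → ℝ} {p : ℝ × ℝ} (hf : DifferentiableAt ℝ f (a p, b p))
    (ha : DifferentiableAt ℝ a p) (hb : DifferentiableAt ℝ b p) :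
    D1 (fun q => f (a q, b q)) p = D1 f (a p, b p) * D1 a p + D2 f (a p, b p) * D1 b p ∧
    D2 (fun q => f (a q, b q)) p = D1 f (a p, b p) * D2 a p + D2 f (a p, b p) * D2 b p := by
  have h := (hasFDerivAt_D hf).comp p ((hasFDerivAt_D ha).prodMk (hasFDerivAt_D hb))
  have h' : fderiv ℝ (fun q => f (a q, b q)) p = _ := h.fderiv
  constructor
  · rw [D1, h']; simp [D1]
  · rw [D2, h']; simp [D2]

theorem D_congr {f g : ℝ × ℝ → ℝ} {p : ℝ × ℝ} (h : f =ᶠ[nhds p] g) :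
    D1 f p = D1 g p ∧ D2 f p = D2 g p := by
  unfold D1 D2; rw [h.fderiv_eq]; exact ⟨rfl, rfl⟩

theorem D1_smul' {f : ℝ × ℝ → ℝ} (c : ℝ) (p : ℝ × ℝ) : D1 (fun x => c * f x) p = c * D1 f p := by
  unfold D1
  rw [show (fun x => c * f x) = c • f from rfl, fderiv_const_smul_field]; rfl

theorem D2_smul' {f : ℝ × ℝ → ℝ} (c : ℝ) (p : ℝ × ℝ) : D2 (fun x => c * f x) p = c * D2 f p := by
  unfold D2
  rw [show (fun x => c * f x) = c • f from rfl, fderiv_const_smul_field]; rfl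

theorem par1 {f : ℝ × ℝ → ℝ} (hf : ContDiff ℝ ∞ f) {s : ℝ}
    (h : ∀ p : ℝ × ℝ, f (-p.1, p.2) = s * f p) (p : ℝ × ℝ) :
    D1 f (-p.1, p.2) = -(s * D1 f p) ∧ D2 f (-p.1, p.2) = s * D2 f p := by
  have hd := sm_diff hf
  have h0 : (fun q : ℝ × ℝ => f (-q.1, q.2)) = fun q => s * f q := funext h
  have := D_comp (f := f) (a := fun q => -q.1) (b := fun q => q.2) (p := p) (hd _)
    (by fun_prop) (by fun_prop)
  rw [h0, D1_smul', D2_smul'] at this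
  simp only [D1_neg, D2_neg, D1_fst, D1_snd, D2_fst, D2_snd] at this
  constructor <;> linarith [this.1, this.2]

theorem par2 {f : ℝ × ℝ → ℝ} (hf : ContDiff ℝ ∞ f) {s : ℝ}
    (h : ∀ p : ℝ × ℝ, f (p.1, -p.2) = s * f p) (p : ℝ × ℝ) :
    D1 f (p.1, -p.2) = s * D1 f p ∧ D2 f (p.1, -p.2) = -(s * D2 f p) := by
  have hd := sm_diff hf
  have h0 : (fun q : ℝ × ℝ => f (q.1, -q.2)) = fun q => s * f q := funext h
  have := D_comp (f := f) (a := fun q => q.1) (b := fun q => -q.2) (p := p) (hd _)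
    (by fun_prop) (by fun_prop)
  rw [h0, D1_smul', D2_smul'] at this
  simp only [D1_neg, D2_neg, D1_fst, D1_snd, D2_fst, D2_snd] at this
  constructor <;> linarith [this.1, this.2]

theorem nsq_pos {p : ℝ × ℝ} (hp : p ≠ 0) : 0 < p.1 ^ 2 + p.2 ^ 2 := by
  rcases eq_or_ne p.1 0 with h | h
  · have : p.2 ≠ 0 := fun h2 => hp (Prod.ext h h2)
    positivity
  · positivity

theorem inv2_ne {p : ℝ × ℝ} (hp : p ≠ 0) : inv2 p ≠ 0 := by
  have := nsq_pos hp
  intro h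
  apply hp
  have h1 := congrArg Prod.fst h
  have h2 := congrArg Prod.snd h
  simp only [inv2, Prod.fst_zero, Prod.snd_zero, div_eq_zero_iff, this.ne', or_false] at h1 h2
  exact Prod.ext h1 h2

theorem inv2_nsq {p : ℝ × ℝ} (hp : p ≠ 0) :
    (inv2 p).1 ^ 2 + (inv2 p).2 ^ 2 = (p.1 ^ 2 + p.2 ^ 2)⁻¹ := by
  have := nsq_pos hp
  simp only [inv2]; field_simp

theorem inv2_inv2 {p : ℝ × ℝ} (hp : p ≠ 0) : inv2 (inv2 p) = p := by
  have := nsq_pos hp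
  have h := inv2_nsq hp
  rw [inv2, h]
  simp only [inv2]
  ext <;> simp <;> field_simp

theorem par_inv {f : ℝ × ℝ → ℝ} (hf : ContDiff ℝ ∞ f) {s : ℝ}
    (h : ∀ p : ℝ × ℝ, p ≠ 0 → f (inv2 p) = s * f p) {p : ℝ × ℝ} (hp : p ≠ 0) :
    s * D1 f p * (p.1 ^ 2 + p.2 ^ 2) ^ 2 =
      D1 f (inv2 p) * (p.2 ^ 2 - p.1 ^ 2) - D2 f (inv2 p) * (2 * p.1 * p.2) ∧
    s * D2 f p * (p.1 ^ 2 + p.2 ^ 2) ^ 2 =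
      D2 f (inv2 p) * (p.1 ^ 2 - p.2 ^ 2) - D1 f (inv2 p) * (2 * p.1 * p.2) := by
  have hd := sm_diff hf
  have hn := nsq_pos hp
  set a : ℝ × ℝ → ℝ := fun q => q.1 / (q.1 ^ 2 + q.2 ^ 2) with ha
  set b : ℝ × ℝ → ℝ := fun q => q.2 / (q.1 ^ 2 + q.2 ^ 2) with hb
  have hN : HasFDerivAt (fun q : ℝ × ℝ => q.1 ^ 2 + q.2 ^ 2)
      ((2 * p.1) • ContinuousLinearMap.fst ℝ ℝ ℝ + (2 * p.2) • ContinuousLinearMap.snd ℝ ℝ ℝ) p := by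
    have h1 := ((hasFDerivAt_fst (𝕜 := ℝ) (p := p)).pow 2).add ((hasFDerivAt_snd (𝕜 := ℝ) (p := p)).pow 2)
    exact h1.congr_fderiv (by ext <;> simp)
  have hI := (hasDerivAt_inv hn.ne').comp_hasFDerivAt p hN
  have da : HasFDerivAt a _ p := (hasFDerivAt_fst (𝕜 := ℝ) (p := p)).mul hI
  have db : HasFDerivAt b _ p := (hasFDerivAt_snd (𝕜 := ℝ) (p := p)).mul hI
  have h0 : (fun q : ℝ × ℝ => f (a q, b q)) =ᶠ[nhds p] fun q => s * f q := by
    filter_upwards [isOpen_ne.mem_nhds hp] with q hq using h q hq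
  have := D_comp (f := f) (a := a) (b := b) (p := p) (hd _)
    da.differentiableAt db.differentiableAt
  rw [(D_congr h0).1, (D_congr h0).2, D1_smul', D2_smul'] at this
  have e1 : D1 a p = (p.2 ^ 2 - p.1 ^ 2) / (p.1 ^ 2 + p.2 ^ 2) ^ 2 := by
    rw [D1, da.fderiv]; simp; field_simp; ring
  have e2 : D2 a p = -(2 * p.1 * p.2) / (p.1 ^ 2 + p.2 ^ 2) ^ 2 := by
    rw [D2, da.fderiv]; simp; field_simp
  have e3 : D1 b p = -(2 * p.1 * p.2) / (p.1 ^ 2 + p.2 ^ 2) ^ 2 := by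
    rw [D1, db.fderiv]; simp; field_simp
  have e4 : D2 b p = (p.1 ^ 2 - p.2 ^ 2) / (p.1 ^ 2 + p.2 ^ 2) ^ 2 := by
    rw [D2, db.fderiv]; simp; field_simp; ring
  rw [e1, e2, e3, e4] at this
  have hi : (a p, b p) = inv2 p := rfl
  rw [hi] at this
  constructor
  · rw [this.1]; field_simp; ring
  · rw [this.2]; field_simp; ring

section par
variable {lam : ℝ} {u : ℝ × ℝ → ℝ}

theorem PS.d1 (h : PS lam u) (p : ℝ × ℝ) :
    D1 u (-p.1, p.2) = -D1 u p ∧ D2 u (-p.1, p.2) = D2 u p := by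
  have := par1 h.sm (s := 1) (by simpa using h.ev1) p
  simpa using this

theorem PS.d2 (h : PS lam u) (p : ℝ × ℝ) :
    D1 u (p.1, -p.2) = D1 u p ∧ D2 u (p.1, -p.2) = -D2 u p := by
  have := par2 h.sm (s := 1) (by simpa using h.ev2) p
  simpa using this

theorem phi1_ev1 (h : PS lam u) (p : ℝ × ℝ) : phi1 u (-p.1, p.2) = phi1 u p := by
  simp only [phi1, h.d1 p]; ring
theorem phi1_od2 (h : PS lam u) (p : ℝ × ℝ) : phi1 u (p.1, -p.2) = -phi1 u p := by
  simp only [phi1, h.d2 p]; ring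
theorem phi2_od1 (h : PS lam u) (p : ℝ × ℝ) : phi2 u (-p.1, p.2) = -phi2 u p := by
  simp only [phi2, h.d1 p]; ring
theorem phi2_ev2 (h : PS lam u) (p : ℝ × ℝ) : phi2 u (p.1, -p.2) = phi2 u p := by
  simp only [phi2, h.d2 p]; ring
theorem phi3_od1 (h : PS lam u) (p : ℝ × ℝ) : phi3 u (-p.1, p.2) = -phi3 u p := by
  simp only [phi3, h.d1 p]; ring
theorem phi3_od2 (h : PS lam u) (p : ℝ × ℝ) : phi3 u (p.1, -p.2) = -phi3 u p := by
  simp only [phi3, h.d2 p]; ring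

theorem PS.di (h : PS lam u) {p : ℝ × ℝ} (hp : p ≠ 0) :
    D1 u (inv2 p) = D1 u p * (p.2 ^ 2 - p.1 ^ 2) - D2 u p * (2 * p.1 * p.2) ∧
    D2 u (inv2 p) = D2 u p * (p.1 ^ 2 - p.2 ^ 2) - D1 u p * (2 * p.1 * p.2) := by
  have hn := nsq_pos hp
  have h1 := par_inv h.sm (s := 1) (by simpa using h.inv) (inv2_ne hp)
  rw [inv2_inv2 hp, inv2_nsq hp] at h1
  simp only [inv2] at h1 ⊢
  constructor
  · have := h1.1
    field_simp at this
    linarith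
  · have := h1.2
    field_simp at this
    linarith

theorem phi1_inv (h : PS lam u) {p : ℝ × ℝ} (hp : p ≠ 0) : phi1 u (inv2 p) = -phi1 u p := by
  have hn := nsq_pos hp
  simp only [phi1, h.di hp]
  simp only [inv2]; field_simp; ring
theorem phi2_inv (h : PS lam u) {p : ℝ × ℝ} (hp : p ≠ 0) : phi2 u (inv2 p) = -phi2 u p := by
  have hn := nsq_pos hp
  simp only [phi2, h.di hp]
  simp only [inv2]; field_simp; ring
theorem phi3_inv (h : PS lam u) {p : ℝ × ℝ} (hp : p ≠ 0) : phi3 u (inv2 p) = phi3 u p := by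
  have hn := nsq_pos hp
  simp only [phi3, h.di hp]
  simp only [inv2]; field_simp; ring
end par

theorem grad_inv {f : ℝ × ℝ → ℝ} (hf : ContDiff ℝ ∞ f) {s : ℝ} (hs : s ^ 2 = 1)
    (h : ∀ p : ℝ × ℝ, p ≠ 0 → f (inv2 p) = s * f p) {p : ℝ × ℝ} (hp : p ≠ 0) :
    D1 f (inv2 p) ^ 2 + D2 f (inv2 p) ^ 2 =
      (p.1 ^ 2 + p.2 ^ 2) ^ 2 * (D1 f p ^ 2 + D2 f p ^ 2) := by
  have hn := nsq_pos hp
  obtain ⟨h1, h2⟩ := par_inv hf h hp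
  have h3 : (s * D1 f p * (p.1 ^ 2 + p.2 ^ 2) ^ 2) ^ 2 + (s * D2 f p * (p.1 ^ 2 + p.2 ^ 2) ^ 2) ^ 2
    = (D1 f (inv2 p) ^ 2 + D2 f (inv2 p) ^ 2) * (p.1 ^ 2 + p.2 ^ 2) ^ 2 := by
    rw [h1, h2]; ring
  have h4 : (p.1 ^ 2 + p.2 ^ 2) ^ 2 ≠ 0 := by positivity
  apply mul_right_cancel₀ h4
  rw [← h3]
  linear_combination (D1 f p ^ 2 + D2 f p ^ 2) * (p.1 ^ 2 + p.2 ^ 2) ^ 4 * hs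

theorem tau_inv {p : ℝ × ℝ} (hp : p ≠ 0) : tau (inv2 p) = (p.1 ^ 2 + p.2 ^ 2) * tau p := by
  have hn := nsq_pos hp
  have := inv2_nsq hp
  unfold tau
  rw [add_assoc, this]
  field_simp
  ring

open scoped ContDiff

/-- energy density -/
def Qf (k : ℝ) (u f : ℝ × ℝ → ℝ) (p : ℝ × ℝ) : ℝ :=
  D1 f p ^ 2 + D2 f p ^ 2 + k * (rho p * Real.exp (u p)) * f p ^ 2

@[fun_prop]
theorem contDiff_Qf {k : ℝ} {u f : ℝ × ℝ → ℝ} (hu : ContDiff ℝ ∞ u) (hf : ContDiff ℝ ∞ f) :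
    ContDiff ℝ ∞ (Qf k u f) := by unfold Qf; fun_prop

theorem Q_alg (f f1 f2 f11 f12 f22 f111 f112 f122 f222 w1 w2 w11 w22 E nu lam e k : ℝ)
    (hk : k = lam / 2 + e)
    (h0 : f11 + f22 + lam * E * f = 0)
    (h1 : f111 + f122 + lam * (E * w1 * f + E * f1) = 0)
    (h2 : f112 + f222 + lam * (E * w2 * f + E * f2) = 0)
    (hw : w11 + w22 = nu - lam * E) :
    k * ((f1 ^ 2 + f2 ^ 2 + k * E * f ^ 2) *
      ((2 * (f11 ^ 2 + f1 * f111) + 2 * (f12 ^ 2 + f2 * f112) +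
        k * (E * (w11 + w1 ^ 2) * f ^ 2 + 4 * E * w1 * f * f1 + 2 * E * f1 ^ 2 + 2 * E * f * f11)) +
       (2 * (f12 ^ 2 + f1 * f122) + 2 * (f22 ^ 2 + f2 * f222) +
        k * (E * (w22 + w2 ^ 2) * f ^ 2 + 4 * E * w2 * f * f2 + 2 * E * f2 ^ 2 + 2 * E * f * f22)))
      - (2 * f1 * f11 + 2 * f2 * f12 + k * (E * w1 * f ^ 2 + 2 * E * f * f1)) ^ 2
      - (2 * f1 * f12 + 2 * f2 * f22 + k * (E * w2 * f ^ 2 + 2 * E * f * f2)) ^ 2) =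
    2 * ((f1 ^ 2 + f2 ^ 2 + k * E * f ^ 2) * (-(lam / 2) * k * E * (f1 ^ 2 + f2 ^ 2 + k * E * f ^ 2)
      + k * f ^ 2 * E * (k * nu / 2 - lam * e * E) + (f1 ^ 2 + f2 ^ 2) * E * (k * e - 2 * e ^ 2)))
    + 4 * E * ((k * f * ((f11 - f22) / 2 - (w1 * f1 - w2 * f2) / 2) - e * (f1 ^ 2 - f2 ^ 2)) ^ 2
      + (k * f * (f12 - (w1 * f2 + w2 * f1) / 2) - 2 * e * f1 * f2) ^ 2) := by
  have a1 : f11 = -f22 - lam * E * f := by linarith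
  have a2 : f111 = -f122 - lam * (E * w1 * f + E * f1) := by linarith
  have a3 : f222 = -f112 - lam * (E * w2 * f + E * f2) := by linarith
  have a4 : w11 = nu - lam * E - w22 := by linarith
  subst a1 a2 a3 a4 hk
  ring

theorem Q_ineq {lam : ℝ} {u f : ℝ × ℝ → ℝ} (hu : ContDiff ℝ ∞ u)
    (hpde : ∀ p, Lap u p = lam * rho p * (1 - Real.exp (u p))) (hf : LS lam u f)
    {k e δ : ℝ} (hk : k = lam / 2 + e) (hk0 : 0 < k) (p : ℝ × ℝ)
    (hc1 : (lam * e + k * δ) * Real.exp (u p) ≤ k * (lam / 2 - 1))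
    (hc2 : k * δ ≤ k * e - 2 * e ^ 2) :
    (-lam + 2 * δ) * (rho p * Real.exp (u p)) * Qf k u f p ^ 2 ≤
      Qf k u f p * Lap (Qf k u f) p - (D1 (Qf k u f) p ^ 2 + D2 (Qf k u f) p ^ 2) := by
  have hfs := hf.sm
  have h00 : (fun p => D1 (D1 f) p + D2 (D2 f) p + lam * rho p * Real.exp (u p) * f p) =
    fun _ => 0 := funext hf.pde
  have g1 := congrFun (congrArg D1 h00) p
  have g2 := congrFun (congrArg D2 h00) p
  simp (disch := fun_prop) only [D1_mul, D1_add, D1_sub, D1_const, D1_rho, D1_exp, D12_comm] at g1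
  simp (disch := fun_prop) only [D2_mul, D2_add, D2_sub, D2_const, D2_rho, D2_exp] at g2
  have g0 := hf.pde p
  have gu := hpde p
  have ht := tau_mul p
  have key := Q_alg (f p) (D1 f p) (D2 f p) (D1 (D1 f) p) (D2 (D1 f) p) (D2 (D2 f) p)
    (D1 (D1 (D1 f)) p) (D2 (D1 (D1 f)) p) (D2 (D2 (D1 f)) p) (D2 (D2 (D2 f)) p)
    (D1 u p - 4 * p.1 * tau p) (D2 u p - 4 * p.2 * tau p)
    (D1 (D1 u) p - 4 * tau p + 8 * p.1 ^ 2 * tau p ^ 2)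
    (D2 (D2 u) p - 4 * tau p + 8 * p.2 ^ 2 * tau p ^ 2)
    (rho p * Real.exp (u p)) ((lam - 2) * rho p) lam e k hk
    (by unfold Lap at g0; linarith) (by linear_combination g1) (by linear_combination g2)
    (by
      unfold Lap at gu
      have hr : rho p = 4 * tau p ^ 2 := rfl
      have h8 : -(8 * tau p) + 8 * (p.1 ^ 2 + p.2 ^ 2) * tau p ^ 2 = -2 * rho p := by
        rw [hr]; linear_combination (8 * tau p) * ht
      linear_combination gu + h8)
  set E := rho p * Real.exp (u p) with hE
  have hEpos : 0 < E := mul_pos (rho_pos p) (Real.exp_pos _)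
  have q0 : Qf k u f p = D1 f p ^ 2 + D2 f p ^ 2 + k * E * f p ^ 2 := rfl
  have q1 : D1 (Qf k u f) p = 2 * D1 f p * D1 (D1 f) p + 2 * D2 f p * D2 (D1 f) p +
      k * (E * (D1 u p - 4 * p.1 * tau p) * f p ^ 2 + 2 * E * f p * D1 f p) := by
    unfold Qf
    simp (disch := fun_prop) only [D1_mul, D1_add, D1_pow, D1_const, D1_rho, D1_exp, D12_comm]
    rw [hE]; push_cast; ring
  have q2 : D2 (Qf k u f) p = 2 * D1 f p * D2 (D1 f) p + 2 * D2 f p * D2 (D2 f) p +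
      k * (E * (D2 u p - 4 * p.2 * tau p) * f p ^ 2 + 2 * E * f p * D2 f p) := by
    unfold Qf
    simp (disch := fun_prop) only [D2_mul, D2_add, D2_pow, D2_const, D2_rho, D2_exp]
    rw [hE]; push_cast; ring
  have q11 : D1 (D1 (Qf k u f)) p = 2 * (D1 (D1 f) p ^ 2 + D1 f p * D1 (D1 (D1 f)) p) +
      2 * (D2 (D1 f) p ^ 2 + D2 f p * D2 (D1 (D1 f)) p) +
      k * (E * (D1 (D1 u) p - 4 * tau p + 8 * p.1 ^ 2 * tau p ^ 2 +
        (D1 u p - 4 * p.1 * tau p) ^ 2) * f p ^ 2 +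
        4 * E * (D1 u p - 4 * p.1 * tau p) * f p * D1 f p + 2 * E * D1 f p ^ 2 +
        2 * E * f p * D1 (D1 f) p) := by
    unfold Qf
    simp (disch := fun_prop) only [D1_mul, D1_add, D1_pow, D1_neg, D1_const, D1_rho, D1_exp,
      D1_tau, D1_fst, D12_comm]
    rw [hE]; push_cast; ring
  have q22 : D2 (D2 (Qf k u f)) p = 2 * (D2 (D1 f) p ^ 2 + D1 f p * D2 (D2 (D1 f)) p) +
      2 * (D2 (D2 f) p ^ 2 + D2 f p * D2 (D2 (D2 f)) p) +
      k * (E * (D2 (D2 u) p - 4 * tau p + 8 * p.2 ^ 2 * tau p ^ 2 +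
        (D2 u p - 4 * p.2 * tau p) ^ 2) * f p ^ 2 +
        4 * E * (D2 u p - 4 * p.2 * tau p) * f p * D2 f p + 2 * E * D2 f p ^ 2 +
        2 * E * f p * D2 (D2 f) p) := by
    unfold Qf
    simp (disch := fun_prop) only [D2_mul, D2_add, D2_pow, D2_neg, D2_const, D2_rho, D2_exp,
      D2_tau, D2_snd]
    rw [hE]; push_cast; ring
  have hQ0 : 0 ≤ D1 f p ^ 2 + D2 f p ^ 2 + k * E * f p ^ 2 := by positivity
  rw [Lap, q11, q22, q1, q2, q0, ← sub_sub]
  rw [← mul_le_mul_iff_right₀ hk0, key]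
  have b1 : k * δ * E ≤ k * ((lam - 2) * rho p) / 2 - lam * e * E := by
    have := mul_le_mul_of_nonneg_left hc1 (rho_pos p).le
    rw [hE]; linarith
  have b2 : k * f p ^ 2 * E * (k * δ * E) ≤
      k * f p ^ 2 * E * (k * ((lam - 2) * rho p) / 2 - lam * e * E) :=
    mul_le_mul_of_nonneg_left b1 (by positivity)
  have b3 : (D1 f p ^ 2 + D2 f p ^ 2) * E * (k * δ) ≤
      (D1 f p ^ 2 + D2 f p ^ 2) * E * (k * e - 2 * e ^ 2) :=
    mul_le_mul_of_nonneg_left hc2 (by positivity)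
  have b4 := mul_le_mul_of_nonneg_left (add_le_add b2 b3) hQ0
  refine le_trans ?_ (le_add_of_nonneg_right (by positivity))
  linarith

open scoped ContDiff Topology

theorem second_deriv_nonneg {g : ℝ → ℝ} {x : ℝ} (hg : IsLocalMin g x) (hc : ContinuousAt g x) :
    0 ≤ deriv (deriv g) x := by
  by_contra hneg
  push Not at hneg
  have hmax := isLocalMax_of_deriv_deriv_neg hneg hg.deriv_eq_zero hc
  have hconst : g =ᶠ[𝓝 x] fun _ => g x := by
    filter_upwards [hg, hmax] with y h1 h2 using le_antisymm h2 h1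
  have h1 : deriv g =ᶠ[𝓝 x] fun _ => 0 := by
    have := hconst.deriv
    simpa using this
  have := h1.deriv_eq
  simp at this
  linarith

theorem line_deriv {f : ℝ × ℝ → ℝ} (hf : ContDiff ℝ ∞ f) (p v : ℝ × ℝ) (t : ℝ) :
    HasDerivAt (fun t : ℝ => f (p + t • v)) (v.1 * D1 f (p + t • v) + v.2 * D2 f (p + t • v)) t := by
  have h1 : HasDerivAt (fun t : ℝ => p + t • v) v t := by
    have := ((hasDerivAt_id t).smul_const v).const_add p
    simpa using this
  have h2 := (sm_diff hf (p + t • v)).hasFDerivAt.comp_hasDerivAt t h1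
  rw [fderiv_eq_D] at h2
  exact h2

theorem local_min_D {h : ℝ × ℝ → ℝ} (hh : ContDiff ℝ ∞ h) {p : ℝ × ℝ} (hm : IsLocalMin h p) :
    D1 h p = 0 ∧ D2 h p = 0 ∧ 0 ≤ D1 (D1 h) p ∧ 0 ≤ D2 (D2 h) p := by
  have h0 := hm.fderiv_eq_zero
  have key : ∀ v : ℝ × ℝ, 0 ≤ deriv (deriv (fun t : ℝ => h (p + t • v))) 0 := by
    intro v
    have hc : Continuous (fun t : ℝ => p + t • v) := by fun_prop
    apply second_deriv_nonneg
    · have : Filter.Tendsto (fun t : ℝ => p + t • v) (𝓝 0) (𝓝 p) := by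
        have := hc.tendsto 0; simpa using this
      have := this.eventually hm
      simpa [IsLocalMin, IsMinFilter] using this
    · exact (hh.continuous.comp hc).continuousAt
  refine ⟨by simp [D1, h0], by simp [D2, h0], ?_, ?_⟩
  · have := key (1, 0)
    have e : deriv (fun t : ℝ => h (p + t • ((1 : ℝ), (0 : ℝ)))) =
        fun t => D1 h (p + t • ((1 : ℝ), (0 : ℝ))) := by
      ext t; rw [(line_deriv hh p (1, 0) t).deriv]; simp
    rw [e, (line_deriv (contDiff_D1 hh) p (1, 0) 0).deriv] at this
    simpa using this
  · have := key (0, 1)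
    have e : deriv (fun t : ℝ => h (p + t • ((0 : ℝ), (1 : ℝ)))) =
        fun t => D2 h (p + t • ((0 : ℝ), (1 : ℝ))) := by
      ext t; rw [(line_deriv hh p (0, 1) t).deriv]; simp
    rw [e, (line_deriv (contDiff_D2 hh) p (0, 1) 0).deriv] at this
    simpa using this

/-- `f Δf - |∇f|²` -/
def ell (f : ℝ × ℝ → ℝ) (p : ℝ × ℝ) : ℝ := f p * Lap f p - (D1 f p ^ 2 + D2 f p ^ 2)

theorem ell_mul {f g : ℝ × ℝ → ℝ} (hf : ContDiff ℝ ∞ f) (hg : ContDiff ℝ ∞ g) (p : ℝ × ℝ) :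
    ell (fun x => f x * g x) p = f p ^ 2 * ell g p + g p ^ 2 * ell f p := by
  unfold ell Lap
  simp (disch := fun_prop) only [D1_mul, D1_add, D2_mul, D2_add]
  ring

theorem ell_const (c : ℝ) (p : ℝ × ℝ) : ell (fun _ => c) p = 0 := by
  unfold ell Lap
  simp only [D1_const, D2_const]
  simp

theorem ell_pow {f : ℝ × ℝ → ℝ} (hf : ContDiff ℝ ∞ f) (p : ℝ × ℝ) (hp : f p ≠ 0) (n : ℕ) :
    ell (fun x => f x ^ n) p * f p ^ 2 = n * (f p ^ n) ^ 2 * ell f p := by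
  induction n with
  | zero => simp [ell_const]
  | succ n ih =>
    simp only [pow_succ]
    rw [ell_mul (by fun_prop) hf]
    push_cast
    linear_combination f p ^ 2 * ih

theorem ell_exp {f : ℝ × ℝ → ℝ} (hf : ContDiff ℝ ∞ f) (p : ℝ × ℝ) :
    ell (fun x => Real.exp (f x)) p = Real.exp (f p) ^ 2 * Lap f p := by
  unfold ell Lap
  simp (disch := fun_prop) only [D1_mul, D1_exp, D2_mul, D2_exp]
  ring

theorem ell_tau (p : ℝ × ℝ) : ell tau p = - rho p * tau p ^ 2 := by
  have ht := tau_mul p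
  unfold ell Lap rho
  simp (disch := fun_prop) only [D1_mul, D1_tau, D2_mul, D2_tau, D1_neg, D2_neg, D1_const, D2_const,
    D1_fst, D2_snd, D1_pow, D2_pow]
  norm_num
  linear_combination (4 * tau p ^ 3) * ht

theorem disc_compact : IsCompact {p : ℝ × ℝ | p.1 ^ 2 + p.2 ^ 2 ≤ 1} := by
  apply Metric.isCompact_of_isClosed_isBounded
  · exact isClosed_le (by fun_prop) (by fun_prop)
  · apply (Metric.isBounded_closedBall (x := (0 : ℝ × ℝ)) (r := 1)).subset
    intro p hp
    simp only [Set.mem_ofPred_eq] at hp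
    rw [mem_closedBall_zero_iff, Prod.norm_def]
    have h1 : |p.1| ≤ 1 := by
      rw [abs_le_one_iff_mul_self_le_one]; nlinarith [sq_nonneg p.2]
    have h2 : |p.2| ≤ 1 := by
      rw [abs_le_one_iff_mul_self_le_one]; nlinarith [sq_nonneg p.1]
    exact max_le h1 h2

set_option maxHeartbeats 1000000 in
theorem N_lemma {lam : ℝ} {u f W : ℝ × ℝ → ℝ} (hl1 : 2 < lam) (hl2 : lam ≤ 8) (hu : PS lam u)
    (hf : LS lam u f) {s : ℝ} (hs : s ^ 2 = 1) (hinv : ∀ p, p ≠ 0 → f (inv2 p) = s * f p)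
    (hW : ContDiff ℝ ∞ W) (hW0 : ∀ p, 0 ≤ W p) (hWh : ∀ p, ell W p = 0)
    (hWi : ∀ p : ℝ × ℝ, p ≠ 0 → W (inv2 p) * (p.1 ^ 2 + p.2 ^ 2) ^ 6 = W p)
    (hfin : ∃ C : ℝ, ∀ p : ℝ × ℝ, p.1 ^ 2 + p.2 ^ 2 ≤ 1 →
      D1 f p ^ 2 + D2 f p ^ 2 + f p ^ 2 ≤ C * W p) :
    ∀ p, f p = 0 := by
  have hus := hu.sm
  have hfs := hf.sm
  have hne : ({p : ℝ × ℝ | p.1 ^ 2 + p.2 ^ 2 ≤ 1}).Nonempty := ⟨0, by simp⟩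
  -- bounds on u
  obtain ⟨pM, -, hM⟩ := disc_compact.exists_isMaxOn hne hus.continuous.continuousOn
  obtain ⟨pm, -, hm⟩ := disc_compact.exists_isMinOn hne hus.continuous.continuousOn
  set M := u pM with hMdef
  set m := u pm with hmdef
  -- choice of e, delta
  set c0 := (lam / 2 - 1) * Real.exp (-M) with hc0
  have hc0pos : 0 < c0 := mul_pos (by linarith) (Real.exp_pos _)
  set e := min (c0 / 4) (1 / 4) with he
  have hepos : 0 < e := lt_min (by linarith) (by norm_num)
  have he1 : e ≤ c0 / 4 := min_le_left _ _
  have he2 : e ≤ 1 / 4 := min_le_right _ _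
  set k := lam / 2 + e with hk
  have hk1 : 1 < k := by linarith
  set δ := e / 2 with hδ
  have hδpos : 0 < δ := by positivity
  have hc1 : ∀ p : ℝ × ℝ, p.1 ^ 2 + p.2 ^ 2 ≤ 1 →
      (lam * e + k * δ) * Real.exp (u p) ≤ k * (lam / 2 - 1) := by
    intro p hp
    have h1 : Real.exp (u p) ≤ Real.exp M := Real.exp_le_exp.2 (hM hp)
    have h2 : (lam * e + k * δ) ≤ k * c0 := by
      have : lam * e ≤ 2 * k * e := by
        apply mul_le_mul_of_nonneg_right _ hepos.le; linarith
      nlinarith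
    have h3 : c0 * Real.exp M = lam / 2 - 1 := by
      rw [hc0, mul_assoc, ← Real.exp_add]; simp
    calc (lam * e + k * δ) * Real.exp (u p) ≤ (lam * e + k * δ) * Real.exp M :=
          mul_le_mul_of_nonneg_left h1 (by positivity)
      _ ≤ (k * c0) * Real.exp M := mul_le_mul_of_nonneg_right h2 (Real.exp_pos _).le
      _ = _ := by rw [mul_assoc, h3]
  have hc2 : k * δ ≤ k * e - 2 * e ^ 2 := by rw [hδ]; nlinarith
  have hineq := fun p hp => Q_ineq hus hu.pde hf hk (by linarith) p (hc1 p hp) hc2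
  -- choice of n
  obtain ⟨n, hn⟩ := exists_nat_gt (3 / (δ * Real.exp m))
  have hn' : 3 < n * (δ * Real.exp m) := by
    rwa [div_lt_iff₀ (by positivity)] at hn
  have hn1 : 1 ≤ n := by
    rcases Nat.eq_zero_or_pos n with h | h
    · subst h; norm_num at hn'
    · exact h
  set Q := Qf k u f with hQ
  have hQs : ContDiff ℝ ∞ Q := contDiff_Qf hus hfs
  have hQ0 : ∀ p, 0 ≤ Q p := by
    intro p
    have := rho_pos p
    simp only [hQ, Qf]; positivity
  have hQinv : ∀ p : ℝ × ℝ, p ≠ 0 → Q (inv2 p) = (p.1 ^ 2 + p.2 ^ 2) ^ 2 * Q p := by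
    intro p hp
    simp only [hQ, Qf]
    rw [grad_inv hfs hs hinv hp, hu.inv p hp, hinv p hp, rho, rho, tau_inv hp]
    linear_combination (k * (4 * ((p.1 ^ 2 + p.2 ^ 2) * tau p) ^ 2 * Real.exp (u p)) * f p ^ 2) * hs
  obtain ⟨C, hC⟩ := hfin
  have hC' : ∃ C' : ℝ, 0 ≤ C' ∧ ∀ p : ℝ × ℝ, p.1 ^ 2 + p.2 ^ 2 ≤ 1 → Q p ≤ C' * W p := by
    refine ⟨(1 + k * (4 * Real.exp M)) * |C|, by positivity, fun p hp => ?_⟩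
    have h1 := hC p hp
    have h2 : C * W p ≤ |C| * W p := mul_le_mul_of_nonneg_right (le_abs_self C) (hW0 p)
    have h3 : rho p ≤ 4 := by
      have a := tau_mul p
      have b := tau_pos p
      have : tau p ≤ 1 := by nlinarith [sq_nonneg p.1, sq_nonneg p.2]
      unfold rho; nlinarith
    have h4 : rho p * Real.exp (u p) ≤ 4 * Real.exp M :=
      mul_le_mul h3 (Real.exp_le_exp.2 (hM hp)) (Real.exp_pos _).le (by norm_num)
    have h5 : 0 ≤ rho p * Real.exp (u p) := by have := rho_pos p; positivity
    have h6 : k * (rho p * Real.exp (u p)) * f p ^ 2 ≤ k * (4 * Real.exp M) * f p ^ 2 := by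
      gcongr
    have h7 : 0 ≤ k * (4 * Real.exp M) := by positivity
    have h8 : Q p ≤ (1 + k * (4 * Real.exp M)) * (D1 f p ^ 2 + D2 f p ^ 2 + f p ^ 2) := by
      simp only [hQ, Qf]
      nlinarith [sq_nonneg (f p), mul_nonneg h7 (add_nonneg (sq_nonneg (D1 f p)) (sq_nonneg (D2 f p)))]
    rw [mul_assoc]
    exact h8.trans (mul_le_mul_of_nonneg_left (h1.trans h2) (by positivity))
  obtain ⟨C', hC'0, hC'⟩ := hC'
  -- the barrier function
  set A : ℝ × ℝ → ℝ := fun p => Q p ^ n * Real.exp (-(n * u p)) *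
    (1 + p.1 ^ 2 + p.2 ^ 2) ^ (8 * n - 6) / W p ^ (n - 1) with hA
  have hAnn : ∀ p, 0 ≤ A p := by
    intro p
    have := hQ0 p; have := hW0 p; have := sig_pos p
    simp only [hA]; positivity
  have hAinv : ∀ p : ℝ × ℝ, p ≠ 0 → A (inv2 p) = A p := by
    intro p hp
    have hN := nsq_pos hp
    have h1 : W p = W (inv2 p) * (p.1 ^ 2 + p.2 ^ 2) ^ 6 := (hWi p hp).symm
    simp only [hA]
    rw [hQinv p hp, hu.inv p hp, h1, add_assoc 1, inv2_nsq hp]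
    have h2 : (1 + (p.1 ^ 2 + p.2 ^ 2)⁻¹) = (1 + p.1 ^ 2 + p.2 ^ 2) / (p.1 ^ 2 + p.2 ^ 2) := by
      field_simp; ring
    rw [h2]
    set N := p.1 ^ 2 + p.2 ^ 2
    obtain ⟨j, rfl⟩ : ∃ j, n = j + 1 := ⟨n - 1, by omega⟩
    have h3 : 8 * (j + 1) - 6 = 8 * j + 2 := by omega
    rw [h3, Nat.add_sub_cancel, mul_pow, mul_pow, div_pow, ← pow_mul, ← pow_mul]
    rcases eq_or_ne (W (inv2 p) ^ j) 0 with h | h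
    · rw [h]; simp
    · field_simp
      ring
  have hAc : ContinuousOn A {p : ℝ × ℝ | p.1 ^ 2 + p.2 ^ 2 ≤ 1} := by
    intro p hp
    rcases eq_or_ne (W p) 0 with h | h
    · -- zero of W
      have hQp : Q p = 0 := by
        have := hC' p hp
        rw [h, mul_zero] at this
        exact le_antisymm this (hQ0 p)
      have hAp : A p = 0 := by simp only [hA]; rw [hQp, zero_pow (by omega)]; simp
      rw [ContinuousWithinAt, hAp]
      set B : ℝ × ℝ → ℝ := fun q => C' ^ (n - 1) * (Q q * Real.exp (-(n * u q)) *
        (1 + q.1 ^ 2 + q.2 ^ 2) ^ (8 * n - 6)) with hB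
      have hBc : Continuous B := by
        have := hQs.continuous; have := hus.continuous
        simp only [hB]; fun_prop
      have hBt : Filter.Tendsto B (𝓝[{p : ℝ × ℝ | p.1 ^ 2 + p.2 ^ 2 ≤ 1}] p) (𝓝 0) := by
        have := hBc.tendsto p
        have hBp : B p = 0 := by simp [hB, hQp]
        rw [hBp] at this
        exact this.mono_left nhdsWithin_le_nhds
      refine tendsto_of_tendsto_of_tendsto_of_le_of_le' tendsto_const_nhds hBt
        (Filter.Eventually.of_forall hAnn) ?_
      filter_upwards [self_mem_nhdsWithin] with q hq
      have hWq := hW0 q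
      have hQq := hQ0 q
      have hCq := hC' q hq
      simp only [hA, hB]
      rcases eq_or_lt_of_le hWq with h0 | h0
      · have : Q q = 0 := by
          rw [← h0, mul_zero] at hCq; exact le_antisymm hCq hQq
        rw [this, zero_pow (by omega)]; simp
      · rw [div_le_iff₀ (by positivity)]
        have hp1 : Q q ^ n = Q q ^ (n - 1) * Q q := by
          rw [← pow_succ]; congr 1; omega
        have hp2 : Q q ^ (n - 1) ≤ C' ^ (n - 1) * W q ^ (n - 1) := by
          rw [← mul_pow]; exact pow_le_pow_left₀ hQq hCq _
        have hs0 := sig_pos q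
        have hR : 0 ≤ Q q * Real.exp (-(n * u q)) * (1 + q.1 ^ 2 + q.2 ^ 2) ^ (8 * n - 6) := by
          positivity
        rw [hp1]
        calc _ = Q q ^ (n - 1) * (Q q * Real.exp (-(n * u q)) *
              (1 + q.1 ^ 2 + q.2 ^ 2) ^ (8 * n - 6)) := by ring
          _ ≤ (C' ^ (n - 1) * W q ^ (n - 1)) * (Q q * Real.exp (-(n * u q)) *
              (1 + q.1 ^ 2 + q.2 ^ 2) ^ (8 * n - 6)) := mul_le_mul_of_nonneg_right hp2 hR
          _ = _ := by ring
    · apply ContinuousAt.continuousWithinAt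
      have := hQs.continuous; have := hus.continuous; have := hW.continuous
      simp only [hA]
      refine ContinuousAt.div ?_ ?_ (pow_ne_zero _ h)
      · fun_prop
      · fun_prop
  obtain ⟨p, hp, hpmax⟩ := disc_compact.exists_isMaxOn hne hAc
  have hglob : ∀ q, A q ≤ A p := by
    intro q
    rcases le_or_gt (q.1 ^ 2 + q.2 ^ 2) 1 with h | h
    · exact hpmax h
    · have hq0 : q ≠ 0 := by rintro rfl; norm_num at h
      rw [← hAinv q hq0]
      apply hpmax
      simp only [Set.mem_ofPred_eq]
      rw [inv2_nsq hq0]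
      exact inv_le_one_of_one_le₀ h.le
  -- the maximum is zero
  have hmax0 : A p = 0 := by
    by_contra hAp
    have hApos : 0 < A p := lt_of_le_of_ne (hAnn p) (Ne.symm hAp)
    have hQp : 0 < Q p := by
      rcases eq_or_lt_of_le (hQ0 p) with h | h
      · exfalso; apply hAp; simp only [hA]; rw [← h, zero_pow (by omega)]; simp
      · exact h
    have hWp : 0 < W p := by
      rcases eq_or_lt_of_le (hW0 p) with h | h
      · have := hC' p hp
        rw [← h, mul_zero] at this; linarith
      · exact h
    set F : ℝ × ℝ → ℝ := fun q => (A p * W q ^ (n - 1)) * (Real.exp (n * u q) *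
      tau q ^ (8 * n - 6)) with hF
    set G : ℝ × ℝ → ℝ := fun q => Q q ^ n with hG
    have hFs : ContDiff ℝ ∞ F := by simp only [hF]; fun_prop
    have hGs : ContDiff ℝ ∞ G := by simp only [hG]; fun_prop
    have hAG : ∀ q, W q ≠ 0 → A q * W q ^ (n - 1) * (Real.exp (n * u q) *
      tau q ^ (8 * n - 6)) = G q := by
      intro q hq
      simp only [hA, hG, tau]
      have h1 := sig_pos q
      have h2 : Real.exp (-(n * u q)) = (Real.exp (n * u q))⁻¹ := Real.exp_neg _
      have h3 := Real.exp_pos (n * u q)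
      rw [h2, inv_pow]
      field_simp
    have hFG : F p = G p := hAG p hWp.ne'
    have hmin : IsLocalMin (fun q => F q - G q) p := by
      have : ∀ᶠ q in 𝓝 p, 0 < W q := hW.continuous.continuousAt.eventually (lt_mem_nhds hWp)
      filter_upwards [this] with q hq
      rw [hFG, sub_self, sub_nonneg, ← hAG q hq.ne']
      have := tau_pos q
      simp only [hF]
      have h9 := hglob q
      gcongr
    obtain ⟨d1, d2, d11, d22⟩ := local_min_D (by fun_prop) hmin
    simp (disch := fun_prop) only [D1_sub, D2_sub] at d1 d2 d11 d22
    have hell : ell G p ≤ ell F p := by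
      unfold ell Lap
      have e1 : D1 F p = D1 G p := by linarith
      have e2 : D2 F p = D2 G p := by linarith
      rw [e1, e2, hFG]
      have hGp : 0 < G p := pow_pos hQp n
      have : 0 ≤ G p * ((D1 (D1 F) p - D1 (D1 G) p) + (D2 (D2 F) p - D2 (D2 G) p)) :=
        mul_nonneg hGp.le (add_nonneg d11 d22)
      linarith
    have eF : ell F p = F p ^ 2 * (n * Lap u p - (8 * n - 6 : ℕ) * rho p) := by
      have x1 : ell (fun q => W q ^ (n - 1)) p = 0 := by
        have := ell_pow hW p hWp.ne' (n - 1)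
        rw [hWh p, mul_zero] at this
        rcases mul_eq_zero.1 this with h | h
        · exact h
        · exact absurd h (by positivity)
      have x2 : ell (fun q => Real.exp (n * u q)) p = Real.exp (n * u p) ^ 2 * (n * Lap u p) := by
        rw [ell_exp (by fun_prop)]
        congr 1
        unfold Lap
        simp (disch := fun_prop) only [D1_mul, D2_mul, D1_const, D2_const, D1_add, D2_add]
        ring
      have x3 : ell (fun q => tau q ^ (8 * n - 6)) p =
          -((8 * n - 6 : ℕ) * rho p) * (tau p ^ (8 * n - 6)) ^ 2 := by
        have h1 := ell_pow contDiff_tau p (tau_pos p).ne' (8 * n - 6)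
        rw [ell_tau] at h1
        have h2 : tau p ^ 2 ≠ 0 := pow_ne_zero _ (tau_pos p).ne'
        apply mul_right_cancel₀ h2
        rw [h1]; ring
      simp only [hF]
      rw [ell_mul (by fun_prop) (by fun_prop), ell_mul (by fun_prop) (by fun_prop),
        ell_mul (by fun_prop) (by fun_prop), x1, x2, x3, ell_const]
      ring
    have eG : ell G p * Q p ^ 2 = n * G p ^ 2 * ell Q p := ell_pow hQs p hQp.ne' n
    have hq := hineq p hp
    have hfinal : G p ^ 2 * (n * ((-lam + 2 * δ) * (rho p * Real.exp (u p)))) ≤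
        G p ^ 2 * (n * Lap u p - (8 * n - 6 : ℕ) * rho p) := by
      have h1 : G p ^ 2 * (n * ((-lam + 2 * δ) * (rho p * Real.exp (u p)))) * Q p ^ 2 ≤
          ell G p * Q p ^ 2 := by
        rw [eG]
        have : (n * G p ^ 2) * ((-lam + 2 * δ) * (rho p * Real.exp (u p)) * Q p ^ 2) ≤
          (n * G p ^ 2) * ell Q p := mul_le_mul_of_nonneg_left hq (by positivity)
        linarith
      have h2 := le_of_mul_le_mul_right h1 (by positivity)
      rw [← hFG]
      rw [← hFG] at h2
      rw [← eF]; exact h2.trans hell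
    have hGp : 0 < G p ^ 2 := by have : 0 < G p := pow_pos hQp n
                                 positivity
    have h1 := le_of_mul_le_mul_left hfinal hGp
    rw [hu.pde p, Nat.cast_sub (by omega)] at h1
    push_cast at h1
    have h2 : rho p * (n * (2 * δ * Real.exp (u p)) + n * (8 - lam)) ≤ rho p * 6 := by linarith
    have h3 := le_of_mul_le_mul_left h2 (rho_pos p)
    have h4 : Real.exp m ≤ Real.exp (u p) := Real.exp_le_exp.2 (hm hp)
    have h5 : (0 : ℝ) ≤ n * (8 - lam) := mul_nonneg (by positivity) (by linarith)
    have h6 : n * (δ * Real.exp m) ≤ n * (δ * Real.exp (u p)) := by gcongr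
    linarith
  have hQall : ∀ q : ℝ × ℝ, q.1 ^ 2 + q.2 ^ 2 ≤ 1 → Q q = 0 := by
    intro q hq
    rcases eq_or_lt_of_le (hW0 q) with h | h
    · have := hC' q hq
      rw [← h, mul_zero] at this
      exact le_antisymm this (hQ0 q)
    · have h1 : A q = 0 := le_antisymm (hmax0 ▸ hglob q) (hAnn q)
      simp only [hA] at h1
      have h2 := sig_pos q
      have h3 := Real.exp_pos (-(n * u q))
      rw [div_eq_zero_iff, mul_eq_zero, mul_eq_zero] at h1
      rcases h1 with ((h1 | h1) | h1) | h1
      · exact pow_eq_zero_iff (by omega) |>.1 h1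
      · exact absurd h1 h3.ne'
      · exact absurd h1 (by positivity)
      · exact absurd h1 (by positivity)
  have hdisc : ∀ q : ℝ × ℝ, q.1 ^ 2 + q.2 ^ 2 ≤ 1 → f q = 0 := by
    intro q hq
    have h1 := hQall q hq
    simp only [hQ, Qf] at h1
    have h2 := rho_pos q
    have h3 := Real.exp_pos (u q)
    have h4 : 0 < k * (rho q * Real.exp (u q)) := by positivity
    by_contra hne
    have : 0 < f q ^ 2 := by positivity
    nlinarith [mul_pos h4 this, sq_nonneg (D1 f q), sq_nonneg (D2 f q)]
  intro q
  rcases le_or_gt (q.1 ^ 2 + q.2 ^ 2) 1 with h | h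
  · exact hdisc q h
  · have hq0 : q ≠ 0 := by rintro rfl; norm_num at h
    have h1 := hdisc (inv2 q) (by rw [inv2_nsq hq0]; exact inv_le_one_of_one_le₀ h.le)
    rw [hinv q hq0] at h1
    rcases mul_eq_zero.1 h1 with h2 | h2
    · rw [h2] at hs; norm_num at hs
    · exact h2

open scoped ContDiff Topology

/-! ### weights -/
/-- `|z² - A|²` -/
def qA (A : ℝ × ℝ) (p : ℝ × ℝ) : ℝ := (p.1 ^ 2 - p.2 ^ 2 - A.1) ^ 2 + (2 * p.1 * p.2 - A.2) ^ 2

/-- complex square -/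
def csq (p : ℝ × ℝ) : ℝ × ℝ := (p.1 ^ 2 - p.2 ^ 2, 2 * p.1 * p.2)

@[fun_prop]
theorem contDiff_qA (A : ℝ × ℝ) : ContDiff ℝ ∞ (qA A) := by unfold qA; fun_prop

theorem qA_nonneg (A p : ℝ × ℝ) : 0 ≤ qA A p := by unfold qA; positivity

theorem ell_qA (A p : ℝ × ℝ) : ell (qA A) p = 0 := by
  unfold ell Lap qA
  simp (disch := fun_prop) only [D1_mul, D1_add, D1_sub, D1_pow, D1_const, D1_fst, D1_snd, D2_mul,
    D2_add, D2_sub, D2_pow, D2_const, D2_fst, D2_snd]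
  norm_num
  ring

theorem qA_eq_zero {A p : ℝ × ℝ} (h : qA A p = 0) : A = csq p := by
  unfold qA at h
  have h1 : (p.1 ^ 2 - p.2 ^ 2 - A.1) ^ 2 = 0 := by nlinarith [sq_nonneg (p.1 ^ 2 - p.2 ^ 2 - A.1), sq_nonneg (2 * p.1 * p.2 - A.2)]
  have h2 : (2 * p.1 * p.2 - A.2) ^ 2 = 0 := by nlinarith [sq_nonneg (p.1 ^ 2 - p.2 ^ 2 - A.1), sq_nonneg (2 * p.1 * p.2 - A.2)]
  have h3 := pow_eq_zero_iff (two_ne_zero) |>.1 h1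
  have h4 := pow_eq_zero_iff (two_ne_zero) |>.1 h2
  unfold csq
  ext <;> simp <;> linarith

theorem qA_inv_unit {A : ℝ × ℝ} (hA : A.1 ^ 2 + A.2 ^ 2 = 1) {p : ℝ × ℝ} (hp : p ≠ 0) :
    qA A (inv2 p) * (p.1 ^ 2 + p.2 ^ 2) ^ 2 = qA A p := by
  have hn := nsq_pos hp
  unfold qA inv2
  field_simp
  linear_combination ((p.1 ^ 2 + p.2 ^ 2) ^ 4 - (p.1 ^ 2 + p.2 ^ 2) ^ 2) * hA

theorem qA_inv_pair {A : ℝ × ℝ} (hA : A ≠ 0) {p : ℝ × ℝ} (hp : p ≠ 0) :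
    qA A (inv2 p) * qA (inv2 A) (inv2 p) * (p.1 ^ 2 + p.2 ^ 2) ^ 4 = qA A p * qA (inv2 A) p := by
  have hn := nsq_pos hp
  have hm := nsq_pos hA
  have h1 : qA A (inv2 p) * (p.1 ^ 2 + p.2 ^ 2) ^ 2 = (A.1 ^ 2 + A.2 ^ 2) * qA (inv2 A) p := by
    unfold qA inv2
    field_simp
    ring
  have h2 : qA (inv2 A) (inv2 p) * (p.1 ^ 2 + p.2 ^ 2) ^ 2 * (A.1 ^ 2 + A.2 ^ 2) = qA A p := by
    unfold qA inv2
    field_simp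
    ring
  apply mul_right_cancel₀ hm.ne'
  linear_combination (qA (inv2 A) (inv2 p) * (p.1 ^ 2 + p.2 ^ 2) ^ 2 * (A.1 ^ 2 + A.2 ^ 2)) * h1
    + (A.1 ^ 2 + A.2 ^ 2) * qA (inv2 A) p * h2

theorem qA_zero_inv {p : ℝ × ℝ} (hp : p ≠ 0) :
    qA 0 (inv2 p) * (p.1 ^ 2 + p.2 ^ 2) ^ 4 = qA 0 p := by
  have hn := nsq_pos hp
  unfold qA inv2
  simp only [Prod.fst_zero, Prod.snd_zero]
  field_simp
  ring

/-! ### orders of vanishing -/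
def Vn (m : ℕ) (f : ℝ × ℝ → ℝ) (p₀ : ℝ × ℝ) : Prop := f =O[𝓝 p₀] fun p => ‖p - p₀‖ ^ m

theorem Vn_zero {f : ℝ × ℝ → ℝ} (hf : Continuous f) (p₀ : ℝ × ℝ) : Vn 0 f p₀ := by
  unfold Vn
  simp only [pow_zero]
  exact (hf.tendsto p₀).isBigO_one ℝ

theorem Vn_mono {f : ℝ × ℝ → ℝ} {p₀ : ℝ × ℝ} {m n : ℕ} (h : m ≤ n) (hf : Vn n f p₀) :
    Vn m f p₀ := by
  refine hf.trans (Asymptotics.IsBigO.of_bound 1 ?_)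
  filter_upwards [Metric.ball_mem_nhds p₀ one_pos] with p hp
  rw [Metric.mem_ball, dist_eq_norm] at hp
  rw [norm_pow, norm_pow, norm_norm, one_mul]
  exact pow_le_pow_of_le_one (norm_nonneg _) hp.le h

theorem Vn_succ {f : ℝ × ℝ → ℝ} (hf : ContDiff ℝ ∞ f) {p₀ : ℝ × ℝ} (h0 : f p₀ = 0) {m : ℕ}
    (h1 : Vn m (D1 f) p₀) (h2 : Vn m (D2 f) p₀) : Vn (m + 1) f p₀ := by
  obtain ⟨C1, h1⟩ := h1.bound
  obtain ⟨C2, h2⟩ := h2.bound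
  obtain ⟨ε, hε, hb⟩ := Metric.eventually_nhds_iff_ball.1 (h1.and h2)
  refine Asymptotics.IsBigO.of_bound (|C1| + |C2|) ?_
  filter_upwards [Metric.ball_mem_nhds p₀ hε] with p hp
  set r := ‖p - p₀‖ with hr
  have hrε : r < ε := by rwa [Metric.mem_ball, dist_eq_norm] at hp
  have hbound : ∀ q ∈ Metric.closedBall p₀ r, ‖fderiv ℝ f q‖ ≤ (|C1| + |C2|) * r ^ m := by
    intro q hq
    rw [Metric.mem_closedBall] at hq
    have hq' : q ∈ Metric.ball p₀ ε := lt_of_le_of_lt hq hrε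
    obtain ⟨b1, b2⟩ := hb q hq'
    rw [norm_pow, norm_norm, ← dist_eq_norm] at b1 b2
    have hdm : dist q p₀ ^ m ≤ r ^ m := pow_le_pow_left₀ dist_nonneg hq m
    have hd0 : 0 ≤ dist q p₀ ^ m := by positivity
    have b1' : ‖D1 f q‖ ≤ |C1| * r ^ m := b1.trans (mul_le_mul (le_abs_self _) hdm hd0 (abs_nonneg _))
    have b2' : ‖D2 f q‖ ≤ |C2| * r ^ m := b2.trans (mul_le_mul (le_abs_self _) hdm hd0 (abs_nonneg _))
    apply ContinuousLinearMap.opNorm_le_bound _ (by positivity)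
    intro v
    rw [fderiv_eq_D]
    have hv1 : ‖v.1‖ ≤ ‖v‖ := norm_fst_le v
    have hv2 : ‖v.2‖ ≤ ‖v‖ := norm_snd_le v
    calc ‖v.1 * D1 f q + v.2 * D2 f q‖ ≤ ‖v.1‖ * ‖D1 f q‖ + ‖v.2‖ * ‖D2 f q‖ := by
          refine (norm_add_le _ _).trans ?_
          rw [norm_mul, norm_mul]
      _ ≤ ‖v‖ * (|C1| * r ^ m) + ‖v‖ * (|C2| * r ^ m) := by gcongr
      _ = _ := by ring
  have := (convex_closedBall p₀ r).norm_image_sub_le_of_norm_fderiv_le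
    (fun q _ => sm_diff hf q) hbound (Metric.mem_closedBall_self (norm_nonneg _))
    (show p ∈ Metric.closedBall p₀ r by rw [Metric.mem_closedBall, dist_eq_norm])
  rw [h0, sub_zero] at this
  rw [norm_pow, norm_norm, pow_succ, ← mul_assoc]
  exact this

/-- `f` vanishes to order `m+1`. -/
def Van (m : ℕ) (f : ℝ × ℝ → ℝ) (p₀ : ℝ × ℝ) : Prop :=
  Vn m (D1 f) p₀ ∧ Vn m (D2 f) p₀ ∧ Vn m f p₀

theorem Van_mk {f : ℝ × ℝ → ℝ} (hf : ContDiff ℝ ∞ f) {p₀ : ℝ × ℝ} (h0 : f p₀ = 0) {m : ℕ}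
    (h1 : Vn m (D1 f) p₀) (h2 : Vn m (D2 f) p₀) : Van m f p₀ :=
  ⟨h1, h2, Vn_mono (Nat.le_succ m) (Vn_succ hf h0 h1 h2)⟩

theorem Van_mono {f : ℝ × ℝ → ℝ} {p₀ : ℝ × ℝ} {m n : ℕ} (h : m ≤ n) (hf : Van n f p₀) :
    Van m f p₀ := ⟨Vn_mono h hf.1, Vn_mono h hf.2.1, Vn_mono h hf.2.2⟩

theorem Van_zero {f : ℝ × ℝ → ℝ} (hf : ContDiff ℝ ∞ f) (p₀ : ℝ × ℝ) : Van 0 f p₀ :=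
  ⟨Vn_zero (contDiff_D1 hf).continuous _, Vn_zero (contDiff_D2 hf).continuous _,
    Vn_zero hf.continuous _⟩

theorem Vn_one {f : ℝ × ℝ → ℝ} (hf : ContDiff ℝ ∞ f) {p₀ : ℝ × ℝ} (h0 : f p₀ = 0) : Vn 1 f p₀ :=
  Vn_succ hf h0 (Vn_zero (contDiff_D1 hf).continuous _) (Vn_zero (contDiff_D2 hf).continuous _)

theorem Van_one {f : ℝ × ℝ → ℝ} (hf : ContDiff ℝ ∞ f) {p₀ : ℝ × ℝ} (h0 : f p₀ = 0)
    (h1 : D1 f p₀ = 0) (h2 : D2 f p₀ = 0) : Van 1 f p₀ :=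
  Van_mk hf h0 (Vn_one (contDiff_D1 hf) h1) (Vn_one (contDiff_D2 hf) h2)

theorem Van_bound {f : ℝ × ℝ → ℝ} {p₀ : ℝ × ℝ} {m : ℕ} (h : Van m f p₀) :
    ∃ C : ℝ, 0 ≤ C ∧ ∀ᶠ p in 𝓝 p₀, D1 f p ^ 2 + D2 f p ^ 2 + f p ^ 2 ≤
      C * ((p.1 - p₀.1) ^ 2 + (p.2 - p₀.2) ^ 2) ^ m := by
  obtain ⟨h1, h2, h3⟩ := h
  obtain ⟨C1, h1⟩ := h1.bound
  obtain ⟨C2, h2⟩ := h2.bound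
  obtain ⟨C3, h3⟩ := h3.bound
  refine ⟨C1 ^ 2 + C2 ^ 2 + C3 ^ 2, by positivity, ?_⟩
  filter_upwards [h1, h2, h3] with p g1 g2 g3
  have hn : ‖p - p₀‖ ^ 2 ≤ (p.1 - p₀.1) ^ 2 + (p.2 - p₀.2) ^ 2 := by
    rw [Prod.norm_def]
    rcases max_cases ‖(p - p₀).1‖ ‖(p - p₀).2‖ with h | h
    · rw [h.1, Real.norm_eq_abs, sq_abs]; simp; positivity
    · rw [h.1, Real.norm_eq_abs, sq_abs]; simp; positivity
  have key : ∀ a C : ℝ, ‖a‖ ≤ C * ‖‖p - p₀‖ ^ m‖ →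
      a ^ 2 ≤ C ^ 2 * ((p.1 - p₀.1) ^ 2 + (p.2 - p₀.2) ^ 2) ^ m := by
    intro a C ha
    rw [norm_pow, norm_norm] at ha
    have h1 : a ^ 2 ≤ (C * ‖p - p₀‖ ^ m) ^ 2 := by
      rw [← sq_abs]; exact pow_le_pow_left₀ (abs_nonneg _) ha 2
    refine h1.trans ?_
    rw [mul_pow, ← pow_mul, mul_comm m 2, pow_mul]
    gcongr
  have := key _ _ g1
  have := key _ _ g2
  have := key _ _ g3
  linarith

theorem qA_lower {A p₀ : ℝ × ℝ} (hp : p₀ ≠ 0) : ∃ c : ℝ, 0 < c ∧ ∀ᶠ p in 𝓝 p₀,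
    c * ((p.1 - p₀.1) ^ 2 + (p.2 - p₀.2) ^ 2) ^ (if A = csq p₀ then 1 else 0) ≤ qA A p := by
  split_ifs with h
  · have hn := nsq_pos hp
    refine ⟨p₀.1 ^ 2 + p₀.2 ^ 2, hn, ?_⟩
    have hc : Continuous (fun p : ℝ × ℝ => (p.1 + p₀.1) ^ 2 + (p.2 + p₀.2) ^ 2) := by fun_prop
    have : ∀ᶠ p in 𝓝 p₀, p₀.1 ^ 2 + p₀.2 ^ 2 < (p.1 + p₀.1) ^ 2 + (p.2 + p₀.2) ^ 2 :=
      hc.continuousAt.eventually (lt_mem_nhds (by nlinarith))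
    filter_upwards [this] with p hp
    have e : qA A p = ((p.1 + p₀.1) ^ 2 + (p.2 + p₀.2) ^ 2) *
        ((p.1 - p₀.1) ^ 2 + (p.2 - p₀.2) ^ 2) := by
      rw [h]; unfold qA csq; ring
    rw [e, pow_one]
    gcongr
  · have hq : 0 < qA A p₀ := lt_of_le_of_ne (qA_nonneg _ _) (fun h' => h (qA_eq_zero h'.symm))
    refine ⟨qA A p₀ / 2, by positivity, ?_⟩
    have := (contDiff_qA A).continuous.continuousAt.eventually (lt_mem_nhds (half_lt_self hq))
    filter_upwards [this] with p hp
    simpa using hp.le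

theorem fin_global {g W : ℝ × ℝ → ℝ} (hW0 : ∀ p, 0 ≤ W p)
    (h : ∀ p₀ : ℝ × ℝ, p₀.1 ^ 2 + p₀.2 ^ 2 ≤ 1 → ∃ C : ℝ, ∀ᶠ p in 𝓝 p₀, g p ≤ C * W p) :
    ∃ C : ℝ, ∀ p : ℝ × ℝ, p.1 ^ 2 + p.2 ^ 2 ≤ 1 → g p ≤ C * W p := by
  have := disc_compact.induction_on (p := fun S => ∃ C : ℝ, ∀ p ∈ S, g p ≤ C * W p)
    ⟨0, by simp⟩ (fun s t hst ⟨C, hC⟩ => ⟨C, fun p hp => hC p (hst hp)⟩)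
    (fun s t ⟨C, hC⟩ ⟨C', hC'⟩ => ⟨max C C', fun p hp => by
      rcases hp with hp | hp
      · exact (hC p hp).trans (mul_le_mul_of_nonneg_right (le_max_left _ _) (hW0 p))
      · exact (hC' p hp).trans (mul_le_mul_of_nonneg_right (le_max_right _ _) (hW0 p))⟩)
    (fun p₀ hp₀ => by
      obtain ⟨C, hC⟩ := h p₀ hp₀
      exact ⟨{p | g p ≤ C * W p}, mem_nhdsWithin_of_mem_nhds hC, C, fun p hp => hp⟩)
  obtain ⟨C, hC⟩ := this
  exact ⟨C, fun p hp => hC p hp⟩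

theorem local_of_pos {g W : ℝ × ℝ → ℝ} (hg : Continuous g) (hW : Continuous W) {p₀ : ℝ × ℝ}
    (hp : 0 < W p₀) : ∃ C : ℝ, ∀ᶠ p in 𝓝 p₀, g p ≤ C * W p := by
  refine ⟨(|g p₀| + 1) / (W p₀ / 2), ?_⟩
  filter_upwards [hg.continuousAt.eventually (gt_mem_nhds (lt_add_one (g p₀))),
    hW.continuousAt.eventually (lt_mem_nhds (half_lt_self hp))] with p h1 h2
  have : (|g p₀| + 1) / (W p₀ / 2) * (W p₀ / 2) ≤ (|g p₀| + 1) / (W p₀ / 2) * W p :=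
    mul_le_mul_of_nonneg_left h2.le (by positivity)
  rw [div_mul_cancel₀ _ (by positivity)] at this
  linarith [le_abs_self (g p₀)]

/-- Main vanishing criterion with three pairs of points. -/
theorem N_three {lam : ℝ} {u f : ℝ × ℝ → ℝ} (hl1 : 2 < lam) (hl2 : lam ≤ 8) (hu : PS lam u)
    (hf : LS lam u f) {s : ℝ} (hs : s ^ 2 = 1) (hinv : ∀ p, p ≠ 0 → f (inv2 p) = s * f p)
    (A B C : ℝ × ℝ) (hA : A ≠ 0) (hB : B ≠ 0) (hC : C ≠ 0)
    (hi : ∀ p : ℝ × ℝ, p ≠ 0 → (qA A (inv2 p) * qA B (inv2 p) * qA C (inv2 p)) *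
      (p.1 ^ 2 + p.2 ^ 2) ^ 6 = qA A p * qA B p * qA C p)
    (hv : ∀ p : ℝ × ℝ, p ≠ 0 → p.1 ^ 2 + p.2 ^ 2 ≤ 1 →
      Van ((if A = csq p then 1 else 0) + (if B = csq p then 1 else 0) +
        (if C = csq p then 1 else 0)) f p) :
    ∀ p, f p = 0 := by
  have hfs := hf.sm
  apply N_lemma hl1 hl2 hu hf hs hinv (W := fun p => qA A p * qA B p * qA C p) (by fun_prop)
    (fun p => mul_nonneg (mul_nonneg (qA_nonneg _ _) (qA_nonneg _ _)) (qA_nonneg _ _)) _ hi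
  · apply fin_global
      (fun p => mul_nonneg (mul_nonneg (qA_nonneg _ _) (qA_nonneg _ _)) (qA_nonneg _ _))
    intro p₀ hp₀
    rcases eq_or_ne p₀ 0 with h0 | h0
    · subst h0
      have hg : Continuous (fun p => D1 f p ^ 2 + D2 f p ^ 2 + f p ^ 2) :=
        ContDiff.continuous (n := ∞) (𝕜 := ℝ) (by fun_prop)
      apply local_of_pos hg (ContDiff.continuous (n := ∞) (𝕜 := ℝ) (by fun_prop))
      have : ∀ A : ℝ × ℝ, A ≠ 0 → 0 < qA A 0 := by
        intro A hA
        have := nsq_pos hA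
        unfold qA; simpa using this
      exact mul_pos (mul_pos (this A hA) (this B hB)) (this C hC)
    · obtain ⟨K, hK0, hK⟩ := Van_bound (hv p₀ h0 hp₀)
      obtain ⟨a, ha, hA'⟩ := qA_lower (A := A) h0
      obtain ⟨b, hb, hB'⟩ := qA_lower (A := B) h0
      obtain ⟨c, hc, hC'⟩ := qA_lower (A := C) h0
      refine ⟨K / (a * b * c), ?_⟩
      filter_upwards [hK, hA', hB', hC'] with p k1 k2 k3 k4
      refine k1.trans ?_
      rw [pow_add, pow_add]
      set R := (p.1 - p₀.1) ^ 2 + (p.2 - p₀.2) ^ 2 with hR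
      have hR0 : 0 ≤ R := by positivity
      have := mul_le_mul (mul_le_mul k2 k3 (by positivity) (qA_nonneg _ _)) k4 (by positivity)
        (mul_nonneg (qA_nonneg _ _) (qA_nonneg _ _))
      rw [div_mul_eq_mul_div, le_div_iff₀ (by positivity)]
      calc _ = K * (a * R ^ (if A = csq p₀ then 1 else 0) * (b * R ^ (if B = csq p₀ then 1 else 0)) *
            (c * R ^ (if C = csq p₀ then 1 else 0))) := by ring
        _ ≤ _ := mul_le_mul_of_nonneg_left this hK0
  · intro p
    rw [ell_mul (by fun_prop) (by fun_prop), ell_mul (by fun_prop) (by fun_prop), ell_qA, ell_qA,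
      ell_qA]
    ring

/-- Vanishing criterion at the origin. -/
theorem N_origin {lam : ℝ} {u f : ℝ × ℝ → ℝ} (hl1 : 2 < lam) (hl2 : lam ≤ 8) (hu : PS lam u)
    (hf : LS lam u f) {s : ℝ} (hs : s ^ 2 = 1) (hinv : ∀ p, p ≠ 0 → f (inv2 p) = s * f p)
    (C : ℝ × ℝ) (hC : C.1 ^ 2 + C.2 ^ 2 = 1) (h0 : Van 2 f 0)
    (hv : ∀ p : ℝ × ℝ, p ≠ 0 → p.1 ^ 2 + p.2 ^ 2 ≤ 1 → C = csq p → Van 1 f p) :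
    ∀ p, f p = 0 := by
  have hfs := hf.sm
  have hC0 : C ≠ 0 := by rintro rfl; norm_num at hC
  apply N_lemma hl1 hl2 hu hf hs hinv (W := fun p => qA 0 p * qA C p) (by fun_prop)
    (fun p => mul_nonneg (qA_nonneg _ _) (qA_nonneg _ _))
  · intro p
    rw [ell_mul (by fun_prop) (by fun_prop), ell_qA, ell_qA]
    ring
  · intro p hp
    have h1 := qA_zero_inv hp
    have h2 := qA_inv_unit hC hp
    rw [← h1, ← h2]; ring
  · apply fin_global (fun p => mul_nonneg (qA_nonneg _ _) (qA_nonneg _ _))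
    intro p₀ hp₀
    rcases eq_or_ne p₀ 0 with h | h
    · subst h
      obtain ⟨K, hK0, hK⟩ := Van_bound h0
      refine ⟨K * 2, ?_⟩
      have hcq : qA C 0 = 1 := by unfold qA; simpa using hC
      have := (contDiff_qA C).continuous.continuousAt.eventually
        (lt_mem_nhds (show 1 / 2 < qA C 0 by rw [hcq]; norm_num))
      filter_upwards [hK, this] with p k1 k2
      refine k1.trans ?_
      have e : qA 0 p = ((p.1 - (0 : ℝ × ℝ).1) ^ 2 + (p.2 - (0 : ℝ × ℝ).2) ^ 2) ^ 2 := by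
        unfold qA; simp; ring
      rw [← e]
      have h3 : qA 0 p * (1 / 2) ≤ qA 0 p * qA C p :=
        mul_le_mul_of_nonneg_left k2.le (qA_nonneg _ _)
      nlinarith
    · have hg : Continuous (fun p => D1 f p ^ 2 + D2 f p ^ 2 + f p ^ 2) :=
        ContDiff.continuous (n := ∞) (𝕜 := ℝ) (by fun_prop)
      have hq0 : 0 < qA 0 p₀ := by
        have := nsq_pos h
        have e : qA 0 p₀ = (p₀.1 ^ 2 + p₀.2 ^ 2) ^ 2 := by unfold qA; simp; ring
        rw [e]; positivity
      by_cases hcs : C = csq p₀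
      · obtain ⟨K, hK0, hK⟩ := Van_bound (hv p₀ h hp₀ hcs)
        obtain ⟨c, hc, hC'⟩ := qA_lower (A := C) h
        rw [if_pos hcs] at hC'
        refine ⟨K / (c * (qA 0 p₀ / 2)), ?_⟩
        have := (contDiff_qA 0).continuous.continuousAt.eventually
          (lt_mem_nhds (half_lt_self hq0))
        filter_upwards [hK, hC', this] with p k1 k2 k3
        refine k1.trans ?_
        rw [div_mul_eq_mul_div, le_div_iff₀ (by positivity), mul_assoc]
        apply mul_le_mul_of_nonneg_left _ hK0
        have := mul_le_mul k3.le k2 (by positivity) (qA_nonneg _ _)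
        linarith
      · apply local_of_pos hg (ContDiff.continuous (n := ∞) (𝕜 := ℝ) (by fun_prop))
        apply mul_pos hq0
        exact lt_of_le_of_ne (qA_nonneg _ _) (fun h' => hcs (qA_eq_zero h'.symm))

/-- rotation field and radial field -/
def Xs (f : ℝ × ℝ → ℝ) (p : ℝ × ℝ) : ℝ := p.1 * D1 f p + p.2 * D2 f p
def Xt (f : ℝ × ℝ → ℝ) (p : ℝ × ℝ) : ℝ := p.1 * D2 f p - p.2 * D1 f p

@[fun_prop]
theorem contDiff_Xs {f : ℝ × ℝ → ℝ} (hf : ContDiff ℝ ∞ f) : ContDiff ℝ ∞ (Xs f) := by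
  unfold Xs; fun_prop
@[fun_prop]
theorem contDiff_Xt {f : ℝ × ℝ → ℝ} (hf : ContDiff ℝ ∞ f) : ContDiff ℝ ∞ (Xt f) := by
  unfold Xt; fun_prop

theorem Vn_X {f : ℝ × ℝ → ℝ} {p₀ : ℝ × ℝ} (hp : p₀ ≠ 0) {m : ℕ}
    (h1 : Vn m (Xs f) p₀) (h2 : Vn m (Xt f) p₀) : Vn m (D1 f) p₀ ∧ Vn m (D2 f) p₀ := by
  have hn := nsq_pos hp
  have hb : ∀ g : ℝ × ℝ → ℝ, ContinuousAt g p₀ → ∀ k, Vn m k p₀ → Vn m (fun p => g p * k p) p₀ := by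
    intro g hg k hk
    have := (hg.isBigO_one ℝ).mul hk
    simpa [Vn] using this
  have c1 : ContinuousAt (fun p : ℝ × ℝ => p.1 / (p.1 ^ 2 + p.2 ^ 2)) p₀ :=
    ContinuousAt.div (by fun_prop) (by fun_prop) hn.ne'
  have c2 : ContinuousAt (fun p : ℝ × ℝ => p.2 / (p.1 ^ 2 + p.2 ^ 2)) p₀ :=
    ContinuousAt.div (by fun_prop) (by fun_prop) hn.ne'
  constructor
  · refine ((hb _ c1 _ h1).sub (hb _ c2 _ h2)).congr' ?_ Filter.EventuallyEq.rfl
    filter_upwards [isOpen_ne.mem_nhds hp] with p hp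
    have := nsq_pos hp
    unfold Xs Xt
    field_simp
    ring
  · refine ((hb _ c2 _ h1).add (hb _ c1 _ h2)).congr' ?_ Filter.EventuallyEq.rfl
    filter_upwards [isOpen_ne.mem_nhds hp] with p hp
    have := nsq_pos hp
    unfold Xs Xt
    field_simp
    ring

theorem Vn_succX {f : ℝ × ℝ → ℝ} (hf : ContDiff ℝ ∞ f) {p₀ : ℝ × ℝ} (hp : p₀ ≠ 0) (h0 : f p₀ = 0)
    {m : ℕ} (h1 : Vn m (Xs f) p₀) (h2 : Vn m (Xt f) p₀) : Vn (m + 1) f p₀ :=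
  Vn_succ hf h0 (Vn_X hp h1 h2).1 (Vn_X hp h1 h2).2

theorem Van_X {f : ℝ × ℝ → ℝ} (hf : ContDiff ℝ ∞ f) {p₀ : ℝ × ℝ} (hp : p₀ ≠ 0) (h0 : f p₀ = 0)
    {m : ℕ} (h1 : Vn m (Xs f) p₀) (h2 : Vn m (Xt f) p₀) : Van m f p₀ :=
  Van_mk hf h0 (Vn_X hp h1 h2).1 (Vn_X hp h1 h2).2

theorem Xst_comm {f : ℝ × ℝ → ℝ} (hf : ContDiff ℝ ∞ f) : Xs (Xt f) = Xt (Xs f) := by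
  ext p
  unfold Xs Xt
  simp (disch := fun_prop) only [D1_mul, D1_add, D1_sub, D1_fst, D1_snd, D2_mul,
    D2_add, D2_sub, D2_fst, D2_snd, D12_comm]
  ring

theorem LS_X {lam : ℝ} {u f : ℝ × ℝ → ℝ} (hf : LS lam u f) (p : ℝ × ℝ) :
    Xs (Xs f) p + Xt (Xt f) p + (p.1 ^ 2 + p.2 ^ 2) * (lam * rho p * Real.exp (u p)) * f p = 0 := by
  have hfs := hf.sm
  have := hf.pde p
  unfold Lap at this
  unfold Xs Xt
  simp (disch := fun_prop) only [D1_mul, D1_add, D1_sub, D1_fst, D1_snd, D2_mul,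
    D2_add, D2_sub, D2_fst, D2_snd, D12_comm]
  linear_combination (p.1 ^ 2 + p.2 ^ 2) * this

open scoped ContDiff Topology

/-- odd solutions of the linearised equation -/
structure OL (lam : ℝ) (u f : ℝ × ℝ → ℝ) : Prop where
  ls : LS lam u f
  inv : ∀ p, p ≠ 0 → f (inv2 p) = (-1) * f p
  odd : ∀ p, f (-p) = -f p

theorem circ_deriv {g : ℝ × ℝ → ℝ} (hg : ContDiff ℝ ∞ g) (t : ℝ) :
    HasDerivAt (fun t => g (cos t, sin t)) (Xt g (cos t, sin t)) t := by
  have h := (hasFDerivAt_D (sm_diff hg (cos t, sin t))).comp_hasDerivAt t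
    ((hasDerivAt_cos t).prodMk (hasDerivAt_sin t))
  refine h.congr_deriv ?_
  simp [Xt]; ring

theorem circ_rep {p : ℝ × ℝ} (hp : p.1 ^ 2 + p.2 ^ 2 = 1) : ∃ t, p = (cos t, sin t) := by
  have h : ‖(⟨p.1, p.2⟩ : ℂ)‖ = 1 := by
    rw [Complex.norm_def, Complex.normSq_mk, ← pow_two, ← pow_two, hp, Real.sqrt_one]
  have h0 : (⟨p.1, p.2⟩ : ℂ) ≠ 0 := by intro h0; rw [h0] at h; simp at h
  refine ⟨Complex.arg ⟨p.1, p.2⟩, ?_⟩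
  rw [Complex.cos_arg h0, Complex.sin_arg, h]
  simp

theorem Xt_circ {g : ℝ × ℝ → ℝ} (hg : ContDiff ℝ ∞ g)
    (h : ∀ p : ℝ × ℝ, p.1 ^ 2 + p.2 ^ 2 = 1 → g p = 0) (p : ℝ × ℝ) (hp : p.1 ^ 2 + p.2 ^ 2 = 1) :
    Xt g p = 0 := by
  obtain ⟨t, rfl⟩ := circ_rep hp
  have h1 := circ_deriv hg t
  have h2 : (fun t => g (cos t, sin t)) = fun _ => 0 := by
    ext t; apply h; simp
  rw [h2] at h1
  exact h1.unique (hasDerivAt_const _ _)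

theorem odd_D {f : ℝ × ℝ → ℝ} (hf : ContDiff ℝ ∞ f) {s : ℝ} (h : ∀ p, f (-p) = s * f p)
    (p : ℝ × ℝ) : D1 f (-p) = -s * D1 f p ∧ D2 f (-p) = -s * D2 f p := by
  have h0 : (fun q : ℝ × ℝ => f (-q)) = fun q => s * f q := funext h
  have h1 : (fun q : ℝ × ℝ => f (-q.1, -q.2)) = fun q => s * f q := funext h
  have hd := sm_diff hf
  have hc := D_comp (f := f) (a := fun q => -q.1) (b := fun q => -q.2) (p := p) (hd _)
    (by fun_prop) (by fun_prop)
  rw [h1, D1_smul', D2_smul'] at hc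
  simp (disch := fun_prop) only [D1_neg, D2_neg, D1_fst, D2_fst, D1_snd, D2_snd] at hc
  have e : (-p.1, -p.2) = -p := rfl
  rw [e] at hc
  constructor
  · linarith [hc.1]
  · linarith [hc.2]

theorem Vn_neg {g : ℝ × ℝ → ℝ} {s : ℝ} (h : ∀ p, g (-p) = s * g p) {m : ℕ} {q : ℝ × ℝ}
    (hq : Vn m g q) : Vn m g (-q) := by
  have h1 : Filter.Tendsto (fun p : ℝ × ℝ => -p) (𝓝 (-q)) (𝓝 q) := by
    have := (continuous_neg (G := ℝ × ℝ)).tendsto (-q)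
    simpa using this
  have h2 := hq.comp_tendsto h1
  have h3 : (fun p : ℝ × ℝ => ‖p - -q‖ ^ m) = (fun p => ‖p - q‖ ^ m) ∘ fun p => -p := by
    ext p; simp only [Function.comp]
    rw [← norm_neg]; congr 2; abel
  unfold Vn
  rw [h3]
  refine Asymptotics.IsBigO.trans ?_ (h2.const_mul_left s)
  refine Asymptotics.IsBigO.of_bound 1 (Filter.Eventually.of_forall fun p => ?_)
  have := h (-p)
  rw [neg_neg] at this
  simp [Function.comp, this]

namespace OL
variable {lam : ℝ} {u f : ℝ × ℝ → ℝ}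

theorem sm (h : OL lam u f) : ContDiff ℝ ∞ f := h.ls.sm

theorem van_neg (h : OL lam u f) {m : ℕ} {q : ℝ × ℝ} (hq : Van m f q) : Van m f (-q) := by
  have h1 := odd_D h.sm (s := -1) (by simpa using h.odd)
  refine ⟨Vn_neg (s := 1) (fun p => ?_) hq.1, Vn_neg (s := 1) (fun p => ?_) hq.2.1,
    Vn_neg (s := -1) (by simpa using h.odd) hq.2.2⟩
  · rw [(h1 p).1]; ring
  · rw [(h1 p).2]; ring

theorem circ (h : OL lam u f) (p : ℝ × ℝ) (hp : p.1 ^ 2 + p.2 ^ 2 = 1) : f p = 0 := by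
  have h0 : p ≠ 0 := by rintro rfl; norm_num at hp
  have := h.inv p h0
  rw [show inv2 p = p from by simp [inv2, hp]] at this
  linarith

theorem circ_t (h : OL lam u f) (p : ℝ × ℝ) (hp : p.1 ^ 2 + p.2 ^ 2 = 1) : Xt f p = 0 :=
  Xt_circ h.sm h.circ p hp

theorem circ_tt (h : OL lam u f) (p : ℝ × ℝ) (hp : p.1 ^ 2 + p.2 ^ 2 = 1) : Xt (Xt f) p = 0 :=
  Xt_circ (contDiff_Xt h.sm) h.circ_t p hp

theorem circ_ttt (h : OL lam u f) (p : ℝ × ℝ) (hp : p.1 ^ 2 + p.2 ^ 2 = 1) :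
    Xt (Xt (Xt f)) p = 0 :=
  Xt_circ (contDiff_Xt (contDiff_Xt h.sm)) h.circ_tt p hp

theorem circ_ss (h : OL lam u f) (p : ℝ × ℝ) (hp : p.1 ^ 2 + p.2 ^ 2 = 1) : Xs (Xs f) p = 0 := by
  have := LS_X h.ls p
  rw [h.circ_tt p hp, h.circ p hp] at this
  linarith

theorem circ_tss (h : OL lam u f) (p : ℝ × ℝ) (hp : p.1 ^ 2 + p.2 ^ 2 = 1) :
    Xt (Xs (Xs f)) p = 0 :=
  Xt_circ (contDiff_Xs (contDiff_Xs h.sm)) h.circ_ss p hp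

theorem Xs_odd (h : OL lam u f) (p : ℝ × ℝ) : Xs f (-p) = - Xs f p := by
  have h1 := odd_D h.sm (s := -1) (by simpa using h.odd) p
  simp only [Xs, h1, Prod.fst_neg, Prod.snd_neg]; ring

theorem van1 (h : OL lam u f) {p : ℝ × ℝ} (hp : p.1 ^ 2 + p.2 ^ 2 = 1) (h1 : Xs f p = 0) :
    Van 1 f p := by
  have h0 : p ≠ 0 := by rintro rfl; norm_num at hp
  have hs := h.sm
  exact Van_X h.sm h0 (h.circ p hp) (Vn_one (by fun_prop) h1) (Vn_one (by fun_prop) (h.circ_t p hp))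

theorem van2 (h : OL lam u f) {p : ℝ × ℝ} (hp : p.1 ^ 2 + p.2 ^ 2 = 1) (h1 : Xs f p = 0)
    (h2 : Xt (Xs f) p = 0) : Van 2 f p := by
  have h0 : p ≠ 0 := by rintro rfl; norm_num at hp
  have hs := h.sm
  refine Van_X h.sm h0 (h.circ p hp) ?_ ?_
  · exact Vn_succX (by fun_prop) h0 h1 (Vn_one (by fun_prop) (h.circ_ss p hp))
      (Vn_one (by fun_prop) h2)
  · refine Vn_succX (by fun_prop) h0 (h.circ_t p hp) ?_ (Vn_one (by fun_prop) (h.circ_tt p hp))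
    rw [Xst_comm hs]
    exact Vn_one (by fun_prop) h2

theorem Xs_mul {a b : ℝ × ℝ → ℝ} (ha : ContDiff ℝ ∞ a) (hb : ContDiff ℝ ∞ b) (p : ℝ × ℝ) :
    Xs (fun p => a p * b p) p = Xs a p * b p + a p * Xs b p := by
  unfold Xs
  simp (disch := fun_prop) only [D1_mul, D2_mul]; ring

theorem circ_sss (hu : ContDiff ℝ ∞ u) (h : OL lam u f) {p : ℝ × ℝ} (hp : p.1 ^ 2 + p.2 ^ 2 = 1)
    (h1 : Xs f p = 0) (h3 : Xt (Xt (Xs f)) p = 0) : Xs (Xs (Xs f)) p = 0 := by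
  have hs := h.sm
  have e : Xs (Xs f) = fun p => (-1) * Xt (Xt f) p +
      (-((p.1 ^ 2 + p.2 ^ 2) * (lam * rho p * Real.exp (u p)))) * f p := by
    ext p; linarith [LS_X h.ls p]
  have hadd : ∀ {a b : ℝ × ℝ → ℝ}, ContDiff ℝ ∞ a → ContDiff ℝ ∞ b → ∀ p,
      Xs (fun p => a p + b p) p = Xs a p + Xs b p := by
    intro a b ha hb p; unfold Xs; simp (disch := fun_prop) only [D1_add, D2_add]; ring
  have c1 : Xs (fun _ : ℝ × ℝ => (-1 : ℝ)) p = 0 := by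
    unfold Xs; simp (disch := fun_prop) only [D1_const, D2_const]; ring
  rw [e, hadd (by fun_prop) (by fun_prop), Xs_mul (by fun_prop) (by fun_prop),
    Xs_mul (by fun_prop) (by fun_prop), Xst_comm (by fun_prop), Xst_comm (by fun_prop), h3,
    h.circ p hp, h1, c1]
  ring

theorem van3 (hu : ContDiff ℝ ∞ u) (h : OL lam u f) {p : ℝ × ℝ} (hp : p.1 ^ 2 + p.2 ^ 2 = 1)
    (h1 : Xs f p = 0) (h2 : Xt (Xs f) p = 0) (h3 : Xt (Xt (Xs f)) p = 0) : Van 3 f p := by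
  have h0 : p ≠ 0 := by rintro rfl; norm_num at hp
  have hs := h.sm
  have hts : Vn 2 (Xt (Xs f)) p := by
    refine Vn_succX (by fun_prop) h0 h2 ?_ (Vn_one (by fun_prop) h3)
    rw [Xst_comm (by fun_prop)]
    exact Vn_one (by fun_prop) (h.circ_tss p hp)
  refine Van_X h.sm h0 (h.circ p hp) ?_ ?_
  · refine Vn_succX (by fun_prop) h0 h1 ?_ hts
    exact Vn_succX (by fun_prop) h0 (h.circ_ss p hp)
      (Vn_one (by fun_prop) (circ_sss hu h hp h1 h3)) (Vn_one (by fun_prop) (h.circ_tss p hp))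
  · refine Vn_succX (by fun_prop) h0 (h.circ_t p hp) ?_ ?_
    · rw [Xst_comm hs]; exact hts
    · refine Vn_succX (by fun_prop) h0 (h.circ_tt p hp) ?_ (Vn_one (by fun_prop) (h.circ_ttt p hp))
      rw [Xst_comm (by fun_prop), Xst_comm (by fun_prop)]
      exact Vn_one (by fun_prop) h3

end OL

theorem csq_eq {p q : ℝ × ℝ} (h : csq p = csq q) : p = q ∨ p = -q := by
  have h1 : p.1 ^ 2 - p.2 ^ 2 = q.1 ^ 2 - q.2 ^ 2 := congrArg Prod.fst h
  have h2 : 2 * p.1 * p.2 = 2 * q.1 * q.2 := congrArg Prod.snd h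
  have h3 : ((⟨p.1, p.2⟩ : ℂ)) ^ 2 = (⟨q.1, q.2⟩ : ℂ) ^ 2 := by
    apply Complex.ext <;> simp [pow_two] <;> nlinarith
  rcases sq_eq_sq_iff_eq_or_eq_neg.1 h3 with h | h
  · left; exact Prod.ext (congrArg Complex.re h) (congrArg Complex.im h)
  · right; exact Prod.ext (by simpa using congrArg Complex.re h) (by simpa using congrArg Complex.im h)

theorem csq_nsq (p : ℝ × ℝ) : (csq p).1 ^ 2 + (csq p).2 ^ 2 = (p.1 ^ 2 + p.2 ^ 2) ^ 2 := by
  simp [csq]; ring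

theorem csq_ne {p : ℝ × ℝ} (hp : p ≠ 0) : csq p ≠ 0 := by
  intro h
  have h1 := csq_nsq p
  rw [h] at h1
  have := nsq_pos hp
  simp only [Prod.fst_zero, Prod.snd_zero] at h1
  have := pow_pos this 2
  linarith

namespace OL
variable {lam : ℝ} {u f : ℝ × ℝ → ℝ}

theorem van_csq (h : OL lam u f) {m : ℕ} {p q : ℝ × ℝ} (hq : Van m f q) (hc : csq q = csq p) :
    Van m f p := by
  rcases csq_eq hc.symm with rfl | rfl
  · exact hq
  · exact h.van_neg hq

theorem kill_a (hl1 : 2 < lam) (hl2 : lam ≤ 8) (hu : PS lam u) (h : OL lam u f) {p₀ x₀ : ℝ × ℝ}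
    (h0 : p₀ ≠ 0) (h1 : p₀.1 ^ 2 + p₀.2 ^ 2 < 1) (hx : x₀.1 ^ 2 + x₀.2 ^ 2 = 1)
    (hv : Van 1 f p₀) (hw : Van 1 f x₀) : ∀ p, f p = 0 := by
  have hx0 : x₀ ≠ 0 := by rintro rfl; norm_num at hx
  have hA := csq_ne h0
  have hn := nsq_pos h0
  have hAn := csq_nsq p₀
  have hCn := csq_nsq x₀
  rw [hx] at hCn
  have hBn := inv2_nsq hA
  refine N_three hl1 hl2 hu h.ls (s := -1) (by norm_num) h.inv (csq p₀) (inv2 (csq p₀)) (csq x₀)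
    hA (inv2_ne hA) (csq_ne hx0) ?_ ?_
  · intro p hp
    have e1 := qA_inv_pair hA hp
    have e2 := qA_inv_unit (A := csq x₀) (by linarith) hp
    rw [← e1, ← e2]; ring
  · intro p hp hp1
    have hpn := csq_nsq p
    have hB : inv2 (csq p₀) ≠ csq p := by
      intro he
      rw [he, hpn, hAn] at hBn
      have hb : (p₀.1 ^ 2 + p₀.2 ^ 2) ^ 2 < 1 := by nlinarith
      have hb2 : 1 < ((p₀.1 ^ 2 + p₀.2 ^ 2) ^ 2)⁻¹ := (one_lt_inv₀ (by positivity)).2 hb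
      nlinarith [nsq_pos hp]
    rw [if_neg hB]
    by_cases hA' : csq p₀ = csq p
    · have hC : csq x₀ ≠ csq p := by
        intro he
        rw [← hA'] at he
        rw [he, hAn] at hCn
        nlinarith
      rw [if_pos hA', if_neg hC]
      exact h.van_csq hv hA'
    · rw [if_neg hA']
      by_cases hC : csq x₀ = csq p
      · rw [if_pos hC]; exact h.van_csq hw hC
      · rw [if_neg hC]; exact Van_zero h.sm p

theorem kill_b (hl1 : 2 < lam) (hl2 : lam ≤ 8) (hu : PS lam u) (h : OL lam u f) {A B C : ℝ × ℝ}
    (hA : A.1 ^ 2 + A.2 ^ 2 = 1) (hB : B.1 ^ 2 + B.2 ^ 2 = 1) (hC : C.1 ^ 2 + C.2 ^ 2 = 1)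
    (hv : ∀ p : ℝ × ℝ, p.1 ^ 2 + p.2 ^ 2 = 1 → Van ((if A = csq p then 1 else 0) +
      (if B = csq p then 1 else 0) + (if C = csq p then 1 else 0)) f p) : ∀ p, f p = 0 := by
  have hne : ∀ A : ℝ × ℝ, A.1 ^ 2 + A.2 ^ 2 = 1 → A ≠ 0 := by
    rintro A hA rfl; norm_num at hA
  refine N_three hl1 hl2 hu h.ls (s := -1) (by norm_num) h.inv A B C
    (hne A hA) (hne B hB) (hne C hC) ?_ ?_
  · intro p hp
    rw [← qA_inv_unit hA hp, ← qA_inv_unit hB hp, ← qA_inv_unit hC hp]; ring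
  · intro p hp hp1
    by_cases h1 : p.1 ^ 2 + p.2 ^ 2 = 1
    · exact hv p h1
    · have hn : ∀ A : ℝ × ℝ, A.1 ^ 2 + A.2 ^ 2 = 1 → A ≠ csq p := by
        rintro A hA rfl
        rw [csq_nsq] at hA
        have := nsq_pos hp
        apply h1; nlinarith
      rw [if_neg (hn A hA), if_neg (hn B hB), if_neg (hn C hC)]
      exact Van_zero h.sm p

theorem ex_zero (h : OL lam u f) : ∃ p : ℝ × ℝ, p.1 ^ 2 + p.2 ^ 2 = 1 ∧ Xs f p = 0 := by
  have hs := h.sm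
  have hc : Continuous fun t => Xs f (cos t, sin t) :=
    (contDiff_Xs hs).continuous.comp (by fun_prop)
  have e : Xs f (cos (0 + π), sin (0 + π)) = - Xs f (cos 0, sin 0) := by
    rw [cos_add_pi, sin_add_pi]; exact h.Xs_odd (cos 0, sin 0)
  have : (0 : ℝ) ∈ Set.uIcc (Xs f (cos 0, sin 0)) (Xs f (cos (0 + π), sin (0 + π))) := by
    rw [e, Set.mem_uIcc]
    rcases le_total 0 (Xs f (cos 0, sin 0)) with h | h
    · right; constructor <;> linarith
    · left; constructor <;> linarith
  obtain ⟨t, -, ht⟩ := intermediate_value_uIcc hc.continuousOn this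
  exact ⟨(cos t, sin t), by simp, ht⟩

/-- (a) no singular zero in the punctured open disc -/
theorem no_sing (hl1 : 2 < lam) (hl2 : lam ≤ 8) (hu : PS lam u) (h : OL lam u f)
    (hne : ∃ p, f p ≠ 0) {p : ℝ × ℝ} (h0 : p ≠ 0) (h1 : p.1 ^ 2 + p.2 ^ 2 < 1)
    (hf : f p = 0) (hd1 : D1 f p = 0) (hd2 : D2 f p = 0) : False := by
  obtain ⟨x, hx, hx0⟩ := h.ex_zero
  obtain ⟨q, hq⟩ := hne
  exact hq (kill_a hl1 hl2 hu h h0 h1 hx (Van_one h.sm hf hd1 hd2) (h.van1 hx hx0) q)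

/-- (b) no double zero on the circle -/
theorem no_double (hl1 : 2 < lam) (hl2 : lam ≤ 8) (hu : PS lam u) (h : OL lam u f)
    (hne : ∃ p, f p ≠ 0) {p : ℝ × ℝ} (hp : p.1 ^ 2 + p.2 ^ 2 = 1)
    (h1 : Xs f p = 0) (h2 : Xt (Xs f) p = 0) : False := by
  obtain ⟨q, hq⟩ := hne
  have hs := h.sm
  have hpn := csq_nsq p
  rw [hp] at hpn
  by_cases h3 : Xt (Xt (Xs f)) p = 0
  · refine hq (kill_b hl1 hl2 hu h (A := csq p) (B := csq p) (C := csq p) (by linarith)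
      (by linarith) (by linarith) ?_ q)
    intro x hx
    by_cases hc : csq p = csq x
    · rw [if_pos hc]; exact h.van_csq (van3 hu.sm h hp h1 h2 h3) hc
    · rw [if_neg hc]; exact Van_zero hs x
  · -- another zero
    obtain ⟨t, rfl⟩ := circ_rep hp
    have hex : ∃ y : ℝ × ℝ, y.1 ^ 2 + y.2 ^ 2 = 1 ∧ Xs f y = 0 ∧ csq y ≠ csq (cos t, sin t) := by
      by_contra hcon
      push Not at hcon
      set g := fun t => Xs f (cos t, sin t) with hg
      have hgc : Continuous g := (contDiff_Xs hs).continuous.comp (by fun_prop)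
      have hgd : ∀ t, HasDerivAt g (Xt (Xs f) (cos t, sin t)) t := fun t => circ_deriv (by fun_prop) t
      have hgdd : ∀ t, HasDerivAt (fun t => Xt (Xs f) (cos t, sin t))
        (Xt (Xt (Xs f)) (cos t, sin t)) t := fun t => circ_deriv (by fun_prop) t
      have hgp : ∀ t, g (t + π) = - g t := fun t => by
        simp only [hg, cos_add_pi, sin_add_pi]; exact h.Xs_odd (cos t, sin t)
      -- no zeros in (t, t+π)
      have hnz : ∀ x ∈ Set.Ioo t (t + π), g x ≠ 0 := by
        intro x hx h0
        have := hcon (cos x, sin x) (by simp) h0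
        have hs0 : 0 < sin (x - t) := sin_pos_of_pos_of_lt_pi (by linarith [hx.1]) (by linarith [hx.2])
        have hs1 : sin (x - t) = 0 := by
          rw [sin_sub]
          rcases csq_eq this with h | h
          · have a := congrArg Prod.fst h
            have b := congrArg Prod.snd h
            simp only at a b
            rw [a, b]; ring
          · have a := congrArg Prod.fst h
            have b := congrArg Prod.snd h
            simp only [Prod.fst_neg, Prod.snd_neg] at a b
            rw [a, b]; ring
        linarith
      -- second derivative sign: extremum strict on both sides, contradiction
      have key : ∀ e : ℝ, e ^ 2 = 1 → 0 < e * Xt (Xt (Xs f)) (cos t, sin t) → False := by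
        intro e he hpos
        have hmin : IsLocalMin (fun x => e * g x) t ∧ ∀ᶠ x in 𝓝[≠] t, 0 < e * g x := by
          have hd2 : HasDerivAt (fun t => e * Xt (Xs f) (cos t, sin t))
            (e * Xt (Xt (Xs f)) (cos t, sin t)) t := (hgdd t).const_mul e
          have hsign := hd2.tendsto_slope
          have hev : ∀ᶠ x in 𝓝[≠] t, 0 < slope (fun t => e * Xt (Xs f) (cos t, sin t)) t x :=
            hsign.eventually (lt_mem_nhds hpos)
          have hev' : ∀ᶠ x in 𝓝[≠] t, 0 < (e * Xt (Xs f) (cos x, sin x)) / (x - t) := by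
            filter_upwards [hev] with x hx
            rw [slope_def_field, h2] at hx
            simpa using hx
          rw [eventually_nhdsWithin_iff] at hev'
          obtain ⟨d, hd, hball⟩ := Metric.eventually_nhds_iff.1 hev'
          have hpos' : ∀ x, dist x t < d → x ≠ t → 0 < e * g x := by
            intro x hx hxt
            have hg0 : g t = 0 := h1
            rcases lt_or_gt_of_ne hxt with hlt | hgt
            · obtain ⟨y, hy, hye⟩ := exists_hasDerivAt_eq_slope (fun x => e * g x)
                (fun x => e * Xt (Xs f) (cos x, sin x)) hlt (by fun_prop)
                (fun y _ => (hgd y).const_mul e)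
              rw [Real.dist_eq, abs_lt] at hx
              have := hball (y := y) (by rw [Real.dist_eq, abs_lt]; constructor <;> linarith [hy.1, hy.2])
                hy.2.ne
              rw [hye, hg0] at this
              have h5 : 0 < (t - x) := by linarith
              have h6 : y - t < 0 := by linarith [hy.2]
              rw [div_div] at this
              have h7 : (t - x) * (y - t) < 0 := mul_neg_of_pos_of_neg h5 h6
              rw [mul_zero, zero_sub] at this
              by_contra h8
              push Not at h8
              exact absurd this (not_lt.2 (div_nonpos_of_nonneg_of_nonpos (by linarith) h7.le))
            · obtain ⟨y, hy, hye⟩ := exists_hasDerivAt_eq_slope (fun x => e * g x)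
                (fun x => e * Xt (Xs f) (cos x, sin x)) hgt (by fun_prop)
                (fun y _ => (hgd y).const_mul e)
              rw [Real.dist_eq, abs_lt] at hx
              have := hball (y := y) (by rw [Real.dist_eq, abs_lt]; constructor <;> linarith [hy.1, hy.2])
                hy.1.ne'
              rw [hye, hg0] at this
              have h5 : 0 < (x - t) := by linarith
              have h6 : 0 < y - t := by linarith [hy.1]
              rw [div_div, mul_zero, sub_zero] at this
              have h7 := mul_pos h5 h6
              by_contra h8
              push Not at h8
              exact absurd this (not_lt.2 (div_nonpos_of_nonpos_of_nonneg h8 h7.le))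
          have hg0 : g t = 0 := h1
          constructor
          · filter_upwards [Metric.ball_mem_nhds t hd] with x hx
            by_cases hxt : x = t
            · rw [hxt]
            · simp only [hg0, mul_zero]; exact (hpos' x hx hxt).le
          · rw [eventually_nhdsWithin_iff]
            filter_upwards [Metric.ball_mem_nhds t hd] with x hx hxt
            exact hpos' x hx hxt
        obtain ⟨-, hev⟩ := hmin
        rw [eventually_nhdsWithin_iff] at hev
        obtain ⟨d, hd, hball⟩ := Metric.eventually_nhds_iff.1 hev
        set r := min (d / 2) (π / 4) with hr
        have hr0 : 0 < r := lt_min (by linarith) (by positivity)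
        have hrd : r < d := lt_of_le_of_lt (min_le_left _ _) (by linarith)
        have hrp : r ≤ π / 4 := min_le_right _ _
        have pi0 := pi_pos
        have k1 : 0 < e * g (t + r) := hball (y := t + r)
          (by rw [Real.dist_eq]; simpa [abs_of_pos hr0] using hrd) (by simp [hr0.ne'])
        have k2 : 0 < e * g (t - r) := hball (y := t - r)
          (by rw [Real.dist_eq]; simpa [abs_of_pos hr0] using hrd) (by simp [hr0.ne'])
        have k3 : e * g (t - r + π) < 0 := by rw [hgp]; linarith
        have hivt := intermediate_value_Icc' (f := fun x => e * g x) (a := t + r) (b := t - r + π)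
          (by linarith) (by fun_prop)
        obtain ⟨x, hx, hx0⟩ := hivt ⟨k3.le, k1.le⟩
        have he0 : e ≠ 0 := by rintro rfl; norm_num at he
        exact hnz x ⟨by linarith [hx.1], by linarith [hx.2]⟩ ((mul_eq_zero.1 hx0).resolve_left he0)
      rcases lt_or_gt_of_ne h3 with hn | hpz
      · exact key (-1) (by norm_num) (by linarith)
      · exact key 1 (by norm_num) (by linarith)
    obtain ⟨y, hy, hy0, hyc⟩ := hex
    have hyn := csq_nsq y
    rw [hy] at hyn
    refine hq (kill_b hl1 hl2 hu h (A := csq (cos t, sin t)) (B := csq (cos t, sin t)) (C := csq y)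
      (by linarith) (by linarith) (by linarith) ?_ q)
    intro x hx
    by_cases hc : csq (cos t, sin t) = csq x
    · have : csq y ≠ csq x := fun h => hyc (h.trans hc.symm)
      rw [if_pos hc, if_neg this]
      exact h.van_csq (h.van2 hp h1 h2) hc
    · rw [if_neg hc]
      by_cases hc' : csq y = csq x
      · rw [if_pos hc']; exact h.van_csq (h.van1 hy hy0) hc'
      · rw [if_neg hc']; exact Van_zero hs x

/-- three distinct zeros on circle are impossible -/
theorem no_three (hl1 : 2 < lam) (hl2 : lam ≤ 8) (hu : PS lam u) (h : OL lam u f)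
    (hne : ∃ p, f p ≠ 0) {x y z : ℝ × ℝ} (hx : x.1 ^ 2 + x.2 ^ 2 = 1) (hy : y.1 ^ 2 + y.2 ^ 2 = 1)
    (hz : z.1 ^ 2 + z.2 ^ 2 = 1) (hx0 : Xs f x = 0) (hy0 : Xs f y = 0) (hz0 : Xs f z = 0)
    (hxy : csq x ≠ csq y) (hyz : csq y ≠ csq z) (hxz : csq x ≠ csq z) : False := by
  obtain ⟨q, hq⟩ := hne
  have hxn := csq_nsq x
  have hyn := csq_nsq y
  have hzn := csq_nsq z
  rw [hx] at hxn
  rw [hy] at hyn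
  rw [hz] at hzn
  refine hq (kill_b hl1 hl2 hu h (A := csq x) (B := csq y) (C := csq z)
      (by linarith) (by linarith) (by linarith) ?_ q)
  intro p hp
  by_cases h1 : csq x = csq p
  · have h2 : csq y ≠ csq p := fun h => hxy (h1.trans h.symm)
    have h3 : csq z ≠ csq p := fun h => hxz (h1.trans h.symm)
    rw [if_pos h1, if_neg h2, if_neg h3]
    exact h.van_csq (h.van1 hx hx0) h1
  · rw [if_neg h1]
    by_cases h2 : csq y = csq p
    · have h3 : csq z ≠ csq p := fun h => hyz (h2.trans h.symm)
      rw [if_pos h2, if_neg h3]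
      exact h.van_csq (h.van1 hy hy0) h2
    · rw [if_neg h2]
      by_cases h3 : csq z = csq p
      · rw [if_pos h3]; exact h.van_csq (h.van1 hz hz0) h3
      · rw [if_neg h3]; exact Van_zero h.sm p

end OL

open scoped ContDiff Topology

theorem Xpar1 {f : ℝ × ℝ → ℝ} (hf : ContDiff ℝ ∞ f) {s : ℝ}
    (h : ∀ p : ℝ × ℝ, f (-p.1, p.2) = s * f p) (p : ℝ × ℝ) :
    Xs f (-p.1, p.2) = s * Xs f p ∧ Xt f (-p.1, p.2) = (-s) * Xt f p := by
  have := par1 hf h p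
  simp only [Xs, Xt, this]
  constructor <;> ring

theorem Xpar2 {f : ℝ × ℝ → ℝ} (hf : ContDiff ℝ ∞ f) {s : ℝ}
    (h : ∀ p : ℝ × ℝ, f (p.1, -p.2) = s * f p) (p : ℝ × ℝ) :
    Xs f (p.1, -p.2) = s * Xs f p ∧ Xt f (p.1, -p.2) = (-s) * Xt f p := by
  have := par2 hf h p
  simp only [Xs, Xt, this]
  constructor <;> ring

/-- good solutions: first two rotational derivatives nontrivial -/
structure GS (lam : ℝ) (u : ℝ × ℝ → ℝ) : Prop where
  l1 : 2 < lam
  l2 : lam ≤ 8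
  ps : PS lam u
  n1 : ∃ p, phi1 u p ≠ 0
  n2 : ∃ p, phi2 u p ≠ 0

def psi (a b : ℝ) (u : ℝ × ℝ → ℝ) (p : ℝ × ℝ) : ℝ := a * phi1 u p + b * phi2 u p

@[fun_prop]
theorem contDiff_phi1 {u : ℝ × ℝ → ℝ} (h : ContDiff ℝ ∞ u) : ContDiff ℝ ∞ (phi1 u) := by
  unfold phi1; fun_prop
@[fun_prop]
theorem contDiff_phi2 {u : ℝ × ℝ → ℝ} (h : ContDiff ℝ ∞ u) : ContDiff ℝ ∞ (phi2 u) := by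
  unfold phi2; fun_prop
@[fun_prop]
theorem contDiff_phi3 {u : ℝ × ℝ → ℝ} (h : ContDiff ℝ ∞ u) : ContDiff ℝ ∞ (phi3 u) := by
  unfold phi3; fun_prop

theorem OL_psi {lam : ℝ} {u : ℝ × ℝ → ℝ} (h : PS lam u) (a b : ℝ) : OL lam u (psi a b u) := by
  have hs := h.sm
  refine ⟨⟨by unfold psi; fun_prop, fun p => ?_⟩, fun p hp => ?_, fun p => ?_⟩
  · have e1 := (LS_phi1 h).pde p
    have e2 := (LS_phi2 h).pde p
    unfold Lap at *
    unfold psi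
    simp (disch := fun_prop) only [D1_mul, D1_add, D1_const, D2_mul, D2_add, D2_const]
    linear_combination a * e1 + b * e2
  · simp only [psi, phi1_inv h hp, phi2_inv h hp]; ring
  · have e1 := phi1_od2 h (-p.1, p.2)
    have e2 := phi1_ev1 h p
    have e3 := phi2_ev2 h (-p.1, p.2)
    have e4 := phi2_od1 h p
    have e : -p = (-p.1, -p.2) := rfl
    simp only [psi, e]
    simp only at e1 e3
    rw [e1, e2, e3, e4]; ring

theorem psi_10 (u : ℝ × ℝ → ℝ) : psi 1 0 u = phi1 u := by ext p; simp [psi]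
theorem psi_01 (u : ℝ × ℝ → ℝ) : psi 0 1 u = phi2 u := by ext p; simp [psi]

theorem OL_phi1 {lam : ℝ} {u : ℝ × ℝ → ℝ} (h : PS lam u) : OL lam u (phi1 u) := by
  rw [← psi_10]; exact OL_psi h 1 0
theorem OL_phi2 {lam : ℝ} {u : ℝ × ℝ → ℝ} (h : PS lam u) : OL lam u (phi2 u) := by
  rw [← psi_01]; exact OL_psi h 0 1

theorem D_psi {u : ℝ × ℝ → ℝ} (hs : ContDiff ℝ ∞ u) (a b : ℝ) (p : ℝ × ℝ) :
    D1 (psi a b u) p = a * D1 (phi1 u) p + b * D1 (phi2 u) p ∧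
    D2 (psi a b u) p = a * D2 (phi1 u) p + b * D2 (phi2 u) p := by
  unfold psi
  simp (disch := fun_prop) only [D1_mul, D1_add, D1_const, D2_mul, D2_add, D2_const]
  constructor <;> ring

namespace GS
variable {lam : ℝ} {u : ℝ × ℝ → ℝ}

theorem psi_ne (h : GS lam u) {a b : ℝ} (hab : a ≠ 0 ∨ b ≠ 0) : ∃ p, psi a b u p ≠ 0 := by
  by_contra hcon
  push Not at hcon
  have e : ∀ p, a * phi1 u p - b * phi2 u p = 0 := by
    intro p
    have := hcon (-p.1, p.2)
    simp only [psi, phi1_ev1 h.ps p, phi2_od1 h.ps p] at this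
    linarith
  rcases hab with ha | hb
  · obtain ⟨p, hp⟩ := h.n1
    have h1 := hcon p
    have h2 := e p
    unfold psi at h1
    exact hp ((mul_eq_zero.1 (show a * phi1 u p = 0 by linarith)).resolve_left ha)
  · obtain ⟨p, hp⟩ := h.n2
    have h1 := hcon p
    have h2 := e p
    unfold psi at h1
    exact hp ((mul_eq_zero.1 (show b * phi2 u p = 0 by linarith)).resolve_left hb)

/-- (a) -/
theorem nosing (h : GS lam u) {a b : ℝ} (hab : a ≠ 0 ∨ b ≠ 0) {p : ℝ × ℝ} (h0 : p ≠ 0)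
    (h1 : p.1 ^ 2 + p.2 ^ 2 < 1) (hf : psi a b u p = 0)
    (hd1 : D1 (psi a b u) p = 0) (hd2 : D2 (psi a b u) p = 0) : False :=
  OL.no_sing h.l1 h.l2 h.ps (OL_psi h.ps a b) (h.psi_ne hab) h0 h1 hf hd1 hd2

/-- (b) -/
theorem wedge (h : GS lam u) {p : ℝ × ℝ} (hp : p.1 ^ 2 + p.2 ^ 2 = 1) :
    Xs (phi1 u) p * Xt (Xs (phi2 u)) p - Xs (phi2 u) p * Xt (Xs (phi1 u)) p ≠ 0 := by
  have hs := h.ps.sm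
  intro hz
  have key : ∀ a b : ℝ, (a ≠ 0 ∨ b ≠ 0) → a * Xs (phi1 u) p + b * Xs (phi2 u) p = 0 →
      a * Xt (Xs (phi1 u)) p + b * Xt (Xs (phi2 u)) p = 0 → False := by
    intro a b hab h1 h2
    have eX : Xs (psi a b u) = fun p => a * Xs (phi1 u) p + b * Xs (phi2 u) p := by
      ext p; unfold Xs; rw [(D_psi hs a b p).1, (D_psi hs a b p).2]; ring
    have eT : Xt (Xs (psi a b u)) p = a * Xt (Xs (phi1 u)) p + b * Xt (Xs (phi2 u)) p := by
      rw [eX]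
      unfold Xt
      simp (disch := fun_prop) only [D1_mul, D1_add, D1_const, D2_mul, D2_add, D2_const]
      ring
    exact OL.no_double h.l1 h.l2 h.ps (OL_psi h.ps a b) (h.psi_ne hab) hp
      (by rw [eX]; exact h1) (by rw [eT]; exact h2)
  by_cases hX : Xs (phi1 u) p = 0 ∧ Xs (phi2 u) p = 0
  · by_cases hY : Xt (Xs (phi1 u)) p = 0 ∧ Xt (Xs (phi2 u)) p = 0
    · exact key 1 0 (by simp) (by rw [hX.1]; simp) (by rw [hY.1]; simp)
    · rw [not_and_or] at hY
      refine key (Xt (Xs (phi2 u)) p) (-Xt (Xs (phi1 u)) p) ?_ (by rw [hX.1, hX.2]; ring) (by ring)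
      rcases hY with hY | hY
      · right; simpa using hY
      · left; exact hY
  · rw [not_and_or] at hX
    refine key (Xs (phi2 u) p) (-Xs (phi1 u) p) ?_ (by ring) (by linarith)
    rcases hX with hX | hX
    · right; simpa using hX
    · left; exact hX

theorem c1_ne (h : GS lam u) {p : ℝ × ℝ} (hp : p.1 ^ 2 + p.2 ^ 2 = 1) (h2 : p.2 ≠ 0) :
    Xs (phi1 u) p ≠ 0 := by
  have hs := h.ps.sm
  intro hz
  have hx1 := Xpar1 (f := phi1 u) (by fun_prop) (s := 1) (by simpa using phi1_ev1 h.ps)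
  have hx2 := Xpar2 (f := phi1 u) (by fun_prop) (s := -1) (by simpa using phi1_od2 h.ps)
  by_cases h1 : p.1 = 0
  · refine OL.no_double h.l1 h.l2 h.ps (OL_phi1 h.ps) h.n1 hp hz ?_
    have := (Xpar1 (f := Xs (phi1 u)) (by fun_prop) (fun p => (hx1 p).1) p).2
    have e : (-p.1, p.2) = p := by ext <;> simp [h1]
    rw [e] at this
    linarith
  · have hz' := (hx2 p).1
    rw [hz] at hz'
    have hz1 := (hx2 (1, 0)).1
    simp only [neg_zero] at hz1
    refine OL.no_three h.l1 h.l2 h.ps (OL_phi1 h.ps) h.n1 (x := (1, 0)) (y := p)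
      (z := (p.1, -p.2)) (by norm_num) hp (by simpa using hp) (by linarith) hz (by simpa using hz') ?_ ?_ ?_
    · intro hc
      have := congrArg Prod.snd hc
      simp [csq] at this; tauto
    · intro hc
      have := congrArg Prod.snd hc
      simp [csq] at this
      have h3 : p.1 * p.2 = 0 := by linarith
      simp at h3; tauto
    · intro hc
      have := congrArg Prod.snd hc
      simp [csq] at this; tauto

theorem c2_ne (h : GS lam u) {p : ℝ × ℝ} (hp : p.1 ^ 2 + p.2 ^ 2 = 1) (h1 : p.1 ≠ 0) :
    Xs (phi2 u) p ≠ 0 := by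
  have hs := h.ps.sm
  intro hz
  have hx1 := Xpar1 (f := phi2 u) (by fun_prop) (s := -1) (by simpa using phi2_od1 h.ps)
  have hx2 := Xpar2 (f := phi2 u) (by fun_prop) (s := 1) (by simpa using phi2_ev2 h.ps)
  by_cases h2 : p.2 = 0
  · refine OL.no_double h.l1 h.l2 h.ps (OL_phi2 h.ps) h.n2 hp hz ?_
    have := (Xpar2 (f := Xs (phi2 u)) (by fun_prop) (fun p => (hx2 p).1) p).2
    have e : (p.1, -p.2) = p := by ext <;> simp [h2]
    rw [e] at this
    linarith
  · have hz' := (hx1 p).1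
    rw [hz] at hz'
    have hz1 := (hx1 (0, 1)).1
    simp only [neg_zero] at hz1
    refine OL.no_three h.l1 h.l2 h.ps (OL_phi2 h.ps) h.n2 (x := (0, 1)) (y := p)
      (z := (-p.1, p.2)) (by norm_num) hp (by simpa using hp) (by linarith) hz (by simpa using hz') ?_ ?_ ?_
    · intro hc
      have := congrArg Prod.snd hc
      simp [csq] at this; tauto
    · intro hc
      have := congrArg Prod.snd hc
      simp [csq] at this
      have h3 : p.1 * p.2 = 0 := by linarith
      simp at h3; tauto
    · intro hc
      have := congrArg Prod.snd hc
      simp [csq] at this; tauto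

end GS

theorem Vn_succ2 {f : ℝ × ℝ → ℝ} (hf : ContDiff ℝ ∞ f) {p₀ : ℝ × ℝ} (h0 : f p₀ = 0)
    (h1 : D1 f p₀ = 0) (h2 : D2 f p₀ = 0) : Vn 2 f p₀ :=
  Vn_succ hf h0 (Vn_one (contDiff_D1 hf) h1) (Vn_one (contDiff_D2 hf) h2)

theorem OL.van2_zero {lam : ℝ} {u f : ℝ × ℝ → ℝ} (h : OL lam u f) (h1 : D1 f 0 = 0)
    (h2 : D2 f 0 = 0) : Van 2 f 0 := by
  have hs := h.sm
  have hd := odd_D hs (s := -1) (by simpa using h.odd)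
  have h0 : f 0 = 0 := by have := h.odd 0; simp at this; linarith
  have hd1 := odd_D (f := D1 f) (by fun_prop) (s := 1) (fun p => by rw [(hd p).1]; ring) 0
  have hd2 := odd_D (f := D2 f) (by fun_prop) (s := 1) (fun p => by rw [(hd p).2]; ring) 0
  simp only [neg_zero] at hd1 hd2
  refine Van_mk hs h0 (Vn_succ2 (by fun_prop) h1 (by linarith [hd1.1]) (by linarith [hd1.2]))
    (Vn_succ2 (by fun_prop) h2 (by linarith [hd2.1]) (by linarith [hd2.2]))

namespace GS
variable {lam : ℝ} {u : ℝ × ℝ → ℝ}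

theorem D1phi1_0 (h : GS lam u) : D1 (phi1 u) 0 = 0 := by
  have := (par1 (contDiff_phi1 h.ps.sm) (s := 1) (by simpa using phi1_ev1 h.ps) 0).1
  simp only [Prod.fst_zero, Prod.snd_zero, neg_zero, Prod.mk_zero_zero] at this
  linarith
theorem D2phi2_0 (h : GS lam u) : D2 (phi2 u) 0 = 0 := by
  have := (par2 (contDiff_phi2 h.ps.sm) (s := 1) (by simpa using phi2_ev2 h.ps) 0).2
  simp only [Prod.fst_zero, Prod.snd_zero, neg_zero, Prod.mk_zero_zero] at this
  linarith

theorem D2phi1_0 (h : GS lam u) : D2 (phi1 u) 0 ≠ 0 := by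
  intro hz
  obtain ⟨q, hq⟩ := h.n1
  have ho := OL_phi1 h.ps
  have hs := h.ps.sm
  have hx2 := (Xpar2 (f := phi1 u) (by fun_prop) (s := -1) (by simpa using phi1_od2 h.ps) (1, 0)).1
  simp only [neg_zero] at hx2
  refine hq (N_origin h.l1 h.l2 h.ps ho.ls (s := -1) (by norm_num) ho.inv (csq (1, 0))
    (by norm_num [csq]) (ho.van2_zero h.D1phi1_0 hz) ?_ q)
  intro p _ _ hc
  exact ho.van_csq (ho.van1 (p := (1, 0)) (by norm_num) (by linarith)) hc

theorem D1phi2_0 (h : GS lam u) : D1 (phi2 u) 0 ≠ 0 := by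
  intro hz
  obtain ⟨q, hq⟩ := h.n2
  have ho := OL_phi2 h.ps
  have hs := h.ps.sm
  have hx1 := (Xpar1 (f := phi2 u) (by fun_prop) (s := -1) (by simpa using phi2_od1 h.ps) (0, 1)).1
  simp only [neg_zero] at hx1
  refine hq (N_origin h.l1 h.l2 h.ps ho.ls (s := -1) (by norm_num) ho.inv (csq (0, 1))
    (by norm_num [csq]) (ho.van2_zero hz h.D2phi2_0) ?_ q)
  intro p _ _ hc
  exact ho.van_csq (ho.van1 (p := (0, 1)) (by norm_num) (by linarith)) hc

end GS

open scoped ContDiff Topology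

theorem convex_log {X : Type*} [NormedAddCommGroup X] [NormedSpace ℝ X] {U : Set X}
    (hU : Convex ℝ U) (hne : U.Nonempty) (ho : IsOpen U) {g : X → ℂ} (hg : ContinuousOn g U)
    (h0 : ∀ x ∈ U, g x ≠ 0) :
    ∃ f : X → ℂ, ContinuousOn f U ∧ ∀ x ∈ U, Complex.exp (f x) = g x := by
  have hs : IsSimplyConnected U := by
    have : ContractibleSpace U := hU.contractibleSpace hne
    change SimplyConnectedSpace U
    infer_instance
  obtain ⟨f, h1, h2⟩ := Complex.exists_continuousOn_eqOn_exp_comp hs ho hg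
    (by rintro ⟨x, hx, hx0⟩; exact h0 x hx hx0)
  exact ⟨f, h1, fun x hx => h2 hx⟩

theorem exp_const_of_cont {h : ℝ → ℂ} (hc : Continuous h)
    (he : ∀ t, Complex.exp (h t) = Complex.exp (h 0)) (t : ℝ) : h t = h 0 := by
  have h1 : ∀ t, ∃ n : ℤ, h t = h 0 + n * (2 * π * Complex.I) := fun t =>
    Complex.exp_eq_exp_iff_exists_int.1 (he t)
  choose n hn using h1
  have hnc : Continuous n := by
    rw [Int.isClosedEmbedding_coe_real.isEmbedding.continuous_iff]
    have : (fun t => ((n t : ℤ) : ℝ)) = fun t => ((h t - h 0).im) / (2 * π) := by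
      ext t
      rw [hn t]
      have := pi_pos
      simp
    change Continuous (fun t => ((n t : ℤ) : ℝ))
    rw [this]
    fun_prop
  have h2 : n t = n 0 := PreconnectedSpace.constant inferInstance hnc
  have h3 := hn t
  rw [h2] at h3
  have h4 := hn 0
  rw [← h4] at h3
  exact h3

theorem factor_zeros {R : ℝ} (S : Finset ℂ) : ∀ (Y : ℂ → ℂ),
    (∀ p ∈ S, p ∈ Metric.ball (0 : ℂ) R ∧ Y p = 0 ∧ ∃ d : ℂ, d ≠ 0 ∧ HasDerivAt Y d p) →
    ContinuousOn Y (Metric.ball 0 R) → (∀ z ∈ Metric.ball (0 : ℂ) R, z ∉ S → Y z ≠ 0) →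
    ∃ g : ℂ → ℂ, ContinuousOn g (Metric.ball 0 R) ∧ (∀ z ∈ Metric.ball (0 : ℂ) R, g z ≠ 0) ∧
      ∀ z ∈ Metric.ball (0 : ℂ) R, Y z = (∏ p ∈ S, (z - p)) * g z := by
  classical
  induction S using Finset.induction_on with
  | empty =>
    intro Y _ hc hn
    exact ⟨Y, hc, fun z hz => hn z hz (by simp), by simp⟩
  | insert p S hp ih =>
    intro Y hS hc hn
    obtain ⟨hpR, hp0, d, hd0, hd⟩ := hS p (Finset.mem_insert_self _ _)
    have hnb : Metric.ball (0 : ℂ) R ∈ 𝓝 p := Metric.isOpen_ball.mem_nhds hpR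
    have hY : ∀ z, Y z = (z - p) * dslope Y p z := by
      intro z
      have := sub_smul_dslope Y p z
      rw [hp0, sub_zero, smul_eq_mul] at this
      exact this.symm
    have hpp : dslope Y p p = d := by rw [dslope_same, hd.deriv]
    have hQ : ∀ q ∈ S, q ∈ Metric.ball (0 : ℂ) R ∧ dslope Y p q = 0 ∧
        ∃ d : ℂ, d ≠ 0 ∧ HasDerivAt (dslope Y p) d q := by
      intro q hq
      obtain ⟨hqR, hq0, e, he0, he⟩ := hS q (Finset.mem_insert_of_mem hq)
      have hqp : q ≠ p := by rintro rfl; exact hp hq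
      have hqp' : q - p ≠ 0 := sub_ne_zero.2 hqp
      refine ⟨hqR, ?_, e / (q - p), div_ne_zero he0 hqp', ?_⟩
      · have := hY q
        rw [hq0] at this
        exact (mul_eq_zero.1 this.symm).resolve_left hqp'
      · have h1 : HasDerivAt (fun z => Y z / (z - p)) (e / (q - p)) q := by
          have := he.div ((hasDerivAt_id q).sub_const p) hqp'
          refine this.congr_deriv ?_
          simp only [id, hq0, zero_mul, sub_zero]
          field_simp
        refine h1.congr_of_eventuallyEq ?_
        filter_upwards [isOpen_ne.mem_nhds hqp] with z hz
        have hz' : z - p ≠ 0 := sub_ne_zero.2 hz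
        rw [hY z]; field_simp
    have hC : ContinuousOn (dslope Y p) (Metric.ball 0 R) := by
      rw [continuousOn_dslope hnb]
      exact ⟨hc, hd.differentiableAt⟩
    have hN : ∀ z ∈ Metric.ball (0 : ℂ) R, z ∉ S → dslope Y p z ≠ 0 := by
      intro z hz hzS
      by_cases hzp : z = p
      · rw [hzp, hpp]; exact hd0
      · have := hn z hz (by simp [hzp, hzS])
        rw [hY z] at this
        exact right_ne_zero_of_mul this
    obtain ⟨g, hgc, hg0, hg⟩ := ih (dslope Y p) hQ hC hN
    refine ⟨g, hgc, hg0, fun z hz => ?_⟩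
    rw [hY z, hg z hz, Finset.prod_insert hp, mul_assoc]

theorem index_one {Y : ℂ → ℂ} {R r e : ℝ} (hr : 0 < r) (hrR : r < R) (S : Finset ℂ)
    (hS : ∀ p ∈ S, ‖p‖ < r ∧ Y p = 0 ∧ ∃ d : ℂ, d ≠ 0 ∧ HasDerivAt Y d p)
    (hc : ContinuousOn Y (Metric.ball 0 R)) (hn : ∀ z ∈ Metric.ball (0 : ℂ) R, z ∉ S → Y z ≠ 0)
    (hb : ∀ z : ℂ, ‖z‖ = r → 0 < (e * (Y z / (Complex.I * z))).re) : S.card = 1 := by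
  obtain ⟨g, hgc, hg0, hg⟩ := factor_zeros (R := R) S Y (fun p hp =>
    ⟨by simpa using (hS p hp).1.trans hrR, (hS p hp).2⟩) hc hn
  obtain ⟨L, hLc, hL⟩ := convex_log (convex_ball (0 : ℂ) R) ⟨0, by simpa using hr.trans hrR⟩
    Metric.isOpen_ball hgc hg0
  set z : ℝ → ℂ := fun t => r * Complex.exp (t * Complex.I) with hz
  have hzc : Continuous z := by fun_prop
  have hzn : ∀ t, ‖z t‖ = r := fun t => by
    simp [hz, Complex.norm_exp_ofReal_mul_I, abs_of_pos hr]
  have hz0 : ∀ t, z t ≠ 0 := fun t h => by have := hzn t; rw [h] at this; simp at this; linarith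
  have hzR : ∀ t, z t ∈ Metric.ball (0 : ℂ) R := fun t => by simpa [hzn t] using hrR
  have hz2 : z (2 * π) = z 0 := by simp [hz, Complex.exp_two_pi_mul_I]
  have he : (e : ℂ) ≠ 0 := by
    intro h
    have := hb (z 0) (hzn 0)
    rw [h] at this
    simp at this
  have hYc : Continuous fun t => Y (z t) := hc.comp_continuous hzc hzR
  have hp1 : ∀ p ∈ S, ∀ t, (1 - p / z t) ∈ Complex.slitPlane := by
    intro p hp t
    have h1 : ‖p / z t‖ < 1 := by rw [norm_div, hzn, div_lt_one hr]; exact (hS p hp).1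
    left
    have := Complex.re_le_norm (p / z t)
    simp; linarith
  set K : ℝ → ℂ := fun t => L (z t) + ∑ p ∈ S, Complex.log (1 - p / z t) -
    Complex.log (e * (Y (z t) / (Complex.I * z t))) with hK
  have hKc : Continuous K := by
    refine ((hLc.comp_continuous hzc hzR).add (continuous_finsetSum _ fun p hp => ?_)).sub ?_
    · exact Continuous.clog (continuous_const.sub (continuous_const.div hzc hz0)) (hp1 p hp)
    · refine Continuous.clog (continuous_const.mul (hYc.div (by fun_prop) fun t => ?_)) fun t => ?_
      · exact mul_ne_zero Complex.I_ne_zero (hz0 t)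
      · left; exact hb _ (hzn t)
  have hKe : ∀ t, Complex.exp (K t) * z t ^ S.card = z t * (Complex.I / e) := by
    intro t
    have hne : (e : ℂ) * (Y (z t) / (Complex.I * z t)) ≠ 0 := by
      intro h; have := hb _ (hzn t); rw [h] at this; simp at this
    have hprod : Complex.exp (∑ p ∈ S, Complex.log (1 - p / z t)) * z t ^ S.card =
        ∏ p ∈ S, (z t - p) := by
      rw [Complex.exp_sum, ← Finset.prod_const, ← Finset.prod_mul_distrib]
      refine Finset.prod_congr rfl fun p hp => ?_
      rw [Complex.exp_log (Complex.slitPlane_ne_zero (hp1 p hp t))]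
      field_simp [hz0 t]
    have hY1 : Y (z t) ≠ 0 := by intro h; rw [h] at hne; simp at hne
    have hzt := hz0 t
    simp only [hK]
    rw [Complex.exp_sub, Complex.exp_add, hL _ (hzR t), Complex.exp_log hne]
    have := hg _ (hzR t)
    rw [← hprod] at this
    have h2 : g (z t) * Complex.exp (∑ p ∈ S, Complex.log (1 - p / z t)) /
      (e * (Y (z t) / (Complex.I * z t))) * z t ^ S.card = (Complex.exp (∑ p ∈ S, Complex.log (1 - p / z t)) * z t ^ S.card * g (z t)) / (e * (Y (z t) / (Complex.I * z t))) := by ring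
    rw [h2, ← this]
    field_simp
  have hK2 : K (2 * π) = K 0 := by simp only [hK, hz2]
  set H : ℝ → ℂ := fun t => K t + (S.card - 1) * (t * Complex.I) with hH
  have hHe : ∀ t, Complex.exp (H t) = Complex.exp (H 0) := by
    have hHe' : ∀ t, Complex.exp (H t) * r ^ S.card = r * (Complex.I / e) := by
      intro t
      have h1 := hKe t
      have h2 : Complex.exp (t * Complex.I) ≠ 0 := Complex.exp_ne_zero _
      simp only [hz] at h1
      rw [mul_pow] at h1
      have h3 : Complex.exp (H t) * Complex.exp (t * Complex.I) =
          Complex.exp (K t) * Complex.exp (t * Complex.I) ^ S.card := by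
        rw [← Complex.exp_nat_mul, ← Complex.exp_add, ← Complex.exp_add]
        congr 1
        simp only [hH]; ring
      apply mul_right_cancel₀ h2
      calc _ = (Complex.exp (H t) * Complex.exp (t * Complex.I)) * r ^ S.card := by ring
        _ = _ := by rw [h3]; linear_combination h1
    intro t
    have hrc : ((r : ℂ)) ^ S.card ≠ 0 := pow_ne_zero _ (by exact_mod_cast hr.ne')
    exact mul_right_cancel₀ hrc ((hHe' t).trans (hHe' 0).symm)
  have := exp_const_of_cont (h := H) (by fun_prop) hHe (2 * π)
  simp only [hH, hK2] at this
  have h5 : ((S.card : ℂ) - 1) * (2 * π * Complex.I) = 0 := by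
    push_cast at this
    linear_combination this
  have h6 : (2 * π * Complex.I : ℂ) ≠ 0 := by
    simp [pi_ne_zero]
  have h7 := (mul_eq_zero.1 h5).resolve_right h6
  have h8 : (S.card : ℂ) = 1 := by linear_combination h7
  exact_mod_cast h8

open scoped ContDiff Topology

/-- Cauchy-Riemann criterion -/
theorem CR_deriv {U V : ℝ × ℝ → ℝ} {z : ℂ} (hU : DifferentiableAt ℝ U (z.re, z.im))
    (hV : DifferentiableAt ℝ V (z.re, z.im)) (h1 : D1 U (z.re, z.im) = D2 V (z.re, z.im))
    (h2 : D2 U (z.re, z.im) = - D1 V (z.re, z.im)) :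
    HasDerivAt (fun z : ℂ => (U (z.re, z.im) : ℂ) + Complex.I * V (z.re, z.im))
      ((D1 U (z.re, z.im) : ℂ) + Complex.I * D1 V (z.re, z.im)) z := by
  have hpr : HasFDerivAt (fun z : ℂ => (z.re, z.im)) (Complex.reCLM.prod Complex.imCLM) z :=
    (Complex.reCLM.prod Complex.imCLM).hasFDerivAt
  have hu := Complex.ofRealCLM.hasFDerivAt.comp z ((hasFDerivAt_D hU).comp z hpr)
  have hv := Complex.ofRealCLM.hasFDerivAt.comp z ((hasFDerivAt_D hV).comp z hpr)
  have h := hu.add (hv.const_mul Complex.I)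
  rw [hasDerivAt_iff_hasFDerivAt]
  refine hasFDerivAt_of_restrictScalars ℝ (h.congr_fderiv rfl) ?_
  ext w
  apply Complex.ext
  · simp [h1, h2]
    try ring
  · simp [h1, h2]
    try ring

theorem ann_pos {g : ℝ × ℝ → ℝ} (hg : Continuous g)
    (h : ∀ p : ℝ × ℝ, p.1 ^ 2 + p.2 ^ 2 = 1 → 0 < g p) :
    ∃ δ : ℝ, 0 < δ ∧ δ < 1 ∧ ∀ p : ℝ × ℝ, δ ≤ p.1 ^ 2 + p.2 ^ 2 → p.1 ^ 2 + p.2 ^ 2 ≤ 1 → 0 < g p := by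
  set K := {p : ℝ × ℝ | p.1 ^ 2 + p.2 ^ 2 ≤ 1} ∩ {p | g p ≤ 0} with hK
  have hc : IsCompact K := disc_compact.inter_right (isClosed_le hg continuous_const)
  rcases K.eq_empty_or_nonempty with he | hne
  · refine ⟨1 / 2, by norm_num, by norm_num, fun p _ hp => ?_⟩
    by_contra hcon
    have : p ∈ K := ⟨hp, not_lt.1 hcon⟩
    rw [he] at this; exact this
  · obtain ⟨q, hq, hmax⟩ := hc.exists_isMaxOn hne
      (f := fun p : ℝ × ℝ => p.1 ^ 2 + p.2 ^ 2) (by fun_prop)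
    have hq1 : q.1 ^ 2 + q.2 ^ 2 < 1 := by
      refine lt_of_le_of_ne hq.1 fun h1 => ?_
      have := h q h1
      have h2 : g q ≤ 0 := hq.2
      linarith
    have hq0 : 0 ≤ q.1 ^ 2 + q.2 ^ 2 := by positivity
    refine ⟨(q.1 ^ 2 + q.2 ^ 2 + 1) / 2, by linarith, by linarith, fun p hp1 hp => ?_⟩
    by_contra hcon
    have : p ∈ K := ⟨hp, not_lt.1 hcon⟩
    have h3 : p.1 ^ 2 + p.2 ^ 2 ≤ q.1 ^ 2 + q.2 ^ 2 := hmax this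
    linarith

theorem ray_deriv {g : ℝ × ℝ → ℝ} (hg : ContDiff ℝ ∞ g) (x : ℝ × ℝ) (s : ℝ) :
    HasDerivAt (fun s => g (rexp s * x.1, rexp s * x.2)) (Xs g (rexp s * x.1, rexp s * x.2)) s := by
  have h := (hasFDerivAt_D (sm_diff hg (rexp s * x.1, rexp s * x.2))).comp_hasDerivAt s
    (((Real.hasDerivAt_exp s).mul_const x.1).prodMk ((Real.hasDerivAt_exp s).mul_const x.2))
  refine h.congr_deriv ?_
  simp [Xs]; ring

/-- polar representation `p = e^s x` -/
theorem ray_rep {p : ℝ × ℝ} (hp : p ≠ 0) : ∃ s : ℝ, ∃ x : ℝ × ℝ, x.1 ^ 2 + x.2 ^ 2 = 1 ∧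
    p = (rexp s * x.1, rexp s * x.2) ∧ p.1 ^ 2 + p.2 ^ 2 = rexp (2 * s) := by
  have hn := nsq_pos hp
  have hs := Real.sqrt_pos.2 hn
  refine ⟨Real.log (√(p.1 ^ 2 + p.2 ^ 2)), (p.1 / √(p.1 ^ 2 + p.2 ^ 2), p.2 / √(p.1 ^ 2 + p.2 ^ 2)),
    ?_, ?_, ?_⟩
  · simp only [div_pow, Real.sq_sqrt hn.le]; field_simp
  · rw [Real.exp_log hs]; ext <;> simp only <;> field_simp
  · rw [two_mul, Real.exp_add, Real.exp_log hs, Real.mul_self_sqrt hn.le]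

theorem ray_nsq {x : ℝ × ℝ} (hx : x.1 ^ 2 + x.2 ^ 2 = 1) (s : ℝ) :
    (rexp s * x.1) ^ 2 + (rexp s * x.2) ^ 2 = rexp (2 * s) := by
  rw [two_mul, Real.exp_add]; linear_combination (rexp s) ^ 2 * hx

theorem ray_pos {g : ℝ × ℝ → ℝ} (hg : ContDiff ℝ ∞ g) {δ : ℝ} (hδ : 0 < δ)
    (h0 : ∀ p : ℝ × ℝ, p.1 ^ 2 + p.2 ^ 2 = 1 → g p = 0)
    (h1 : ∀ p : ℝ × ℝ, p.1 ^ 2 + p.2 ^ 2 = 1 → Xs g p = 0)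
    (h2 : ∀ p : ℝ × ℝ, δ ≤ p.1 ^ 2 + p.2 ^ 2 → p.1 ^ 2 + p.2 ^ 2 ≤ 1 → 0 < Xs (Xs g) p)
    (p : ℝ × ℝ) (hp : δ ≤ p.1 ^ 2 + p.2 ^ 2) (hp1 : p.1 ^ 2 + p.2 ^ 2 < 1) : 0 < g p := by
  have hp0 : p ≠ 0 := by rintro rfl; simp at hp; linarith
  obtain ⟨s, x, hx, rfl, he⟩ := ray_rep hp0
  have hs : s < 0 := by
    rw [he] at hp1
    have := Real.exp_lt_one_iff.1 hp1
    linarith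
  have k1 := fun s => ray_deriv hg x s
  have k2 := fun s => ray_deriv (contDiff_Xs hg) x s
  have z1 : Xs g (rexp 0 * x.1, rexp 0 * x.2) = 0 := by simpa using h1 x hx
  have z0 : g (rexp 0 * x.1, rexp 0 * x.2) = 0 := by simpa using h0 x hx
  have n1 : ∀ t, s ≤ t → t < 0 → Xs g (rexp t * x.1, rexp t * x.2) < 0 := by
    intro t hst ht
    obtain ⟨c, hc, hce⟩ := exists_hasDerivAt_eq_slope _ _ ht
      (fun y _ => (k2 y).continuousAt.continuousWithinAt) (fun y _ => k2 y)
    have hpos := h2 (rexp c * x.1, rexp c * x.2)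
      (by
        simp only [ray_nsq hx]; rw [he] at hp
        exact hp.trans (Real.exp_le_exp.2 (by linarith [hc.1])))
      (by simp only [ray_nsq hx]; exact Real.exp_le_one_iff.2 (by linarith [hc.2]))
    rw [hce, z1] at hpos
    have ht' : 0 < 0 - t := by linarith
    have := (div_pos_iff_of_pos_right ht').1 hpos
    linarith
  obtain ⟨c, hc, hce⟩ := exists_hasDerivAt_eq_slope _ _ hs
      (fun y _ => (k1 y).continuousAt.continuousWithinAt) (fun y _ => k1 y)
  have := n1 c hc.1.le hc.2
  rw [hce, z0, div_neg_iff] at this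
  rcases this with h | h
  · linarith [h.2]
  · linarith [h.1]

theorem sign_circ {g : ℝ × ℝ → ℝ} (hg : Continuous g)
    (h : ∀ p : ℝ × ℝ, p.1 ^ 2 + p.2 ^ 2 = 1 → g p ≠ 0) :
    ∃ e : ℝ, e ^ 2 = 1 ∧ ∀ p : ℝ × ℝ, p.1 ^ 2 + p.2 ^ 2 = 1 → 0 < e * g p := by
  have hc : Continuous fun t : ℝ => g (cos t, sin t) := hg.comp (by fun_prop)
  have hn : ∀ t : ℝ, g (cos t, sin t) ≠ 0 := fun t => h _ (by simp)
  have hsame : ∀ t : ℝ, 0 < g (cos 0, sin 0) * g (cos t, sin t) := by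
    intro t
    by_contra hcon
    push Not at hcon
    have : (0 : ℝ) ∈ Set.uIcc (g (cos 0, sin 0)) (g (cos t, sin t)) := by
      rw [Set.mem_uIcc]
      rcases le_total 0 (g (cos 0, sin 0)) with h | h
      · right; refine ⟨?_, h⟩
        by_contra h1
        push Not at h1
        have := mul_pos (lt_of_le_of_ne h (hn 0).symm) h1
        linarith
      · left; refine ⟨h, ?_⟩
        by_contra h1
        push Not at h1
        have := mul_pos_of_neg_of_neg (lt_of_le_of_ne h (hn 0)) h1
        linarith
    obtain ⟨x, -, hx⟩ := intermediate_value_uIcc (f := fun t : ℝ => g (cos t, sin t))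
      (a := 0) (b := t) hc.continuousOn this
    exact hn x hx
  rcases lt_or_gt_of_ne (hn 0) with h0 | h0
  · refine ⟨-1, by norm_num, fun p hp => ?_⟩
    obtain ⟨t, rfl⟩ := circ_rep hp
    have := neg_of_mul_pos_right (hsame t) h0.le
    linarith
  · refine ⟨1, by norm_num, fun p hp => ?_⟩
    obtain ⟨t, rfl⟩ := circ_rep hp
    have := (mul_pos_iff_of_pos_left h0).1 (hsame t)
    linarith

namespace GS
variable {lam : ℝ} {u : ℝ × ℝ → ℝ}

def FF (u : ℝ × ℝ → ℝ) (p : ℝ × ℝ) : ℝ := phi1 u p * Xt (phi2 u) p - phi2 u p * Xt (phi1 u) p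

theorem FF_sign (h : GS lam u) : ∃ e δ : ℝ, 0 < δ ∧ δ < 1 ∧ ∀ p : ℝ × ℝ,
    δ ≤ p.1 ^ 2 + p.2 ^ 2 → p.1 ^ 2 + p.2 ^ 2 < 1 → 0 < e * FF u p := by
  have hs := h.ps.sm
  have o1 := OL_phi1 h.ps
  have o2 := OL_phi2 h.ps
  have hsub : ∀ {a b : ℝ × ℝ → ℝ}, ContDiff ℝ ∞ a → ContDiff ℝ ∞ b →
      Xs (fun p => a p - b p) = fun p => Xs a p - Xs b p := by
    intro a b ha hb; ext p; unfold Xs; simp (disch := fun_prop) only [D1_sub, D2_sub]; ring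
  have hadd : ∀ {a b : ℝ × ℝ → ℝ}, ContDiff ℝ ∞ a → ContDiff ℝ ∞ b →
      Xs (fun p => a p + b p) = fun p => Xs a p + Xs b p := by
    intro a b ha hb; ext p; unfold Xs; simp (disch := fun_prop) only [D1_add, D2_add]; ring
  have hmul : ∀ {a b : ℝ × ℝ → ℝ}, ContDiff ℝ ∞ a → ContDiff ℝ ∞ b →
      Xs (fun p => a p * b p) = fun p => Xs a p * b p + a p * Xs b p := by
    intro a b ha hb; ext p; exact OL.Xs_mul ha hb p
  have e1 : Xs (FF u) = fun p => (Xs (phi1 u) p * Xt (phi2 u) p + phi1 u p * Xs (Xt (phi2 u)) p) -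
      (Xs (phi2 u) p * Xt (phi1 u) p + phi2 u p * Xs (Xt (phi1 u)) p) := by
    unfold FF
    rw [hsub (by fun_prop) (by fun_prop), hmul (by fun_prop) (by fun_prop),
      hmul (by fun_prop) (by fun_prop)]
  have e2 : Xs (Xs (FF u)) = fun p =>
      ((Xs (Xs (phi1 u)) p * Xt (phi2 u) p + Xs (phi1 u) p * Xs (Xt (phi2 u)) p) +
        (Xs (phi1 u) p * Xs (Xt (phi2 u)) p + phi1 u p * Xs (Xs (Xt (phi2 u))) p)) -
      ((Xs (Xs (phi2 u)) p * Xt (phi1 u) p + Xs (phi2 u) p * Xs (Xt (phi1 u)) p) +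
        (Xs (phi2 u) p * Xs (Xt (phi1 u)) p + phi2 u p * Xs (Xs (Xt (phi1 u))) p)) := by
    rw [e1, hsub (by fun_prop) (by fun_prop), hadd (by fun_prop) (by fun_prop),
      hadd (by fun_prop) (by fun_prop), hmul (by fun_prop) (by fun_prop),
      hmul (by fun_prop) (by fun_prop), hmul (by fun_prop) (by fun_prop),
      hmul (by fun_prop) (by fun_prop)]
  have hF : ContDiff ℝ ∞ (FF u) := by unfold FF; fun_prop
  have hw : ∀ p : ℝ × ℝ, p.1 ^ 2 + p.2 ^ 2 = 1 → Xs (Xs (FF u)) p ≠ 0 := by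
    intro p hp hz
    apply h.wedge hp
    rw [e2] at hz
    simp only [o1.circ p hp, o2.circ p hp, o1.circ_t p hp, o2.circ_t p hp] at hz
    rw [Xst_comm (contDiff_phi1 hs), Xst_comm (contDiff_phi2 hs)] at hz
    linarith
  obtain ⟨e, he, hpos⟩ := sign_circ (contDiff_Xs (contDiff_Xs hF)).continuous hw
  obtain ⟨δ, hδ, hδ1, hann⟩ := ann_pos (g := fun p => e * Xs (Xs (FF u)) p)
    (continuous_const.mul (contDiff_Xs (contDiff_Xs hF)).continuous) hpos
  refine ⟨e, δ, hδ, hδ1, ?_⟩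
  have ec : ∀ {a : ℝ × ℝ → ℝ}, ContDiff ℝ ∞ a → Xs (fun p => e * a p) = fun p => e * Xs a p := by
    intro a ha; ext p; unfold Xs; simp (disch := fun_prop) only [D1_mul, D2_mul, D1_const, D2_const]
    ring
  refine ray_pos (g := fun p => e * FF u p) (by fun_prop) hδ ?_ ?_ ?_
  · intro p hp; simp only [FF, o1.circ p hp, o2.circ p hp]; ring
  · intro p hp
    rw [ec hF, e1]
    simp only [o1.circ p hp, o2.circ p hp, o1.circ_t p hp, o2.circ_t p hp]; ring
  · intro p h1 h2
    rw [ec hF, ec (by fun_prop)]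
    exact hann p h1 h2

theorem theta_ne (h : GS lam u) {p₀ : ℝ × ℝ} (h0 : p₀ ≠ 0) (h1 : p₀.1 ^ 2 + p₀.2 ^ 2 < 1)
    (hz1 : phi1 u p₀ = 0) (hz2 : phi2 u p₀ = 0) : False := by
  have hs := h.ps.sm
  set U : ℝ × ℝ → ℝ := fun p => phi1 u p * D1 (phi2 u) p - phi2 u p * D1 (phi1 u) p with hU
  set V : ℝ × ℝ → ℝ := fun p => phi1 u p * D2 (phi2 u) p - phi2 u p * D2 (phi1 u) p with hV
  have cU : ContDiff ℝ ∞ U := by simp only [hU]; fun_prop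
  have cV : ContDiff ℝ ∞ V := by simp only [hV]; fun_prop
  set Y : ℂ → ℂ := fun z => (U (z.re, z.im) : ℂ) + Complex.I * V (z.re, z.im) with hY
  have hYc : Continuous Y := by
    have a1 := cU.continuous
    have a2 := cV.continuous
    have : Continuous fun z : ℂ => (z.re, z.im) := by fun_prop
    have b1 := a1.comp this
    have b2 := a2.comp this
    simp only [Function.comp_def] at b1 b2
    simp only [hY]; fun_prop
  have hO1 : phi1 u 0 = 0 := by
    have := (OL_phi1 h.ps).odd 0
    simp at this; linarith
  have hO2 : phi2 u 0 = 0 := by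
    have := (OL_phi2 h.ps).odd 0
    simp at this; linarith
  -- zeros
  have hzero : ∀ z : ℂ, z.re ^ 2 + z.im ^ 2 < 1 → Y z = 0 →
      phi1 u (z.re, z.im) = 0 ∧ phi2 u (z.re, z.im) = 0 := by
    intro z hz hYz
    by_cases hz0 : ((z.re, z.im) : ℝ × ℝ) = 0
    · rw [hz0]; exact ⟨hO1, hO2⟩
    · have hu' : U (z.re, z.im) = 0 := by simpa [hY] using congrArg Complex.re hYz
      have hv' : V (z.re, z.im) = 0 := by simpa [hY] using congrArg Complex.im hYz
      by_contra hcon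
      have hab : phi2 u (z.re, z.im) ≠ 0 ∨ -phi1 u (z.re, z.im) ≠ 0 := by
        by_contra h2; push Not at h2; exact hcon ⟨by linarith [h2.2], h2.1⟩
      refine h.nosing hab hz0 hz (by simp [psi]; ring) ?_ ?_
      · rw [(D_psi hs _ _ _).1]; simp only [hU] at hu'; linarith
      · rw [(D_psi hs _ _ _).2]; simp only [hV] at hv'; linarith
  have hder : ∀ z : ℂ, z.re ^ 2 + z.im ^ 2 < 1 → Y z = 0 →
      ∃ d : ℂ, d ≠ 0 ∧ HasDerivAt Y d z := by
    intro z hz hYz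
    obtain ⟨k1, k2⟩ := hzero z hz hYz
    set p : ℝ × ℝ := (z.re, z.im) with hp
    have dU1 : D1 U p = 0 := by
      simp (disch := fun_prop) only [hU, D1_mul, D1_sub]; rw [k1, k2]; ring
    have dU2 : D2 U p = D2 (phi1 u) p * D1 (phi2 u) p - D2 (phi2 u) p * D1 (phi1 u) p := by
      simp (disch := fun_prop) only [hU, D2_mul, D2_sub]; rw [k1, k2]; ring
    have dV1 : D1 V p = D1 (phi1 u) p * D2 (phi2 u) p - D1 (phi2 u) p * D2 (phi1 u) p := by
      simp (disch := fun_prop) only [hV, D1_mul, D1_sub]; rw [k1, k2]; ring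
    have dV2 : D2 V p = 0 := by
      simp (disch := fun_prop) only [hV, D2_mul, D2_sub]; rw [k1, k2]; ring
    refine ⟨_, ?_, CR_deriv (sm_diff cU _) (sm_diff cV _) (by rw [← hp, dU1, dV2])
      (by rw [← hp, dU2, dV1]; ring)⟩
    rw [← hp, dU1, dV1]
    have hJ : D1 (phi1 u) p * D2 (phi2 u) p - D1 (phi2 u) p * D2 (phi1 u) p ≠ 0 := by
      intro hJ
      by_cases hz0 : p = 0
      · rw [hz0, h.D1phi1_0, zero_mul, zero_sub, neg_eq_zero] at hJ
        exact mul_ne_zero h.D1phi2_0 h.D2phi1_0 hJ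
      · -- dependent gradients
        by_cases hd : D1 (phi1 u) p = 0 ∧ D1 (phi2 u) p = 0
        · by_cases hd' : D2 (phi1 u) p = 0 ∧ D2 (phi2 u) p = 0
          · refine h.nosing (a := 1) (b := 0) (by simp) hz0 hz ?_ ?_ ?_
            · simp only [psi]; rw [k1, k2]; ring
            · rw [(D_psi hs _ _ _).1, hd.1]; ring
            · rw [(D_psi hs _ _ _).2, hd'.1]; ring
          · refine h.nosing (a := D2 (phi2 u) p) (b := - D2 (phi1 u) p) ?_ hz0 hz ?_ ?_ ?_
            · by_contra hc; push Not at hc; exact hd' ⟨by linarith [hc.2], hc.1⟩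
            · simp only [psi]; rw [k1, k2]; ring
            · rw [(D_psi hs _ _ _).1, hd.1, hd.2]; ring
            · rw [(D_psi hs _ _ _).2]; ring
        · refine h.nosing (a := D1 (phi2 u) p) (b := - D1 (phi1 u) p) ?_ hz0 hz ?_ ?_ ?_
          · by_contra hc; push Not at hc; exact hd ⟨by linarith [hc.2], hc.1⟩
          · simp only [psi]; rw [k1, k2]; ring
          · rw [(D_psi hs _ _ _).1]; ring
          · rw [(D_psi hs _ _ _).2]; linarith
    have hJ' : ((D1 (phi1 u) p * D2 (phi2 u) p - D1 (phi2 u) p * D2 (phi1 u) p : ℝ) : ℂ) ≠ 0 := by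
      exact_mod_cast hJ
    simpa using hJ'
  obtain ⟨e, δ, hδ, hδ1, hF⟩ := h.FF_sign
  have hre : ∀ z : ℂ, z ≠ 0 → (e * (Y z / (Complex.I * z))).re =
      e * FF u (z.re, z.im) / (z.re ^ 2 + z.im ^ 2) := by
    intro z hz
    rw [Complex.re_ofReal_mul]
    rw [Complex.div_re]
    simp only [hY, FF, Xt, hU, hV, Complex.normSq_apply]
    simp
    ring
  have hnz : ∀ z : ℂ, δ ≤ z.re ^ 2 + z.im ^ 2 → z.re ^ 2 + z.im ^ 2 < 1 → Y z ≠ 0 := by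
    intro z hz1 hz2 hYz
    have := hF (z.re, z.im) hz1 hz2
    obtain ⟨k1, k2⟩ := hzero z hz2 hYz
    simp only [FF, k1, k2] at this
    simp at this
  set r := √((δ + 1) / 2) with hr
  have hr2 : r ^ 2 = (δ + 1) / 2 := Real.sq_sqrt (by linarith)
  have hr0 : 0 < r := Real.sqrt_pos.2 (by linarith)
  have hr1 : r < 1 := by nlinarith
  have hnorm : ∀ z : ℂ, ‖z‖ ^ 2 = z.re ^ 2 + z.im ^ 2 := fun z => by
    rw [← Complex.normSq_eq_norm_sq, Complex.normSq_apply]; ring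
  set Z : Set ℂ := Metric.closedBall 0 r ∩ {z | Y z = 0} with hZ
  have hZc : IsCompact Z := (isCompact_closedBall 0 r).inter_right (isClosed_eq hYc continuous_const)
  have hZ1 : ∀ z ∈ Z, z.re ^ 2 + z.im ^ 2 < 1 := by
    intro z hz
    have : ‖z‖ ≤ r := by simpa using hz.1
    rw [← hnorm]
    nlinarith [norm_nonneg z]
  have hZf : Z.Finite := by
    by_contra hinf
    obtain ⟨x, hx, hacc⟩ := Set.Infinite.exists_accPt_of_subset_isCompact hinf hZc (le_refl _)
    obtain ⟨d, hd0, hd⟩ := hder x (hZ1 x hx) hx.2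
    have hev := hd.eventually_ne (c := 0) hd0
    rw [accPt_iff_frequently_nhdsNE] at hacc
    obtain ⟨y, hy1, hy2⟩ := (hacc.and_eventually hev).exists
    exact hy2 hy1.2
  have hcard := index_one (Y := Y) (R := 1) (r := r) (e := e) hr0 hr1 hZf.toFinset ?_
    hYc.continuousOn ?_ ?_
  · rw [Finset.card_eq_one] at hcard
    obtain ⟨a, ha⟩ := hcard
    have m0 : (0 : ℂ) ∈ hZf.toFinset := by
      rw [Set.Finite.mem_toFinset]
      refine ⟨by simpa using hr0.le, ?_⟩
      change Y 0 = 0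
      have e0 : ((0 : ℝ), (0 : ℝ)) = (0 : ℝ × ℝ) := rfl
      have hO1' : phi1 u (0, 0) = 0 := hO1
      have hO2' : phi2 u (0, 0) = 0 := hO2
      simp [hY, hU, hV, hO1', hO2']
    have m1 : (⟨p₀.1, p₀.2⟩ : ℂ) ∈ hZf.toFinset := by
      have hYp : Y ⟨p₀.1, p₀.2⟩ = 0 := by
        simp [hY, hU, hV, hz1, hz2]
      rw [Set.Finite.mem_toFinset]
      refine ⟨?_, hYp⟩
      have hlt : p₀.1 ^ 2 + p₀.2 ^ 2 < δ := by
        by_contra hge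
        exact hnz ⟨p₀.1, p₀.2⟩ (not_lt.1 hge) h1 hYp
      have := hnorm ⟨p₀.1, p₀.2⟩
      simp only at this
      rw [mem_closedBall_zero_iff]
      nlinarith [norm_nonneg (⟨p₀.1, p₀.2⟩ : ℂ)]
    rw [ha, Finset.mem_singleton] at m0 m1
    apply h0
    have := m1.trans m0.symm
    exact Prod.ext (congrArg Complex.re this) (congrArg Complex.im this)
  · intro z hz
    rw [Set.Finite.mem_toFinset] at hz
    refine ⟨?_, hz.2, hder z (hZ1 z hz) hz.2⟩
    have h3 : ¬ δ ≤ z.re ^ 2 + z.im ^ 2 := fun h3 => hnz z h3 (hZ1 z hz) hz.2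
    rw [← hnorm] at h3
    nlinarith [norm_nonneg z]
  · intro z hz hzS hYz
    apply hzS
    rw [Set.Finite.mem_toFinset]
    refine ⟨?_, hYz⟩
    have hz' : ‖z‖ < 1 := by simpa using hz
    have h3 : ¬ δ ≤ z.re ^ 2 + z.im ^ 2 := fun h3 => hnz z h3
      (by rw [← hnorm]; nlinarith [norm_nonneg z]) hYz
    rw [← hnorm] at h3
    rw [mem_closedBall_zero_iff]
    nlinarith [norm_nonneg z]
  · intro z hz
    have hz0 : z ≠ 0 := by rintro rfl; simp at hz; linarith
    have hz2 : z.re ^ 2 + z.im ^ 2 = (δ + 1) / 2 := by rw [← hnorm, hz, hr2]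
    rw [hre z hz0]
    exact div_pos (hF _ (by simp only; linarith) (by simp only; linarith)) (by linarith)

end GS

open scoped ContDiff Topology

/-- topological lemma: nonvanishing map into ℂ without folds -/
theorem quadrant_lemma {U : Set (ℝ × ℝ)} (hU : Convex ℝ U) (ho : IsOpen U)
    (hsub : Metric.closedBall (0 : ℝ × ℝ) 1 ⊆ U) {g : ℝ × ℝ → ℂ} (hg : ContinuousOn g U)
    (h0 : ∀ x ∈ U, g x ≠ 0)
    (hb : ∀ x : ℝ × ℝ, ‖x‖ = 1 → 0 < (g x).re ∧ 0 < (g x).im)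
    (hfold : ∀ x : ℝ × ℝ, ‖x‖ < 1 → ∀ v : ℂ, v ≠ 0 → (v * g x).im = 0 →
      ¬ ∀ᶠ y in 𝓝 x, 0 ≤ (v * g y).im) :
    ∀ x : ℝ × ℝ, ‖x‖ ≤ 1 → 0 < (g x).re ∧ 0 < (g x).im := by
  obtain ⟨L, hL, hexp⟩ := convex_log hU ⟨0, hsub (by simp)⟩ ho hg h0
  set al : ℝ × ℝ → ℝ := fun x => (L x).im with hal
  have hac : ContinuousOn al U := Complex.continuous_im.comp_continuousOn hL
  have hre : ∀ x ∈ U, (g x).re = rexp (L x).re * cos (al x) := fun x hx => by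
    rw [← hexp x hx, Complex.exp_re]
  have him : ∀ x ∈ U, (g x).im = rexp (L x).re * sin (al x) := fun x hx => by
    rw [← hexp x hx, Complex.exp_im]
  have hvim : ∀ x ∈ U, ∀ a c : ℝ, ((c * Complex.exp (-(a * Complex.I))) * g x).im =
      c * (rexp (L x).re * sin (al x - a)) := by
    intro x hx a c
    rw [← hexp x hx, mul_assoc, ← Complex.exp_add, Complex.im_ofReal_mul, Complex.exp_im]
    simp [hal, sub_eq_add_neg, add_comm]
  have hext : ∀ x : ℝ × ℝ, ‖x‖ < 1 → ∀ c : ℝ, c ≠ 0 → ¬ ∀ᶠ y in 𝓝 x, 0 ≤ c * (al y - al x) := by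
    intro x hx c hc hev
    have hxU : x ∈ U := hsub (by simpa using hx.le)
    refine hfold x hx (c * Complex.exp (-((al x : ℝ) * Complex.I))) ?_ ?_ ?_
    · exact mul_ne_zero (by exact_mod_cast hc) (Complex.exp_ne_zero _)
    · rw [hvim x hxU]; simp
    · have hcx : ContinuousAt al x := hac.continuousAt (ho.mem_nhds hxU)
      have hnear : ∀ᶠ y in 𝓝 x, |al y - al x| < π := by
        have := Metric.tendsto_nhds.1 hcx π Real.pi_pos
        simpa [Real.dist_eq] using this
      filter_upwards [hev, hnear, ho.mem_nhds hxU] with y h1 h2 h3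
      rw [hvim y h3]
      have he := Real.exp_pos (L y).re
      rw [abs_lt] at h2
      rcases le_total 0 (al y - al x) with h4 | h4
      · have hs := Real.sin_nonneg_of_nonneg_of_le_pi h4 h2.2.le
        rcases h4.eq_or_lt with h5 | h5
        · rw [← h5]; simp
        · have := nonneg_of_mul_nonneg_left h1 h5
          positivity
      · have hs := Real.sin_nonpos_of_nonpos_of_neg_pi_le h4 h2.1.le
        rcases h4.eq_or_lt with h5 | h5
        · rw [h5]; simp
        · have hc' : c ≤ 0 := by nlinarith
          exact mul_nonneg_of_nonpos_of_nonpos hc' (mul_nonpos_of_nonneg_of_nonpos he.le hs)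
  -- the sphere
  have hSU : ∀ x : ℝ × ℝ, ‖x‖ = 1 → x ∈ U := fun x hx => hsub (by simp [hx])
  have hbs : ∀ x : ℝ × ℝ, ‖x‖ = 1 → 0 < cos (al x) ∧ 0 < sin (al x) := by
    intro x hx
    have h1 := (hb x hx).1
    have h2 := (hb x hx).2
    rw [hre x (hSU x hx)] at h1
    rw [him x (hSU x hx)] at h2
    exact ⟨(mul_pos_iff_of_pos_left (Real.exp_pos _)).1 h1, (mul_pos_iff_of_pos_left (Real.exp_pos _)).1 h2⟩
  have hrank : 1 < Module.rank ℝ (ℝ × ℝ) := by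
    rw [← Module.finrank_eq_rank]; simp
  have hpre : IsPreconnected (al '' Metric.sphere (0 : ℝ × ℝ) 1) :=
    (isPreconnected_sphere hrank 0 1).image al (hac.mono fun x hx => hSU x (by simpa using hx))
  set x0 : ℝ × ℝ := (1, 1) with hx0
  have hx0n : ‖x0‖ = 1 := by simp [hx0, Prod.norm_def]
  set k : ℤ := ⌊al x0 / (2 * π)⌋ with hk
  have hpi := Real.pi_pos
  have k1 : k * (2 * π) ≤ al x0 := by
    have := Int.floor_le (al x0 / (2 * π))
    rwa [le_div_iff₀ (by positivity)] at this
  have k2 : al x0 < k * (2 * π) + 2 * π := by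
    have := Int.lt_floor_add_one (al x0 / (2 * π))
    rw [div_lt_iff₀ (by positivity)] at this
    linarith
  have hsc : ∀ b : ℝ, cos (k * (2 * π) + b) = cos b ∧ sin (k * (2 * π) + b) = sin b := by
    intro b
    constructor
    · rw [add_comm, Real.cos_add_int_mul_two_pi]
    · rw [add_comm, Real.sin_add_int_mul_two_pi]
  have k3 : al x0 < k * (2 * π) + π / 2 := by
    by_contra hcon
    push Not at hcon
    have hb0 := hbs x0 hx0n
    obtain ⟨b, hbb⟩ : ∃ b, al x0 = k * (2 * π) + b := ⟨al x0 - k * (2 * π), by ring⟩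
    rw [hbb, (hsc b).1, (hsc b).2] at hb0
    rw [hbb] at hcon k2
    rcases le_total b π with h | h
    · have := Real.cos_nonpos_of_pi_div_two_le_of_le (x := b) (by linarith) (by linarith)
      linarith [hb0.1]
    · have : sin b ≤ 0 := by
        rw [← Real.sin_sub_two_pi]
        exact Real.sin_nonpos_of_nonpos_of_neg_pi_le (by linarith) (by linarith)
      linarith [hb0.2]
  have hoc := hpre.ordConnected
  have hrange : ∀ x : ℝ × ℝ, ‖x‖ = 1 → k * (2 * π) < al x ∧ al x < k * (2 * π) + π / 2 := by
    intro x hx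
    have m0 : al x0 ∈ al '' Metric.sphere (0 : ℝ × ℝ) 1 := ⟨x0, by simpa using hx0n, rfl⟩
    have m1 : al x ∈ al '' Metric.sphere (0 : ℝ × ℝ) 1 := ⟨x, by simpa using hx, rfl⟩
    constructor
    · by_contra hcon
      push Not at hcon
      obtain ⟨z, hz, hzz⟩ := hoc.out m1 m0 ⟨hcon, k1⟩
      have := (hbs z (by simpa using hz)).2
      rw [hzz, ← add_zero ((k : ℝ) * (2 * π)), (hsc 0).2] at this
      simp at this
    · by_contra hcon
      push Not at hcon
      obtain ⟨z, hz, hzz⟩ := hoc.out m0 m1 ⟨k3.le, hcon⟩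
      have := (hbs z (by simpa using hz)).1
      rw [hzz, (hsc _).1] at this
      simp at this
  have hcomp : IsCompact (Metric.closedBall (0 : ℝ × ℝ) 1) := isCompact_closedBall _ _
  have hbound : ∀ c : ℝ, c ≠ 0 → ∃ q : ℝ × ℝ, ‖q‖ = 1 ∧ ∀ x : ℝ × ℝ, ‖x‖ ≤ 1 → c * al q ≤ c * al x := by
    intro c hc
    obtain ⟨q, hq, hmin⟩ := hcomp.exists_isMinOn ⟨0, by simp⟩
      (f := fun x => c * al x) (continuousOn_const.mul (hac.mono hsub))
    have hq1 : ‖q‖ ≤ 1 := by simpa using hq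
    refine ⟨q, ?_, fun x hx => hmin (by simpa using hx)⟩
    by_contra hne
    have hlt := lt_of_le_of_ne hq1 hne
    refine hext q hlt c hc ?_
    have : ∀ᶠ y : ℝ × ℝ in 𝓝 q, ‖y‖ < 1 := continuous_norm.continuousAt.eventually_lt_const hlt
    filter_upwards [this] with y hy
    have : c * al q ≤ c * al y := hmin (by simpa using hy.le)
    linarith
  intro x hx
  have hxU : x ∈ U := hsub (by simpa using hx)
  obtain ⟨q1, hq1, hm1⟩ := hbound 1 one_ne_zero
  obtain ⟨q2, hq2, hm2⟩ := hbound (-1) (by norm_num)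
  have r1 := (hrange q1 hq1).1
  have r2 := (hrange q2 hq2).2
  have b1 := hm1 x hx
  have b2 := hm2 x hx
  obtain ⟨b, hbb⟩ : ∃ b, al x = k * (2 * π) + b := ⟨al x - k * (2 * π), by ring⟩
  rw [hre x hxU, him x hxU, hbb, (hsc b).1, (hsc b).2]
  constructor
  · exact mul_pos (Real.exp_pos _) (Real.cos_pos_of_mem_Ioo ⟨by linarith, by linarith⟩)
  · exact mul_pos (Real.exp_pos _) (Real.sin_pos_of_pos_of_lt_pi (by linarith) (by linarith))

theorem deriv_left_nonpos {f : ℝ → ℝ} {f' a : ℝ} (hf : HasDerivAt f f' a) (h0 : f a = 0)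
    (h : ∀ᶠ x in 𝓝[<] a, 0 ≤ f x) : f' ≤ 0 := by
  have ht := (hasDerivAt_iff_tendsto_slope_left_right.1 hf).1
  refine le_of_tendsto ht ?_
  filter_upwards [h, self_mem_nhdsWithin] with x hx hxa
  rw [slope_def_field, h0]
  have : x < a := hxa
  exact div_nonpos_of_nonneg_of_nonpos (by linarith) (by linarith)

theorem deriv_right_nonneg {f : ℝ → ℝ} {f' a : ℝ} (hf : HasDerivAt f f' a) (h0 : f a = 0)
    (h : ∀ᶠ x in 𝓝[>] a, 0 ≤ f x) : 0 ≤ f' := by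
  have ht := (hasDerivAt_iff_tendsto_slope_left_right.1 hf).2
  refine ge_of_tendsto ht ?_
  filter_upwards [h, self_mem_nhdsWithin] with x hx hxa
  rw [slope_def_field, h0]
  have : a < x := hxa
  exact div_nonneg (by linarith) (by linarith)

open scoped ContDiff Topology

def pol (s t : ℝ) : ℝ × ℝ := (rexp s * cos t, rexp s * sin t)

theorem pol_nsq (s t : ℝ) : (pol s t).1 ^ 2 + (pol s t).2 ^ 2 = rexp (2 * s) :=
  ray_nsq (x := (cos t, sin t)) (by simp) s

theorem pol_ne (s t : ℝ) : pol s t ≠ 0 := by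
  intro h
  have := pol_nsq s t
  rw [h] at this
  simp at this
  exact absurd this.symm (Real.exp_ne_zero _)

theorem pol_ds {g : ℝ × ℝ → ℝ} (hg : ContDiff ℝ ∞ g) (s t : ℝ) :
    HasDerivAt (fun s => g (pol s t)) (Xs g (pol s t)) s := ray_deriv hg (cos t, sin t) s

theorem pol_dt {g : ℝ × ℝ → ℝ} (hg : ContDiff ℝ ∞ g) (s t : ℝ) :
    HasDerivAt (fun t => g (pol s t)) (Xt g (pol s t)) t := by
  have h := (hasFDerivAt_D (sm_diff hg (pol s t))).comp_hasDerivAt t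
    (((hasDerivAt_cos t).const_mul (rexp s)).prodMk ((hasDerivAt_sin t).const_mul (rexp s)))
  refine h.congr_deriv ?_
  simp [Xt, pol]; ring

theorem pol_cont : Continuous fun x : ℝ × ℝ => pol x.1 x.2 := by unfold pol; fun_prop

theorem sign_conn {X : Type*} [TopologicalSpace X] {S : Set X} (hS : IsPreconnected S) {f : X → ℝ}
    (hc : ContinuousOn f S) (hn : ∀ x ∈ S, f x ≠ 0) :
    ∃ e : ℝ, e ^ 2 = 1 ∧ ∀ x ∈ S, 0 < e * f x := by
  rcases S.eq_empty_or_nonempty with h | ⟨x0, h0⟩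
  · exact ⟨1, by norm_num, by simp [h]⟩
  have hoc := (hS.image f hc).ordConnected
  rcases lt_or_gt_of_ne (hn x0 h0) with h | h
  · refine ⟨-1, by norm_num, fun x hx => ?_⟩
    by_contra hcon
    obtain ⟨z, hz, hzz⟩ := hoc.out ⟨x0, h0, rfl⟩ ⟨x, hx, rfl⟩ ⟨h.le, (by linarith : 0 ≤ f x)⟩
    exact hn z hz hzz
  · refine ⟨1, by norm_num, fun x hx => ?_⟩
    by_contra hcon
    obtain ⟨z, hz, hzz⟩ := hoc.out ⟨x, hx, rfl⟩ ⟨x0, h0, rfl⟩ ⟨(by linarith : f x ≤ 0), h.le⟩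
    exact hn z hz hzz

theorem sign_ne {e : ℝ} (he : e ^ 2 = 1) : e = 1 ∨ e = -1 := by
  have h : (e - 1) * (e + 1) = 0 := by linear_combination he
  rcases mul_eq_zero.1 h with h | h
  · left; linarith
  · right; linarith

namespace GS
variable {lam : ℝ} {u : ℝ × ℝ → ℝ}

theorem ax1 (h : GS lam u) (r : ℝ) : phi1 u (r, 0) = 0 := by
  have := phi1_od2 h.ps (r, 0)
  simp at this; linarith
theorem ax2 (h : GS lam u) (r : ℝ) : phi2 u (0, r) = 0 := by
  have := phi2_od1 h.ps (0, r)
  simp at this; linarith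

theorem signs (h : GS lam u) : ∃ e1 e2 : ℝ, e1 ^ 2 = 1 ∧ e2 ^ 2 = 1 ∧
    (∀ r : ℝ, 0 < r → r < 1 → 0 < e1 * phi1 u (0, r)) ∧
    (∀ r : ℝ, 0 < r → r < 1 → 0 < e2 * phi2 u (r, 0)) := by
  have hs := h.ps.sm
  obtain ⟨e1, h1, h1'⟩ := sign_conn (S := Set.Ioo (0:ℝ) 1) isPreconnected_Ioo
    (f := fun r => phi1 u (0, r))
    ((contDiff_phi1 hs).continuous.comp (by fun_prop)).continuousOn (fun r hr hz =>
      h.theta_ne (p₀ := (0, r)) (by simp [hr.1.ne']) (by have h3 := hr.1; have h4 := hr.2; simp only; nlinarith) hz (h.ax2 r))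
  obtain ⟨e2, h2, h2'⟩ := sign_conn (S := Set.Ioo (0:ℝ) 1) isPreconnected_Ioo
    (f := fun r => phi2 u (r, 0))
    ((contDiff_phi2 hs).continuous.comp (by fun_prop)).continuousOn (fun r hr hz =>
      h.theta_ne (p₀ := (r, 0)) (by simp [hr.1.ne']) (by have h3 := hr.1; have h4 := hr.2; simp only; nlinarith) (h.ax1 r) hz)
  exact ⟨e1, e2, h1, h2, fun r a b => h1' r ⟨a, b⟩, fun r a b => h2' r ⟨a, b⟩⟩

/-- sign of the radial derivative of `phi1` on the equator -/
theorem arc1 (h : GS lam u) {e1 : ℝ} (he : e1 ^ 2 = 1)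
    (hp : ∀ r : ℝ, 0 < r → r < 1 → 0 < e1 * phi1 u (0, r)) {t : ℝ} (h0 : 0 < t) (h1 : t ≤ π / 2) :
    e1 * Xs (phi1 u) (cos t, sin t) < 0 := by
  have hs := h.ps.sm
  have hpi := Real.pi_pos
  obtain ⟨e, h2, h3⟩ := sign_conn (S := Set.Ioc (0:ℝ) (π / 2)) isPreconnected_Ioc
    (f := fun t => Xs (phi1 u) (cos t, sin t))
    ((contDiff_Xs (contDiff_phi1 hs)).continuous.comp (by fun_prop)).continuousOn (fun t ht =>
      h.c1_ne (by simp) (Real.sin_pos_of_pos_of_lt_pi ht.1 (by linarith [ht.2])).ne')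
  have hd := (ray_deriv (contDiff_phi1 hs) (0, 1) 0).const_mul e1
  have hle := deriv_left_nonpos hd (by
      rw [(OL_phi1 h.ps).circ _ (by simp)]; simp) (by
    filter_upwards [self_mem_nhdsWithin] with s hs'
    have := hp (rexp s) (Real.exp_pos s) (Real.exp_lt_one_iff.2 hs')
    simpa using this.le)
  have k1 := h3 (π / 2) ⟨by linarith, le_refl _⟩
  have k2 := h3 t ⟨h0, h1⟩
  simp at k1 hle
  rcases sign_ne he with rfl | rfl <;> rcases sign_ne h2 with rfl | rfl <;> linarith

theorem arc2 (h : GS lam u) {e2 : ℝ} (he : e2 ^ 2 = 1)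
    (hp : ∀ r : ℝ, 0 < r → r < 1 → 0 < e2 * phi2 u (r, 0)) {t : ℝ} (h0 : 0 ≤ t) (h1 : t < π / 2) :
    e2 * Xs (phi2 u) (cos t, sin t) < 0 := by
  have hs := h.ps.sm
  have hpi := Real.pi_pos
  obtain ⟨e, h2, h3⟩ := sign_conn (S := Set.Ico (0:ℝ) (π / 2)) isPreconnected_Ico
    (f := fun t => Xs (phi2 u) (cos t, sin t))
    ((contDiff_Xs (contDiff_phi2 hs)).continuous.comp (by fun_prop)).continuousOn (fun t ht =>
      h.c2_ne (by simp) (Real.cos_pos_of_mem_Ioo ⟨by linarith [ht.1], ht.2⟩).ne')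
  have hd := (ray_deriv (contDiff_phi2 hs) (1, 0) 0).const_mul e2
  have hle := deriv_left_nonpos hd (by
      rw [(OL_phi2 h.ps).circ _ (by simp)]; simp) (by
    filter_upwards [self_mem_nhdsWithin] with s hs'
    have := hp (rexp s) (Real.exp_pos s) (Real.exp_lt_one_iff.2 hs')
    simpa using this.le)
  have k1 := h3 0 ⟨by linarith, by linarith⟩
  have k2 := h3 t ⟨h0, h1⟩
  simp at k1 hle
  rcases sign_ne he with rfl | rfl <;> rcases sign_ne h2 with rfl | rfl <;> linarith

theorem arc1_zero (h : GS lam u) : Xs (phi1 u) (1, 0) = 0 := by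
  have := (Xpar2 (f := phi1 u) (contDiff_phi1 h.ps.sm) (s := -1) (fun p => by
    rw [phi1_od2 h.ps]; ring) (1, 0)).1
  simp at this; linarith
theorem arc2_zero (h : GS lam u) : Xs (phi2 u) (0, 1) = 0 := by
  have := (Xpar1 (f := phi2 u) (contDiff_phi2 h.ps.sm) (s := -1) (fun p => by
    rw [phi2_od1 h.ps]; ring) (0, 1)).1
  simp at this; linarith

theorem or1 (h : GS lam u) {e1 : ℝ} (he : e1 ^ 2 = 1)
    (hp : ∀ r : ℝ, 0 < r → r < 1 → 0 < e1 * phi1 u (0, r)) : 0 < e1 * D2 (phi1 u) 0 := by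
  have hs := h.ps.sm
  have hd := (((hasFDerivAt_D (sm_diff (contDiff_phi1 hs) ((0:ℝ), (0:ℝ)))).comp_hasDerivAt (0:ℝ)
    ((hasDerivAt_const (0:ℝ) (0:ℝ)).prodMk (hasDerivAt_id (0:ℝ)))).const_mul e1)
  have hge := deriv_right_nonneg hd (by simp [h.ax1]) (by
    have : ∀ᶠ r : ℝ in 𝓝[>] 0, r < 1 := (eventually_lt_nhds one_pos).filter_mono nhdsWithin_le_nhds
    filter_upwards [self_mem_nhdsWithin, this] with r h1 h2
    exact (hp r h1 h2).le)
  have hne := h.D2phi1_0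
  simp at hge
  refine lt_of_le_of_ne hge (mul_ne_zero ?_ hne).symm
  rcases sign_ne he with rfl | rfl <;> norm_num

theorem or2 (h : GS lam u) {e2 : ℝ} (he : e2 ^ 2 = 1)
    (hp : ∀ r : ℝ, 0 < r → r < 1 → 0 < e2 * phi2 u (r, 0)) : 0 < e2 * D1 (phi2 u) 0 := by
  have hs := h.ps.sm
  have hd0 : HasDerivAt (fun r : ℝ => (r, (0 : ℝ))) (1, 0) 0 :=
    (hasDerivAt_id (0:ℝ)).prodMk (hasDerivAt_const (0:ℝ) (0:ℝ))
  have hd := (((hasFDerivAt_D (sm_diff (contDiff_phi2 hs) ((0:ℝ), (0:ℝ)))).comp_hasDerivAt (0:ℝ)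
    (f := fun r : ℝ => (r, (0 : ℝ))) hd0).const_mul e2)
  have hge := deriv_right_nonneg hd (by simp [h.ax2]) (by
    have : ∀ᶠ r : ℝ in 𝓝[>] 0, r < 1 := (eventually_lt_nhds one_pos).filter_mono nhdsWithin_le_nhds
    filter_upwards [self_mem_nhdsWithin, this] with r h1 h2
    exact (hp r h1 h2).le)
  have hne := h.D1phi2_0
  simp at hge
  refine lt_of_le_of_ne hge (mul_ne_zero ?_ hne).symm
  rcases sign_ne he with rfl | rfl <;> norm_num

theorem end0 (h : GS lam u) {e1 e2 : ℝ} (he1 : e1 ^ 2 = 1) (he2 : e2 ^ 2 = 1)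
    (hp1 : ∀ r : ℝ, 0 < r → r < 1 → 0 < e1 * phi1 u (0, r))
    (hp2 : ∀ r : ℝ, 0 < r → r < 1 → 0 < e2 * phi2 u (r, 0)) {a b : ℝ} (ha : 0 < a) (hb : 0 < b) :
    ∃ ρ : ℝ, 0 < ρ ∧ ∀ p : ℝ × ℝ, p ≠ 0 → 0 ≤ p.1 → 0 ≤ p.2 → p.1 ^ 2 + p.2 ^ 2 < ρ →
      0 < psi (e1 * a) (e2 * b) u p := by
  have hs := h.ps.sm
  set g := psi (e1 * a) (e2 * b) u with hg
  have hgs : ContDiff ℝ ∞ g := by rw [hg]; unfold psi; fun_prop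
  have hD := D_psi hs (e1 * a) (e2 * b) 0
  have g1 : 0 < D1 g 0 := by
    rw [hg, hD.1, h.D1phi1_0]; nlinarith [mul_pos hb (h.or2 he2 hp2)]
  have g2 : 0 < D2 g 0 := by
    rw [hg, hD.2, h.D2phi2_0]; nlinarith [mul_pos ha (h.or1 he1 hp1)]
  have ev : ∀ᶠ p : ℝ × ℝ in 𝓝 0, 0 < D1 g p ∧ 0 < D2 g p :=
    ((contDiff_D1 hgs).continuous.continuousAt.eventually_const_lt g1).and
      ((contDiff_D2 hgs).continuous.continuousAt.eventually_const_lt g2)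
  obtain ⟨r, hr, hball⟩ := Metric.eventually_nhds_iff.1 ev
  refine ⟨r ^ 2, by positivity, fun p hp0 h1 h2 h3 => ?_⟩
  have hline : ∀ t : ℝ, HasDerivAt (fun t : ℝ => g (t * p.1, t * p.2))
      (p.1 * D1 g (t * p.1, t * p.2) + p.2 * D2 g (t * p.1, t * p.2)) t := by
    intro t
    have := (hasFDerivAt_D (sm_diff hgs (t * p.1, t * p.2))).comp_hasDerivAt t
      (((hasDerivAt_id t).mul_const p.1).prodMk ((hasDerivAt_id t).mul_const p.2))
    refine this.congr_deriv ?_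
    simp; ring
  obtain ⟨c, hc, hce⟩ := exists_hasDerivAt_eq_slope _ _ (zero_lt_one (α := ℝ))
      (fun y _ => (hline y).continuousAt.continuousWithinAt) (fun y _ => hline y)
  have hn : dist ((c * p.1, c * p.2) : ℝ × ℝ) 0 < r := by
    rw [dist_zero_right, Prod.norm_def, max_lt_iff]
    have k1 : p.1 < r := by nlinarith
    have k2 : p.2 < r := by nlinarith
    simp only [Real.norm_eq_abs]
    rw [abs_of_nonneg (mul_nonneg hc.1.le h1), abs_of_nonneg (mul_nonneg hc.1.le h2)]
    constructor <;> nlinarith [hc.1, hc.2]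
  obtain ⟨q1, q2⟩ := hball hn
  have hz : g (0, 0) = 0 := by simp [hg, psi, h.ax1, h.ax2]
  simp [hz] at hce
  rw [← hce]
  rcases h1.eq_or_lt with h4 | h4
  · rcases h2.eq_or_lt with h5 | h5
    · exact absurd (Prod.ext h4.symm h5.symm) hp0
    · linarith [mul_pos h5 q2, mul_nonneg h1 q1.le]
  · linarith [mul_pos h4 q1, mul_nonneg h2 q2.le]

theorem end1 (h : GS lam u) {e1 e2 : ℝ} (he1 : e1 ^ 2 = 1) (he2 : e2 ^ 2 = 1)
    (hp1 : ∀ r : ℝ, 0 < r → r < 1 → 0 < e1 * phi1 u (0, r))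
    (hp2 : ∀ r : ℝ, 0 < r → r < 1 → 0 < e2 * phi2 u (r, 0)) {a b : ℝ} (ha : 0 < a) (hb : 0 < b) :
    ∃ δ : ℝ, 0 < δ ∧ δ < 1 ∧ ∀ p : ℝ × ℝ, 0 ≤ p.1 → 0 ≤ p.2 → δ ≤ p.1 ^ 2 + p.2 ^ 2 →
      p.1 ^ 2 + p.2 ^ 2 < 1 → 0 < psi (e1 * a) (e2 * b) u p := by
  have hs := h.ps.sm
  set g := psi (e1 * a) (e2 * b) u with hg
  have hgs : ContDiff ℝ ∞ g := by rw [hg]; unfold psi; fun_prop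
  have hX : ∀ p, Xs g p = e1 * a * Xs (phi1 u) p + e2 * b * Xs (phi2 u) p := by
    intro p
    have hD := D_psi hs (e1 * a) (e2 * b) p
    simp only [Xs, hg, hD]; ring
  have hpi := Real.pi_pos
  have harc : ∀ t : ℝ, 0 ≤ t → t ≤ π / 2 → Xs g (cos t, sin t) < 0 := by
    intro t h0 h1
    rw [hX]
    rcases h0.eq_or_lt with h2 | h2
    · subst h2
      have := h.arc2 he2 hp2 (t := 0) le_rfl (by linarith)
      simp [h.arc1_zero] at this ⊢
      nlinarith
    · have k1 := h.arc1 he1 hp1 h2 h1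
      rcases h1.eq_or_lt with h3 | h3
      · subst h3
        simp [h.arc2_zero] at k1 ⊢
        nlinarith
      · have k2 := h.arc2 he2 hp2 h0 h3
        nlinarith
  obtain ⟨δ, hδ, hδ1, hann⟩ := ann_pos (g := fun p : ℝ × ℝ => - Xs g (|p.1|, |p.2|))
    (((contDiff_Xs hgs).continuous.comp (by fun_prop)).neg) (fun p hp => by
      have hp' : (|p.1|) ^ 2 + (|p.2|) ^ 2 = 1 := by simpa using hp
      have hq : (|p.1|, |p.2|) = (cos (Real.arcsin |p.2|), sin (Real.arcsin |p.2|)) := by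
        rw [Real.cos_arcsin, Real.sin_arcsin (by linarith [abs_nonneg p.2])
          (by nlinarith [abs_nonneg p.2, abs_nonneg p.1]), ← hp', add_sub_cancel_right,
          Real.sqrt_sq (abs_nonneg _)]
      rw [hq]
      have := harc (Real.arcsin |p.2|) (Real.arcsin_nonneg.2 (abs_nonneg _)) (Real.arcsin_le_pi_div_two _)
      linarith)
  refine ⟨δ, hδ, hδ1, fun p h1 h2 h3 h4 => ?_⟩
  have hp0 : p ≠ 0 := by rintro rfl; simp at h3; linarith
  obtain ⟨s, x, hx, rfl, he⟩ := ray_rep hp0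
  have hx1 : 0 ≤ x.1 := nonneg_of_mul_nonneg_right h1 (Real.exp_pos s)
  have hx2 : 0 ≤ x.2 := nonneg_of_mul_nonneg_right h2 (Real.exp_pos s)
  have hs : s < 0 := by
    rw [he] at h4
    have := Real.exp_lt_one_iff.1 h4
    linarith
  have k1 := fun s => ray_deriv hgs x s
  obtain ⟨c, hc, hce⟩ := exists_hasDerivAt_eq_slope _ _ hs
      (fun y _ => (k1 y).continuousAt.continuousWithinAt) (fun y _ => k1 y)
  have hz : g x = 0 := by
    simp [hg, psi, (OL_phi1 h.ps).circ x hx, (OL_phi2 h.ps).circ x hx]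
  have hneg := hann (rexp c * x.1, rexp c * x.2) (by
      simp only [ray_nsq hx]; rw [he] at h3
      exact h3.trans (Real.exp_le_exp.2 (by linarith [hc.1])))
    (by simp only [ray_nsq hx]; exact Real.exp_le_one_iff.2 (by linarith [hc.2]))
  simp only [abs_mul, Real.abs_exp, abs_of_nonneg hx1, abs_of_nonneg hx2, hce] at hneg
  simp [hz] at hneg
  rw [div_neg_iff] at hneg
  rcases hneg with h | h
  · linarith [h.2]
  · linarith [h.1]

theorem quad_eta (h : GS lam u) {e1 e2 : ℝ} (he1 : e1 ^ 2 = 1) (he2 : e2 ^ 2 = 1)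
    (hp1 : ∀ r : ℝ, 0 < r → r < 1 → 0 < e1 * phi1 u (0, r))
    (hp2 : ∀ r : ℝ, 0 < r → r < 1 → 0 < e2 * phi2 u (r, 0)) {η : ℝ} (h0 : 0 < η) (h1 : η < 1)
    {s t : ℝ} (hs : s < 0) (ht0 : 0 ≤ t) (ht1 : t ≤ π / 2) :
    0 < psi (e1 * 1) (e2 * η) u (pol s t) ∧ 0 < psi (e1 * η) (e2 * 1) u (pol s t) := by
  have hsm := h.ps.sm
  have hpi := Real.pi_pos
  obtain ⟨ρ1, hρ1, hr1⟩ := h.end0 he1 he2 hp1 hp2 one_pos h0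
  obtain ⟨ρ2, hρ2, hr2⟩ := h.end0 he1 he2 hp1 hp2 h0 one_pos
  obtain ⟨δ1, hδ1, hδ1', hd1⟩ := h.end1 he1 he2 hp1 hp2 one_pos h0
  obtain ⟨δ2, hδ2, hδ2', hd2⟩ := h.end1 he1 he2 hp1 hp2 h0 one_pos
  have hE : Filter.Tendsto (fun s : ℝ => rexp (2 * s)) Filter.atBot (𝓝 0) :=
    Real.tendsto_exp_atBot.comp (Filter.tendsto_id.const_mul_atBot two_pos)
  obtain ⟨s1, hs1, hs1a, hs1b⟩ : ∃ s1, s1 < s ∧ rexp (2 * s1) < ρ1 ∧ rexp (2 * s1) < ρ2 :=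
    ((Filter.eventually_lt_atBot s).and ((hE.eventually_lt_const hρ1).and
      (hE.eventually_lt_const hρ2))).exists
  obtain ⟨s2, hs2, hs2', hs2a, hs2b⟩ : ∃ s2, s < s2 ∧ s2 < 0 ∧ δ1 ≤ rexp (2 * s2) ∧ δ2 ≤ rexp (2 * s2) := by
    have hc : ContinuousAt (fun s : ℝ => rexp (2 * s)) 0 := by fun_prop
    have c1 : ∀ᶠ x in 𝓝[<] (0:ℝ), δ1 < rexp (2 * x) :=
      (hc.eventually_const_lt (by simpa using hδ1')).filter_mono nhdsWithin_le_nhds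
    have c2 : ∀ᶠ x in 𝓝[<] (0:ℝ), δ2 < rexp (2 * x) :=
      (hc.eventually_const_lt (by simpa using hδ2')).filter_mono nhdsWithin_le_nhds
    have c3 : ∀ᶠ x in 𝓝[<] (0:ℝ), s < x := (eventually_gt_nhds hs).filter_mono nhdsWithin_le_nhds
    have c4 : ∀ᶠ x in 𝓝[<] (0:ℝ), x < 0 := self_mem_nhdsWithin
    obtain ⟨x, h1, h2, h3, h4⟩ := (c1.and (c2.and (c3.and c4))).exists
    exact ⟨x, h3, h4, h1.le, h2.le⟩
  set S : ℝ → ℝ := fun x => (s1 + s2) / 2 + (s2 - s1) / 2 * x with hS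
  set T : ℝ → ℝ := fun x => π / 4 * (1 + x) with hT
  have dS : ∀ x, HasDerivAt S ((s2 - s1) / 2) x := fun x =>
    (((hasDerivAt_id x).const_mul ((s2 - s1) / 2)).const_add ((s1 + s2) / 2)).congr_deriv (by simp)
  have dT : ∀ x, HasDerivAt T (π / 4) x := fun x => by
    simpa using ((hasDerivAt_id x).const_add 1).const_mul (π / 4)
  set F : ℝ × ℝ → ℂ := fun q => ⟨psi (e1 * 1) (e2 * η) u (pol (S q.1) (T q.2)),
    psi (e1 * η) (e2 * 1) u (pol (S q.1) (T q.2))⟩ with hF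
  have hST : Continuous fun q : ℝ × ℝ => pol (S q.1) (T q.2) := by
    simp only [hS, hT, pol]; fun_prop
  have hpsi : ∀ a b, ContDiff ℝ ∞ (psi a b u) := fun a b => by unfold psi; fun_prop
  have hFc : Continuous F := by
    have k1 := (hpsi (e1 * 1) (e2 * η)).continuous.comp hST
    have k2 := (hpsi (e1 * η) (e2 * 1)).continuous.comp hST
    have : F = fun q => ((psi (e1 * 1) (e2 * η) u (pol (S q.1) (T q.2)) : ℝ) : ℂ) +
      (psi (e1 * η) (e2 * 1) u (pol (S q.1) (T q.2)) : ℝ) * Complex.I := by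
      ext q
      exact Complex.mk_eq_add_mul_I _ _
    rw [this]
    exact (Complex.continuous_ofReal.comp k1).add ((Complex.continuous_ofReal.comp k2).mul continuous_const)
  set U : Set (ℝ × ℝ) := {q | S q.1 < 0} with hU
  have hnn : ∀ x : ℝ × ℝ, ‖x‖ ≤ 1 → (-1 ≤ x.1 ∧ x.1 ≤ 1) ∧ (-1 ≤ x.2 ∧ x.2 ≤ 1) := by
    intro x hx
    rw [Prod.norm_def, max_le_iff] at hx
    exact ⟨abs_le.1 hx.1, abs_le.1 hx.2⟩
  have hUin : ∀ q ∈ U, (pol (S q.1) (T q.2)).1 ^ 2 + (pol (S q.1) (T q.2)).2 ^ 2 < 1 := by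
    intro q hq
    have hq' : S q.1 < 0 := hq
    rw [pol_nsq]; exact Real.exp_lt_one_iff.2 (by linarith)
  have hsub : Metric.closedBall (0 : ℝ × ℝ) 1 ⊆ U := by
    intro x hx
    have := hnn x (by simpa using hx)
    simp only [hU, hS, Set.mem_ofPred_eq]
    nlinarith [this.1.2]
  have hee1 : e1 ≠ 0 := by rintro rfl; norm_num at he1
  have hee2 : e2 ≠ 0 := by rintro rfl; norm_num at he2
  have key := quadrant_lemma (U := U) (g := F) ?_ ?_ hsub hFc.continuousOn ?_ ?_ ?_
  · have hd : 0 < s2 - s1 := by linarith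
    have := key ((s - (s1 + s2) / 2) / ((s2 - s1) / 2), t / (π / 4) - 1) (by
      rw [Prod.norm_def, max_le_iff, Real.norm_eq_abs, Real.norm_eq_abs, abs_le, abs_le]
      refine ⟨⟨?_, ?_⟩, ?_, ?_⟩
      · rw [le_div_iff₀ (by positivity)]; linarith
      · rw [div_le_iff₀ (by positivity)]; linarith
      · have : 0 ≤ t / (π / 4) := by positivity
        simp only; linarith
      · have : t / (π / 4) ≤ 2 := by rw [div_le_iff₀ (by positivity)]; linarith
        simp only; linarith)
    have e1' : S ((s - (s1 + s2) / 2) / ((s2 - s1) / 2)) = s := by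
      simp only [hS]; field_simp; ring
    have e2' : T (t / (π / 4) - 1) = t := by simp only [hT]; field_simp; ring
    simpa only [hF, e1', e2'] using this
  · intro x hx y hy a b ha hb hab
    have hx' : S x.1 < 0 := hx
    have hy' : S y.1 < 0 := hy
    change S (a * x.1 + b * y.1) < 0
    have : S (a * x.1 + b * y.1) = a * S x.1 + b * S y.1 := by
      simp only [hS]; linear_combination (-(s1 + s2) / 2) * hab
    rw [this]
    rcases ha.eq_or_lt with h | h
    · have : b = 1 := by linarith
      rw [← h, this]; linarith
    · nlinarith [mul_nonneg hb (neg_nonneg.2 hy'.le), mul_pos h (neg_pos.2 hx')]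
  · exact isOpen_lt (by fun_prop) continuous_const
  · intro x hx hz
    have z1 : psi (e1 * 1) (e2 * η) u (pol (S x.1) (T x.2)) = 0 := congrArg Complex.re hz
    have z2 : psi (e1 * η) (e2 * 1) u (pol (S x.1) (T x.2)) = 0 := congrArg Complex.im hz
    unfold psi at z1 z2
    have hη : 1 - η ^ 2 ≠ 0 := by nlinarith
    have y1 : e1 * (1 - η ^ 2) * phi1 u (pol (S x.1) (T x.2)) = 0 := by linear_combination z1 - η * z2
    have y2 : e2 * (1 - η ^ 2) * phi2 u (pol (S x.1) (T x.2)) = 0 := by linear_combination z2 - η * z1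
    exact h.theta_ne (pol_ne _ _) (hUin x hx)
      ((mul_eq_zero.1 y1).resolve_left (mul_ne_zero hee1 hη))
      ((mul_eq_zero.1 y2).resolve_left (mul_ne_zero hee2 hη))
  · intro x hx
    have hxn := hnn x hx.le
    have hT0 : 0 ≤ T x.2 := by simp only [hT]; nlinarith [hxn.2.1]
    have hT1 : T x.2 ≤ π / 2 := by simp only [hT]; nlinarith [hxn.2.2]
    have hq1 : 0 ≤ (pol (S x.1) (T x.2)).1 :=
      mul_nonneg (Real.exp_pos _).le (Real.cos_nonneg_of_mem_Icc ⟨by linarith, hT1⟩)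
    have hq2 : 0 ≤ (pol (S x.1) (T x.2)).2 :=
      mul_nonneg (Real.exp_pos _).le (Real.sin_nonneg_of_nonneg_of_le_pi hT0 (by linarith))
    have hUx : x ∈ U := hsub (by simp [hx])
    have hlt : S x.1 < 0 := hUx
    rw [Prod.norm_def, Real.norm_eq_abs, Real.norm_eq_abs] at hx
    have hcases : (x.1 = 1 ∨ x.1 = -1) ∨ (x.2 = 1 ∨ x.2 = -1) := by
      rcases max_choice |x.1| |x.2| with h | h
      · left; rw [h] at hx; exact eq_or_eq_neg_of_abs_eq hx
      · right; rw [h] at hx; exact eq_or_eq_neg_of_abs_eq hx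
    have hel : rexp (S x.1) < 1 := Real.exp_lt_one_iff.2 hlt
    rcases hcases with (hc | hc) | (hc | hc)
    · have : S x.1 = s2 := by rw [hc]; simp only [hS]; ring
      have hn := pol_nsq (S x.1) (T x.2)
      rw [this] at hn hq1 hq2 hlt
      simp only [hF, this]
      have hl : rexp (2 * s2) < 1 := Real.exp_lt_one_iff.2 (by linarith)
      exact ⟨hd1 _ hq1 hq2 (by rw [hn]; exact hs2a) (by rw [hn]; exact hl),
        hd2 _ hq1 hq2 (by rw [hn]; exact hs2b) (by rw [hn]; exact hl)⟩
    · have : S x.1 = s1 := by rw [hc]; simp only [hS]; ring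
      have hn := pol_nsq (S x.1) (T x.2)
      rw [this] at hn hq1 hq2 hlt
      simp only [hF, this]
      exact ⟨hr1 _ (pol_ne _ _) hq1 hq2 (by rw [hn]; exact hs1a),
        hr2 _ (pol_ne _ _) hq1 hq2 (by rw [hn]; exact hs1b)⟩
    · have : T x.2 = π / 2 := by rw [hc]; simp only [hT]; ring
      simp only [hF, this, psi, pol, Real.cos_pi_div_two, Real.sin_pi_div_two, mul_zero, mul_one, h.ax2]
      have := hp1 _ (Real.exp_pos (S x.1)) hel
      constructor <;> nlinarith
    · have : T x.2 = 0 := by rw [hc]; simp only [hT]; ring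
      simp only [hF, this, psi, pol, Real.cos_zero, Real.sin_zero, mul_zero, mul_one, h.ax1]
      have := hp2 _ (Real.exp_pos (S x.1)) hel
      constructor <;> nlinarith
  · intro x hx v hv hz hev
    have hxU : x ∈ U := hsub (by simpa using hx.le)
    set A := e1 * (v.re * η + v.im) with hA
    set B := e2 * (v.re + v.im * η) with hB
    have hval : ∀ y, (v * F y).im = psi A B u (pol (S y.1) (T y.2)) := by
      intro y
      simp only [Complex.mul_im, hF, psi, hA, hB]; ring
    simp only [hval] at hz hev
    have hAB : A ≠ 0 ∨ B ≠ 0 := by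
      by_contra hcon
      push Not at hcon
      have a1 := (mul_eq_zero.1 hcon.1).resolve_left hee1
      have a2 := (mul_eq_zero.1 hcon.2).resolve_left hee2
      have hη : 1 - η ^ 2 ≠ 0 := by nlinarith
      have b1 : (1 - η ^ 2) * v.re = 0 := by linear_combination a2 - η * a1
      have b2 : (1 - η ^ 2) * v.im = 0 := by linear_combination a1 - η * a2
      exact hv (Complex.ext ((mul_eq_zero.1 b1).resolve_left hη) ((mul_eq_zero.1 b2).resolve_left hη))
    have hds : HasDerivAt (fun y => psi A B u (pol (S y) (T x.2)))
        (Xs (psi A B u) (pol (S x.1) (T x.2)) * ((s2 - s1) / 2)) x.1 :=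
      (pol_ds (hpsi A B) (S x.1) (T x.2)).comp x.1 (dS x.1)
    have hdt : HasDerivAt (fun y => psi A B u (pol (S x.1) (T y)))
        (Xt (psi A B u) (pol (S x.1) (T x.2)) * (π / 4)) x.2 :=
      (pol_dt (hpsi A B) (S x.1) (T x.2)).comp x.2 (dT x.2)
    have m1 : IsLocalMin (fun y => psi A B u (pol (S y) (T x.2))) x.1 := by
      have hcc : Filter.Tendsto (fun y : ℝ => (y, x.2)) (𝓝 x.1) (𝓝 x) :=
        (by fun_prop : Continuous fun y : ℝ => (y, x.2)).tendsto x.1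
      filter_upwards [hcc.eventually hev] with y hy
      rw [hz]; exact hy
    have m2 : IsLocalMin (fun y => psi A B u (pol (S x.1) (T y))) x.2 := by
      have hcc : Filter.Tendsto (fun y : ℝ => (x.1, y)) (𝓝 x.2) (𝓝 x) :=
        (by fun_prop : Continuous fun y : ℝ => (x.1, y)).tendsto x.2
      filter_upwards [hcc.eventually hev] with y hy
      rw [hz]; exact hy
    have w1 := (mul_eq_zero.1 (m1.hasDerivAt_eq_zero hds)).resolve_right (by
      have : 0 < s2 - s1 := by linarith
      positivity)
    have w2 := (mul_eq_zero.1 (m2.hasDerivAt_eq_zero hdt)).resolve_right (by positivity)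
    set p := pol (S x.1) (T x.2) with hp
    have hn := nsq_pos (pol_ne (S x.1) (T x.2))
    rw [← hp] at hn
    simp only [Xs, Xt] at w1 w2
    have d1 : (p.1 ^ 2 + p.2 ^ 2) * D1 (psi A B u) p = 0 := by linear_combination p.1 * w1 - p.2 * w2
    have d2 : (p.1 ^ 2 + p.2 ^ 2) * D2 (psi A B u) p = 0 := by linear_combination p.2 * w1 + p.1 * w2
    exact h.nosing hAB (pol_ne _ _) (hUin x hxU) hz ((mul_eq_zero.1 d1).resolve_left hn.ne')
      ((mul_eq_zero.1 d2).resolve_left hn.ne')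

/-- constant signs on the quarter disc -/
theorem const_signs (h : GS lam u) : ∃ e1 e2 : ℝ, e1 ^ 2 = 1 ∧ e2 ^ 2 = 1 ∧
    ∀ s t : ℝ, s < 0 → 0 ≤ t → t ≤ π / 2 →
      0 ≤ e1 * phi1 u (pol s t) ∧ 0 ≤ e2 * phi2 u (pol s t) := by
  obtain ⟨e1, e2, he1, he2, hp1, hp2⟩ := h.signs
  refine ⟨e1, e2, he1, he2, fun s t hs h0 h1 => ?_⟩
  have hev : ∀ᶠ η : ℝ in 𝓝[>] 0, 0 < psi (e1 * 1) (e2 * η) u (pol s t) ∧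
      0 < psi (e1 * η) (e2 * 1) u (pol s t) := by
    have : ∀ᶠ r : ℝ in 𝓝[>] 0, r < 1 := (eventually_lt_nhds one_pos).filter_mono nhdsWithin_le_nhds
    filter_upwards [this, self_mem_nhdsWithin] with η a b
    exact h.quad_eta he1 he2 hp1 hp2 b a hs h0 h1
  constructor
  · have hc : Continuous fun η : ℝ => psi (e1 * 1) (e2 * η) u (pol s t) := by unfold psi; fun_prop
    have := ge_of_tendsto ((hc.tendsto 0).mono_left nhdsWithin_le_nhds)
      (hev.mono fun η hη => hη.1.le)
    simpa [psi] using this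
  · have hc : Continuous fun η : ℝ => psi (e1 * η) (e2 * 1) u (pol s t) := by unfold psi; fun_prop
    have := ge_of_tendsto ((hc.tendsto 0).mono_left nhdsWithin_le_nhds)
      (hev.mono fun η hη => hη.2.le)
    simpa [psi] using this

end GS

open scoped ContDiff Topology

theorem pol_integral_deriv {g : ℝ × ℝ → ℝ} (hg : ContDiff ℝ ∞ g) (a b s0 : ℝ) :
    HasDerivAt (fun s => ∫ t in a..b, g (pol s t)) (∫ t in a..b, Xs g (pol s0 t)) s0 := by
  have hX := (contDiff_Xs hg).continuous.comp pol_cont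
  have hK : IsCompact (Set.Icc (s0 - 1) (s0 + 1) ×ˢ Set.uIcc a b) := isCompact_Icc.prod isCompact_uIcc
  obtain ⟨C, hC⟩ := hK.exists_bound_of_continuousOn hX.continuousOn
  have hc : ∀ s, Continuous fun t => g (pol s t) := fun s =>
    hg.continuous.comp (pol_cont.comp (by fun_prop : Continuous fun t : ℝ => (s, t)))
  have hc' : ∀ s, Continuous fun t => Xs g (pol s t) := fun s =>
    (contDiff_Xs hg).continuous.comp (pol_cont.comp (by fun_prop : Continuous fun t : ℝ => (s, t)))
  refine (intervalIntegral.hasDerivAt_integral_of_dominated_loc_of_deriv_le (μ := volume)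
    (F := fun s t => g (pol s t)) (F' := fun s t => Xs g (pol s t)) (bound := fun _ => C)
    (s := Set.Icc (s0 - 1) (s0 + 1)) (Icc_mem_nhds (by linarith) (by linarith)) ?_ ?_ ?_ ?_ ?_ ?_).2
  · exact Filter.Eventually.of_forall fun s => (hc s).aestronglyMeasurable
  · exact (hc s0).intervalIntegrable _ _
  · exact (hc' s0).aestronglyMeasurable
  · exact Filter.Eventually.of_forall fun t ht s hs => hC (s, t) ⟨hs, Set.uIoc_subset_uIcc ht⟩
  · exact intervalIntegrable_const
  · exact Filter.Eventually.of_forall fun t ht s hs => pol_ds hg s t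

theorem pol_inv (s t : ℝ) : inv2 (pol s t) = pol (-s) t := by
  have h := pol_nsq s t
  unfold inv2
  rw [h]
  have : rexp (2 * s) = rexp s * rexp s := by rw [two_mul, Real.exp_add]
  ext <;> simp only [pol, this, Real.exp_neg] <;> field_simp

theorem Xt_mul' {a b : ℝ × ℝ → ℝ} (ha : ContDiff ℝ ∞ a) (hb : ContDiff ℝ ∞ b) :
    Xt (fun p => a p * b p) = fun p => Xt a p * b p + a p * Xt b p := by
  ext p; unfold Xt; simp (disch := fun_prop) only [D1_mul, D2_mul]; ring
theorem Xs_mul' {a b : ℝ × ℝ → ℝ} (ha : ContDiff ℝ ∞ a) (hb : ContDiff ℝ ∞ b) :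
    Xs (fun p => a p * b p) = fun p => Xs a p * b p + a p * Xs b p := by
  ext p; unfold Xs; simp (disch := fun_prop) only [D1_mul, D2_mul]; ring
theorem Xt_sub' {a b : ℝ × ℝ → ℝ} (ha : ContDiff ℝ ∞ a) (hb : ContDiff ℝ ∞ b) :
    Xt (fun p => a p - b p) = fun p => Xt a p - Xt b p := by
  ext p; unfold Xt; simp (disch := fun_prop) only [D1_sub, D2_sub]; ring
theorem Xs_sub' {a b : ℝ × ℝ → ℝ} (ha : ContDiff ℝ ∞ a) (hb : ContDiff ℝ ∞ b) :
    Xs (fun p => a p - b p) = fun p => Xs a p - Xs b p := by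
  ext p; unfold Xs; simp (disch := fun_prop) only [D1_sub, D2_sub]; ring
theorem Xt_add' {a b : ℝ × ℝ → ℝ} (ha : ContDiff ℝ ∞ a) (hb : ContDiff ℝ ∞ b) :
    Xt (fun p => a p + b p) = fun p => Xt a p + Xt b p := by
  ext p; unfold Xt; simp (disch := fun_prop) only [D1_add, D2_add]; ring

def GG (lam : ℝ) (u : ℝ × ℝ → ℝ) (p : ℝ × ℝ) : ℝ :=
  (p.1 ^ 2 + p.2 ^ 2) * (lam * rho p * Real.exp (u p))

theorem Xt_GG {lam : ℝ} {u : ℝ × ℝ → ℝ} (hs : ContDiff ℝ ∞ u) :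
    Xt (GG lam u) = fun p => GG lam u p * phi3 u p := by
  ext p
  unfold Xt GG phi3
  simp (disch := fun_prop) only [D1_mul, D2_mul, D1_add, D2_add, D1_pow, D2_pow, D1_fst, D2_fst,
    D1_snd, D2_snd, D1_const, D2_const, D1_exp, D2_exp, D1_rho, D2_rho]
  ring

theorem Xt_eqn {lam : ℝ} {u f : ℝ × ℝ → ℝ} (hu : ContDiff ℝ ∞ u) (hf : LS lam u f) (p : ℝ × ℝ) :
    Xs (Xs (Xt f)) p + Xt (Xt (Xt f)) p + GG lam u p * Xt f p = - (GG lam u p * phi3 u p * f p) := by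
  have hfs := hf.sm
  have hG : ContDiff ℝ ∞ (GG lam u) := by unfold GG; fun_prop
  have h0 : (fun p => (Xs (Xs f) p + Xt (Xt f) p) + GG lam u p * f p) = fun _ => (0 : ℝ) := by
    ext p; exact LS_X hf p
  have h1 := congrArg Xt h0
  rw [Xt_add' (by fun_prop) (by fun_prop), Xt_add' (by fun_prop) (by fun_prop),
    Xt_mul' hG hfs, Xt_GG hu] at h1
  have h2 := congrFun h1 p
  have h3 : Xt (fun _ : ℝ × ℝ => (0 : ℝ)) p = 0 := by
    unfold Xt; simp only [D1_const, D2_const]; ring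
  rw [h3] at h2
  rw [Xst_comm hfs, Xst_comm (contDiff_Xs hfs)]
  simp only at h2
  linarith

namespace GS
variable {lam : ℝ} {u : ℝ × ℝ → ℝ}

theorem triple (h : GS lam u) {e3 : ℝ}
    (h3 : ∀ s t : ℝ, s < 0 → 0 ≤ t → t ≤ π / 2 → 0 ≤ e3 * phi3 u (pol s t)) (he3 : e3 ≠ 0)
    (s t : ℝ) (hs : s < 0) (ht0 : 0 < t) (ht1 : t < π / 2) :
    phi1 u (pol s t) * phi2 u (pol s t) * phi3 u (pol s t) = 0 := by
  have hsm := h.ps.sm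
  have o1 := OL_phi1 h.ps
  have o2 := OL_phi2 h.ps
  have hpi := Real.pi_pos
  obtain ⟨e1, e2, he1, he2, hsg⟩ := h.const_signs
  set f := Xt (phi1 u) with hf
  set g := phi2 u with hg
  have hfs : ContDiff ℝ ∞ f := by rw [hf]; fun_prop
  have hgs : ContDiff ℝ ∞ g := by rw [hg]; fun_prop
  have hG : ContDiff ℝ ∞ (GG lam u) := by unfold GG; fun_prop
  set A : ℝ × ℝ → ℝ := fun p => g p * Xs f p - f p * Xs g p with hA
  set B : ℝ × ℝ → ℝ := fun p => g p * Xt f p - f p * Xt g p with hB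
  have hAs : ContDiff ℝ ∞ A := by rw [hA]; fun_prop
  have hBs : ContDiff ℝ ∞ B := by rw [hB]; fun_prop
  set H : ℝ × ℝ → ℝ := fun p => GG lam u p * (phi1 u p * phi2 u p * phi3 u p) with hH
  have hHs : ContDiff ℝ ∞ H := by rw [hH]; fun_prop
  have hdiv : ∀ p, Xs A p = - Xt B p - H p := by
    intro p
    have e1 := Xt_eqn hsm o1.ls p
    have e2 := LS_X o2.ls p
    have e2' : Xs (Xs g) p + Xt (Xt g) p + GG lam u p * g p = 0 := e2
    simp only [hA, hB, hH]
    rw [Xs_sub' (by fun_prop) (by fun_prop), Xs_mul' (by fun_prop) (by fun_prop),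
      Xs_mul' (by fun_prop) (by fun_prop), Xt_sub' (by fun_prop) (by fun_prop),
      Xt_mul' (by fun_prop) (by fun_prop), Xt_mul' (by fun_prop) (by fun_prop)]
    simp only [← hf, ← hg] at e1 ⊢
    linear_combination g p * e1 - f p * e2'
  -- boundary values
  have hf1 : ∀ p : ℝ × ℝ, f (-p.1, p.2) = (-1) * f p := fun p => by
    have := (Xpar1 (f := phi1 u) (by fun_prop) (s := 1) (by simpa using phi1_ev1 h.ps) p).2
    simpa using this
  have hf2 : ∀ p : ℝ × ℝ, f (p.1, -p.2) = 1 * f p := fun p => by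
    have := (Xpar2 (f := phi1 u) (by fun_prop) (s := -1) (by simpa using phi1_od2 h.ps) p).2
    simpa using this
  have hB0 : ∀ s, B (pol s 0) = 0 := by
    intro s
    have k1 := (Xpar2 hfs hf2 (rexp s, 0)).2
    have k2 := (Xpar2 hgs (s := 1) (by simpa using phi2_ev2 h.ps) (rexp s, 0)).2
    simp at k1 k2
    have k1' : Xt f (rexp s, 0) = 0 := by linarith
    have k2' : Xt g (rexp s, 0) = 0 := by linarith
    simp [hB, pol, k1', k2']
  have hB1 : ∀ s, B (pol s (π / 2)) = 0 := by
    intro s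
    have k1 := hf1 (0, rexp s)
    simp at k1
    have k1' : f (0, rexp s) = 0 := by linarith
    have k2 : g (0, rexp s) = 0 := h.ax2 _
    simp [hB, pol, k1', k2]
  have hcs : ∀ {k : ℝ × ℝ → ℝ}, ContDiff ℝ ∞ k → ∀ s, Continuous fun t => k (pol s t) := fun hk s =>
    hk.continuous.comp (pol_cont.comp (by fun_prop : Continuous fun t : ℝ => (s, t)))
  set J : ℝ → ℝ := fun s => ∫ t in (0:ℝ)..(π / 2), A (pol s t) with hJ
  have hJd : ∀ s, HasDerivAt J (- ∫ t in (0:ℝ)..(π / 2), H (pol s t)) s := by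
    intro s
    refine (pol_integral_deriv hAs 0 (π / 2) s).congr_deriv ?_
    simp only [hdiv]
    rw [intervalIntegral.integral_sub, intervalIntegral.integral_neg,
      intervalIntegral.integral_eq_sub_of_hasDerivAt (f := fun t => B (pol s t))
        (fun t _ => pol_dt hBs s t), hB0, hB1]
    · ring
    · exact (hcs (by fun_prop) s).intervalIntegrable _ _
    · exact (hcs (by fun_prop) s).neg.intervalIntegrable _ _
    · exact (hcs hHs s).intervalIntegrable _ _
  have hJ0 : J 0 = 0 := by
    simp only [hJ]
    have : ∀ t, A (pol 0 t) = 0 := by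
      intro t
      have hn : (pol 0 t).1 ^ 2 + (pol 0 t).2 ^ 2 = 1 := by rw [pol_nsq]; simp
      have k1 : f (pol 0 t) = 0 := o1.circ_t _ hn
      have k2 : g (pol 0 t) = 0 := o2.circ _ hn
      simp [hA, k1, k2]
    simp [this]
  have hJm : Filter.Tendsto J Filter.atBot (𝓝 0) := by
    have hA0 : A 0 = 0 := by
      have k1 : g 0 = 0 := h.ax2 0
      have k2 : f 0 = 0 := by simp [hf, Xt]
      simp [hA, k1, k2]
    rw [Metric.tendsto_nhds]
    intro ε hε
    obtain ⟨r, hr, hball⟩ := Metric.continuous_iff.1 hAs.continuous 0 (ε / 2) (by linarith)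
    filter_upwards [Real.tendsto_exp_atBot.eventually_lt_const hr] with s hs
    have hle : ∀ t ∈ Set.uIoc 0 (π / 2), ‖A (pol s t)‖ ≤ ε / 2 := by
      intro t _
      have : dist (pol s t) 0 < r := by
        rw [dist_zero_right, Prod.norm_def, max_lt_iff]
        simp only [pol, Real.norm_eq_abs, abs_mul, Real.abs_exp]
        constructor
        · nlinarith [Real.abs_cos_le_one t, Real.exp_pos s]
        · nlinarith [Real.abs_sin_le_one t, Real.exp_pos s]
      have := hball _ this
      rw [hA0, dist_zero_right] at this
      exact this.le
    have := intervalIntegral.norm_integral_le_of_norm_le_const hle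
    rw [dist_zero_right]
    rw [sub_zero, abs_of_pos (by linarith)] at this
    have h4 := Real.pi_lt_four
    refine lt_of_le_of_lt this ?_
    nlinarith
  set e := e1 * e2 * e3 with he
  have he0 : e ≠ 0 := by
    have hee1 : e1 ≠ 0 := by rintro rfl; norm_num at he1
    have hee2 : e2 ≠ 0 := by rintro rfl; norm_num at he2
    exact mul_ne_zero (mul_ne_zero hee1 hee2) he3
  have hGpos : ∀ s t, 0 < GG lam u (pol s t) := by
    intro s t
    have h1 := nsq_pos (pol_ne s t)
    have h2 := rho_pos (pol s t)
    have h3 : 0 < lam := by linarith [h.l1]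
    unfold GG; positivity
  have hHn : ∀ s t, s < 0 → 0 ≤ t → t ≤ π / 2 → 0 ≤ e * H (pol s t) := by
    intro s t a b c
    have k1 := (hsg s t a b c).1
    have k2 := (hsg s t a b c).2
    have k3 := h3 s t a b c
    have : e * H (pol s t) = GG lam u (pol s t) *
      ((e1 * phi1 u (pol s t)) * (e2 * g (pol s t)) * (e3 * phi3 u (pol s t))) := by
      simp only [he, hH]; ring
    rw [this]
    exact mul_nonneg (hGpos s t).le (mul_nonneg (mul_nonneg k1 k2) k3)
  have hKd : ∀ s, HasDerivAt (fun s => e * J s) (- ∫ t in (0:ℝ)..(π / 2), e * H (pol s t)) s := by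
    intro s
    refine ((hJd s).const_mul e).congr_deriv ?_
    rw [intervalIntegral.integral_const_mul]; ring
  have hanti : AntitoneOn (fun s => e * J s) (Set.Iic 0) := by
    refine antitoneOn_of_deriv_nonpos (convex_Iic 0)
      (fun s _ => (hKd s).continuousAt.continuousWithinAt)
      (fun s _ => (hKd s).differentiableAt.differentiableWithinAt) ?_
    intro s hs
    rw [interior_Iic] at hs
    rw [(hKd s).deriv]
    have := intervalIntegral.integral_nonneg (μ := volume) (f := fun t => e * H (pol s t))
      (by linarith : (0:ℝ) ≤ π / 2) (fun t ht => hHn s t hs ht.1 ht.2)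
    linarith
  have hK0 : ∀ s ∈ Set.Iic (0:ℝ), e * J s = 0 := by
    intro s hs
    apply le_antisymm
    · have hm : Filter.Tendsto (fun s => e * J s) Filter.atBot (𝓝 0) := by
        simpa using hJm.const_mul e
      refine ge_of_tendsto hm ?_
      filter_upwards [Filter.eventually_le_atBot s] with s' hs'
      exact hanti (hs'.trans hs) hs hs'
    · have := hanti hs (Set.mem_Iic.2 le_rfl) hs
      simp only [hJ0, mul_zero] at this
      exact this
  have hd0 : (- ∫ t in (0:ℝ)..(π / 2), e * H (pol s t)) = 0 := by
    have hev : (fun s => e * J s) =ᶠ[𝓝 s] fun _ => 0 := by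
      filter_upwards [Iic_mem_nhds hs] with s' hs'
      exact hK0 s' hs'
    exact (hKd s).unique ((hasDerivAt_const s (0:ℝ)).congr_of_eventuallyEq hev)
  by_contra hne
  have hpos : 0 < e * H (pol s t) := by
    refine lt_of_le_of_ne (hHn s t hs ht0.le ht1.le) (Ne.symm ?_)
    exact mul_ne_zero he0 (mul_ne_zero (hGpos s t).ne' hne)
  have := intervalIntegral.integral_pos (f := fun t => e * H (pol s t)) (by linarith : (0:ℝ) < π / 2)
    ((hcs hHs s).const_mul e).continuousOn (fun x hx => hHn s x hs hx.1.le hx.2)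
    ⟨t, ⟨ht0.le, ht1.le⟩, hpos⟩
  linarith

theorem phi3_arc (h : GS lam u) {e3 : ℝ}
    (h3 : ∀ s t : ℝ, s < 0 → 0 ≤ t → t ≤ π / 2 → 0 ≤ e3 * phi3 u (pol s t)) (he3 : e3 ≠ 0)
    (t : ℝ) (ht0 : 0 < t) (ht1 : t < π / 2) : phi3 u (cos t, sin t) = 0 := by
  have hsm := h.ps.sm
  have hpi := Real.pi_pos
  have p0 : pol 0 t = (cos t, sin t) := by simp [pol]
  have d1 := pol_ds (contDiff_phi1 hsm) 0 t
  have d2 := pol_ds (contDiff_phi2 hsm) 0 t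
  have n1 : Xs (phi1 u) (pol 0 t) ≠ 0 := by
    rw [p0]; exact h.c1_ne (by simp) (Real.sin_pos_of_pos_of_lt_pi ht0 (by linarith)).ne'
  have n2 : Xs (phi2 u) (pol 0 t) ≠ 0 := by
    rw [p0]; exact h.c2_ne (by simp) (Real.cos_pos_of_mem_Ioo ⟨by linarith, ht1⟩).ne'
  have hmono : 𝓝[<] (0:ℝ) ≤ 𝓝[≠] 0 := nhdsWithin_mono _ (fun x hx => ne_of_lt hx)
  have ev1 := (d1.eventually_ne (c := 0) n1).filter_mono hmono
  have ev2 := (d2.eventually_ne (c := 0) n2).filter_mono hmono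
  have hc : Continuous fun s => phi3 u (pol s t) :=
    (contDiff_phi3 hsm).continuous.comp (pol_cont.comp (by fun_prop : Continuous fun s : ℝ => (s, t)))
  have ht := (hc.tendsto 0).mono_left (nhdsWithin_le_nhds (s := Set.Iio 0))
  rw [p0] at ht
  refine tendsto_nhds_unique ht ((tendsto_const_nhds (x := (0:ℝ))).congr' ?_)
  filter_upwards [ev1, ev2, self_mem_nhdsWithin] with s a b c
  have := h.triple h3 he3 s t c ht0 ht1
  exact ((mul_eq_zero.1 this).resolve_left (mul_ne_zero a b)).symm

theorem phi3_zero (h : GS lam u) {e3 : ℝ}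
    (h3 : ∀ s t : ℝ, s < 0 → 0 ≤ t → t ≤ π / 2 → 0 ≤ e3 * phi3 u (pol s t)) (he3 : e3 ≠ 0) :
    ∀ p, phi3 u p = 0 := by
  have hsm := h.ps.sm
  have hpi := Real.pi_pos
  have hv : ∀ t, 0 < t → t < π / 2 → Van 1 (phi3 u) (cos t, sin t) ∧ Van 1 (phi3 u) (-(cos t, sin t)) := by
    intro t ht0 ht1
    have z0 := h.phi3_arc h3 he3 t ht0 ht1
    have zt : Xt (phi3 u) (cos t, sin t) = 0 := by
      have hev : (fun t => phi3 u (cos t, sin t)) =ᶠ[𝓝 t] fun _ => 0 := by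
        filter_upwards [Ioo_mem_nhds ht0 ht1] with x hx
        exact h.phi3_arc h3 he3 x hx.1 hx.2
      exact (circ_deriv (contDiff_phi3 hsm) t).unique ((hasDerivAt_const t (0:ℝ)).congr_of_eventuallyEq hev)
    have zs : Xs (phi3 u) (cos t, sin t) = 0 := by
      have k1 := pol_ds (contDiff_phi3 hsm) 0 t
      have k2 : HasDerivAt (fun s => phi3 u (pol (-s) t)) (- Xs (phi3 u) (pol 0 t)) 0 := by
        have k3 := pol_ds (contDiff_phi3 hsm) (-0) t
        have := k3.scomp (0:ℝ) (hasDerivAt_neg (0:ℝ))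
        refine this.congr_deriv (by simp)
      have k4 : (fun s => phi3 u (pol (-s) t)) = fun s => phi3 u (pol s t) := by
        ext s; rw [← pol_inv, phi3_inv h.ps (pol_ne _ _)]
      rw [k4] at k2
      have := k1.unique k2
      have p0 : pol 0 t = (cos t, sin t) := by simp [pol]
      rw [p0] at this
      linarith
    have hn : ((cos t) ^ 2 + (sin t) ^ 2) = 1 := by simp
    have d1 : D1 (phi3 u) (cos t, sin t) = 0 := by
      simp only [Xs, Xt] at zs zt
      linear_combination cos t * zs - sin t * zt - D1 (phi3 u) (cos t, sin t) * hn
    have d2 : D2 (phi3 u) (cos t, sin t) = 0 := by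
      simp only [Xs, Xt] at zs zt
      linear_combination sin t * zs + cos t * zt - D2 (phi3 u) (cos t, sin t) * hn
    refine ⟨Van_one (contDiff_phi3 hsm) z0 d1 d2, ?_⟩
    have hpar1 := par1 (contDiff_phi3 hsm) (s := -1) (by simpa using phi3_od1 h.ps)
    have hpar2 := par2 (contDiff_phi3 hsm) (s := -1) (by simpa using phi3_od2 h.ps)
    have q1 := hpar1 (cos t, -sin t)
    have q2 := hpar2 (cos t, sin t)
    have q3 := phi3_od1 h.ps (cos t, - sin t)
    have q4 := phi3_od2 h.ps (cos t, sin t)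
    simp only at q1 q2 q3 q4
    have hneg : -((cos t, sin t) : ℝ × ℝ) = (-cos t, -sin t) := rfl
    rw [hneg]
    refine Van_one (contDiff_phi3 hsm) ?_ ?_ ?_
    · rw [q3, q4, z0]; simp
    · rw [q1.1, q2.1, d1]; simp
    · rw [q1.2, q2.2, d2]; simp
  have hvc : ∀ t, 0 < t → t < π / 2 → ∀ p, csq (cos t, sin t) = csq p → Van 1 (phi3 u) p := by
    intro t h0 h1 p hp
    rcases csq_eq hp.symm with rfl | rfl
    · exact (hv t h0 h1).1
    · exact (hv t h0 h1).2
  have hc2 : ∀ t : ℝ, csq (cos t, sin t) = (cos (2 * t), sin (2 * t)) := by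
    intro t; simp only [csq, Real.cos_two_mul', Real.sin_two_mul]; ext <;> simp; ring
  have hun : ∀ t : ℝ, (csq (cos t, sin t)).1 ^ 2 + (csq (cos t, sin t)).2 ^ 2 = 1 := by
    intro t; rw [hc2]; simp
  have hne0 : ∀ t : ℝ, csq (cos t, sin t) ≠ 0 := fun t h0 => by
    have := hun t; rw [h0] at this; norm_num at this
  have a1 : csq (cos (π / 6), sin (π / 6)) ≠ csq (cos (π / 4), sin (π / 4)) := by
    rw [hc2, hc2]; intro h
    have := congrArg Prod.fst h
    simp only at this
    rw [show 2 * (π / 6) = π / 3 by ring, show 2 * (π / 4) = π / 2 by ring] at this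
    norm_num at this
  have a2 : csq (cos (π / 4), sin (π / 4)) ≠ csq (cos (π / 3), sin (π / 3)) := by
    rw [hc2, hc2]; intro h
    have := congrArg Prod.fst h
    simp only at this
    rw [show 2 * (π / 3) = π - π / 3 by ring, show 2 * (π / 4) = π / 2 by ring, Real.cos_pi_sub] at this
    norm_num at this
  have a3 : csq (cos (π / 6), sin (π / 6)) ≠ csq (cos (π / 3), sin (π / 3)) := by
    rw [hc2, hc2]; intro h
    have := congrArg Prod.fst h
    simp only at this
    rw [show 2 * (π / 3) = π - π / 3 by ring, show 2 * (π / 6) = π / 3 by ring, Real.cos_pi_sub] at this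
    norm_num at this
  refine N_three h.l1 h.l2 h.ps (LS_phi3 h.ps) (s := 1) (by norm_num)
    (fun p hp => by rw [phi3_inv h.ps hp]; ring) (csq (cos (π / 6), sin (π / 6)))
    (csq (cos (π / 4), sin (π / 4))) (csq (cos (π / 3), sin (π / 3))) (hne0 _) (hne0 _) (hne0 _) ?_ ?_
  · intro p hp
    rw [← qA_inv_unit (hun (π / 6)) hp, ← qA_inv_unit (hun (π / 4)) hp, ← qA_inv_unit (hun (π / 3)) hp]
    ring
  · intro p _ _
    have t1 := hvc (π / 6) (by linarith) (by linarith) p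
    have t2 := hvc (π / 4) (by linarith) (by linarith) p
    have t3 := hvc (π / 3) (by linarith) (by linarith) p
    by_cases c1 : csq (cos (π / 6), sin (π / 6)) = csq p
    · rw [if_pos c1, if_neg (fun c => a1 (c1.trans c.symm)), if_neg (fun c => a3 (c1.trans c.symm))]
      exact t1 c1
    · rw [if_neg c1]
      by_cases c2 : csq (cos (π / 4), sin (π / 4)) = csq p
      · rw [if_pos c2, if_neg (fun c => a2 (c2.trans c.symm))]
        exact t2 c2
      · rw [if_neg c2]
        by_cases c3 : csq (cos (π / 3), sin (π / 3)) = csq p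
        · rw [if_pos c3]; exact t3 c3
        · rw [if_neg c3]; exact Van_zero (contDiff_phi3 hsm) p

end GS

open scoped ContDiff Topology

theorem D_mul_at {f g : ℝ × ℝ → ℝ} {p : ℝ × ℝ} (hf : DifferentiableAt ℝ f p)
    (hg : DifferentiableAt ℝ g p) :
    D1 (fun x => f x * g x) p = f p * D1 g p + g p * D1 f p ∧
    D2 (fun x => f x * g x) p = f p * D2 g p + g p * D2 f p := by
  unfold D1 D2; rw [fderiv_fun_mul hf hg]; exact ⟨rfl, rfl⟩

theorem D_add_at {f g : ℝ × ℝ → ℝ} {p : ℝ × ℝ} (hf : DifferentiableAt ℝ f p)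
    (hg : DifferentiableAt ℝ g p) :
    D1 (fun x => f x + g x) p = D1 f p + D1 g p ∧
    D2 (fun x => f x + g x) p = D2 f p + D2 g p := by
  unfold D1 D2; rw [fderiv_fun_add hf hg]; exact ⟨rfl, rfl⟩

theorem D_sub_at {f g : ℝ × ℝ → ℝ} {p : ℝ × ℝ} (hf : DifferentiableAt ℝ f p)
    (hg : DifferentiableAt ℝ g p) :
    D1 (fun x => f x - g x) p = D1 f p - D1 g p ∧
    D2 (fun x => f x - g x) p = D2 f p - D2 g p := by
  unfold D1 D2; rw [fderiv_fun_sub hf hg]; exact ⟨rfl, rfl⟩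

/-- denominator of the permutation map -/
def ww (y : ℝ × ℝ) : ℝ := (1 + y.1) ^ 2 + y.2 ^ 2
def al (y : ℝ × ℝ) : ℝ := (1 + y.1) / ww y
def be (y : ℝ × ℝ) : ℝ := y.2 / ww y
/-- chart expression of the cyclic permutation of coordinates -/
def mm (y : ℝ × ℝ) : ℝ × ℝ := (2 * be y, 2 * al y - 1)

theorem ww_pos {y : ℝ × ℝ} (hy : -1 < y.1) : 0 < ww y := by
  unfold ww; have : 0 < 1 + y.1 := by linarith
  positivity

theorem ww_fd (p : ℝ × ℝ) : HasFDerivAt ww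
    ((2 * (1 + p.1)) • ContinuousLinearMap.fst ℝ ℝ ℝ + (2 * p.2) • ContinuousLinearMap.snd ℝ ℝ ℝ) p := by
  have h1 := (((hasFDerivAt_fst (𝕜 := ℝ) (p := p)).const_add 1).pow 2).add
    ((hasFDerivAt_snd (𝕜 := ℝ) (p := p)).pow 2)
  exact h1.congr_fderiv (by ext <;> simp; ring)

theorem albe (y : ℝ × ℝ) (hy : -1 < y.1) : al y ^ 2 + be y ^ 2 = (ww y)⁻¹ := by
  have := ww_pos hy
  unfold al be
  field_simp
  unfold ww; ring

theorem al_diff {p : ℝ × ℝ} (hy : -1 < p.1) : DifferentiableAt ℝ al p ∧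
    D1 al p = be p ^ 2 - al p ^ 2 ∧ D2 al p = - (2 * al p * be p) := by
  have hn := ww_pos hy
  have hI := (hasDerivAt_inv hn.ne').comp_hasFDerivAt p (ww_fd p)
  have da : HasFDerivAt al _ p := ((hasFDerivAt_fst (𝕜 := ℝ) (p := p)).const_add 1).mul hI
  refine ⟨da.differentiableAt, ?_, ?_⟩
  · rw [D1, da.fderiv]; simp; unfold al be; field_simp; unfold ww; ring
  · rw [D2, da.fderiv]; simp; unfold al be; field_simp

theorem be_diff {p : ℝ × ℝ} (hy : -1 < p.1) : DifferentiableAt ℝ be p ∧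
    D1 be p = - (2 * al p * be p) ∧ D2 be p = al p ^ 2 - be p ^ 2 := by
  have hn := ww_pos hy
  have hI := (hasDerivAt_inv hn.ne').comp_hasFDerivAt p (ww_fd p)
  have da : HasFDerivAt be _ p := (hasFDerivAt_snd (𝕜 := ℝ) (p := p)).mul hI
  refine ⟨da.differentiableAt, ?_, ?_⟩
  · rw [D1, da.fderiv]; simp; unfold al be; field_simp
  · rw [D2, da.fderiv]; simp; unfold al be; field_simp; unfold ww; ring

theorem al_sm {p : ℝ × ℝ} (hy : -1 < p.1) : ContDiffAt ℝ ∞ al p := by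
  have hn := ww_pos hy
  unfold al
  refine ContDiffAt.div (by fun_prop) ?_ hn.ne'
  unfold ww; fun_prop

theorem be_sm {p : ℝ × ℝ} (hy : -1 < p.1) : ContDiffAt ℝ ∞ be p := by
  have hn := ww_pos hy
  unfold be
  refine ContDiffAt.div (by fun_prop) ?_ hn.ne'
  unfold ww; fun_prop

theorem half_nhds {p : ℝ × ℝ} (hy : -1 < p.1) : ∀ᶠ q : ℝ × ℝ in 𝓝 p, -1 < q.1 :=
  (isOpen_lt continuous_const continuous_fst).mem_nhds hy

theorem mm_D {f : ℝ × ℝ → ℝ} (hf : Differentiable ℝ f) {p : ℝ × ℝ} (hy : -1 < p.1) :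
    DifferentiableAt ℝ (fun q => f (mm q)) p ∧
    D1 (fun q => f (mm q)) p = D1 f (mm p) * (-(4 * al p * be p))
      - D2 f (mm p) * (2 * (al p ^ 2 - be p ^ 2)) ∧
    D2 (fun q => f (mm q)) p = D1 f (mm p) * (2 * (al p ^ 2 - be p ^ 2))
      + D2 f (mm p) * (-(4 * al p * be p)) := by
  obtain ⟨a0, a1, a2⟩ := al_diff hy
  obtain ⟨b0, b1, b2⟩ := be_diff hy
  have ha : DifferentiableAt ℝ (fun q => 2 * be q) p := by fun_prop
  have hb : DifferentiableAt ℝ (fun q => 2 * al q - 1) p := by fun_prop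
  have h := D_comp (f := f) (a := fun q => 2 * be q) (b := fun q => 2 * al q - 1) (p := p)
    (hf _) ha hb
  have e1 : D1 (fun q => 2 * al q - 1) p = 2 * D1 al p := by
    rw [(D_sub_at (by fun_prop) (by fun_prop)).1, D1_smul', D1_const]; simp
  have e2 : D2 (fun q => 2 * al q - 1) p = 2 * D2 al p := by
    rw [(D_sub_at (by fun_prop) (by fun_prop)).2, D2_smul', D2_const]; simp
  rw [e1, e2, D1_smul', D2_smul', a1, a2, b1, b2] at h
  refine ⟨(hf _).comp p (ha.prodMk hb), ?_, ?_⟩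
  · refine h.1.trans ?_
    unfold mm; ring
  · refine h.2.trans ?_
    unfold mm; ring

theorem mm_Lap {f : ℝ × ℝ → ℝ} (hf : ContDiff ℝ ∞ f) {p : ℝ × ℝ} (hy : -1 < p.1) :
    Lap (fun q => f (mm q)) p = 4 * (al p ^ 2 + be p ^ 2) ^ 2 * Lap f (mm p) := by
  have hd := sm_diff hf
  have g1 : D1 (fun q => f (mm q)) =ᶠ[𝓝 p] fun q => D1 f (mm q) * (-(4 * (al q * be q)))
      - D2 f (mm q) * (2 * (al q * al q - be q * be q)) := by
    filter_upwards [half_nhds hy] with q hq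
    rw [(mm_D hd hq).2.1]; ring
  have g2 : D2 (fun q => f (mm q)) =ᶠ[𝓝 p] fun q =>
      D1 f (mm q) * (2 * (al q * al q - be q * be q))
      + D2 f (mm q) * (-(4 * (al q * be q))) := by
    filter_upwards [half_nhds hy] with q hq
    rw [(mm_D hd hq).2.2]; ring
  obtain ⟨a0, a1, a2⟩ := al_diff hy
  obtain ⟨b0, b1, b2⟩ := be_diff hy
  obtain ⟨c0, c1, c2⟩ := mm_D (sm_diff (contDiff_D1 hf)) hy
  obtain ⟨d0, d1, d2⟩ := mm_D (sm_diff (contDiff_D2 hf)) hy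
  have P0 : DifferentiableAt ℝ (fun q => -(4 * (al q * be q))) p := by fun_prop
  have Q0 : DifferentiableAt ℝ (fun q => 2 * (al q * al q - be q * be q)) p := by fun_prop
  have P1 : D1 (fun q => -(4 * (al q * be q))) p = -(4 * (al p * D1 be p + be p * D1 al p)) := by
    rw [D1_neg, ← (D_mul_at a0 b0).1, ← D1_smul']
  have P2 : D2 (fun q => -(4 * (al q * be q))) p = -(4 * (al p * D2 be p + be p * D2 al p)) := by
    rw [D2_neg, ← (D_mul_at a0 b0).2, ← D2_smul']
  have Q1 : D1 (fun q => 2 * (al q * al q - be q * be q)) p =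
      2 * ((al p * D1 al p + al p * D1 al p) - (be p * D1 be p + be p * D1 be p)) := by
    rw [D1_smul', (D_sub_at (a0.fun_mul a0) (b0.fun_mul b0)).1, ← (D_mul_at a0 a0).1,
      ← (D_mul_at b0 b0).1]
  have Q2 : D2 (fun q => 2 * (al q * al q - be q * be q)) p =
      2 * ((al p * D2 al p + al p * D2 al p) - (be p * D2 be p + be p * D2 be p)) := by
    rw [D2_smul', (D_sub_at (a0.fun_mul a0) (b0.fun_mul b0)).2, ← (D_mul_at a0 a0).2,
      ← (D_mul_at b0 b0).2]
  unfold Lap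
  rw [(D_congr g1).1, (D_congr g2).2]
  rw [(D_sub_at (c0.fun_mul P0) (d0.fun_mul Q0)).1, (D_add_at (c0.fun_mul Q0) (d0.fun_mul P0)).2,
    (D_mul_at c0 P0).1, (D_mul_at d0 Q0).1, (D_mul_at c0 Q0).2, (D_mul_at d0 P0).2,
    P1, P2, Q1, Q2, c1, c2, d1, d2, a1, a2, b1, b2]
  ring

theorem mm_rho {p : ℝ × ℝ} (hy : -1 < p.1) :
    rho (mm p) * (4 * (al p ^ 2 + be p ^ 2) ^ 2) = rho p := by
  have hn := ww_pos hy
  have e : 1 + (mm p).1 ^ 2 + (mm p).2 ^ 2 = 2 * (1 + p.1 ^ 2 + p.2 ^ 2) / ww p := by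
    unfold mm
    have : 1 + (2 * be p) ^ 2 + (2 * al p - 1) ^ 2 = 2 + 4 * (al p ^ 2 + be p ^ 2) - 4 * al p := by
      ring
    simp only [this, albe p hy]
    unfold al; field_simp; unfold ww; ring
  rw [albe p hy]
  unfold rho tau
  rw [e]
  have := sig_pos p
  field_simp
  norm_num

/-- The permuted solution. -/
def uu (u : ℝ × ℝ → ℝ) (y : ℝ × ℝ) : ℝ := if -1 < y.1 then u (mm y) else u (mm (-y.1, y.2))

theorem mm_refl {y : ℝ × ℝ} (h1 : -1 < y.1) (h2 : y.1 < 1) : mm (-y.1, y.2) = inv2 (mm y) := by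
  have w1 := ww_pos h1
  have w2 := ww_pos (y := (-y.1, y.2)) (by simpa using h2)
  have e : (mm y).1 ^ 2 + (mm y).2 ^ 2 = ww (-y.1, y.2) / ww y := by
    have : (mm y).1 ^ 2 + (mm y).2 ^ 2 = 1 + 4 * (al y ^ 2 + be y ^ 2) - 4 * al y := by
      unfold mm; ring
    rw [this, albe y h1]
    unfold al; field_simp; unfold ww; ring
  rw [inv2, e]
  unfold mm al be
  ext
  · simp only; field_simp
  · simp only; field_simp; unfold ww; ring

theorem mm_ne {y : ℝ × ℝ} (h1 : -1 < y.1) (h2 : y.1 < 1) : mm y ≠ 0 := by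
  intro h
  have w1 := ww_pos h1
  have a1 := congrArg Prod.fst h
  have a2 := congrArg Prod.snd h
  simp only [mm, be, al, Prod.fst_zero, Prod.snd_zero] at a1 a2
  field_simp at a1 a2
  unfold ww at a2
  have : y.2 = 0 := by simpa using a1
  rw [this] at a2
  nlinarith

theorem uu_pos {u : ℝ × ℝ → ℝ} {y : ℝ × ℝ} (h1 : -1 < y.1) : uu u y = u (mm y) := by
  simp [uu, h1]

section
variable {lam : ℝ} {u : ℝ × ℝ → ℝ}

theorem uu_ev1 (h : PS lam u) (y : ℝ × ℝ) : uu u (-y.1, y.2) = uu u y := by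
  unfold uu
  simp only [neg_neg, neg_lt_neg_iff]
  by_cases h1 : -1 < y.1
  · by_cases h2 : y.1 < 1
    · simp only [h1, h2, if_true]
      rw [mm_refl h1 h2, h.inv _ (mm_ne h1 h2)]
    · simp [h1, h2]
  · have h2 : y.1 < 1 := by linarith [not_lt.1 h1]
    simp [h1, h2]

theorem uu_loc {p : ℝ × ℝ} (h1 : -1 < p.1) : uu u =ᶠ[𝓝 p] fun q => u (mm q) := by
  filter_upwards [half_nhds h1] with q hq using uu_pos hq

theorem uu_smAt (h : PS lam u) {p : ℝ × ℝ} (h1 : -1 < p.1) : ContDiffAt ℝ ∞ (uu u) p := by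
  refine ContDiffAt.congr_of_eventuallyEq ?_ (uu_loc h1)
  have ha := al_sm h1
  have hb := be_sm h1
  exact h.sm.contDiffAt.comp p (ContDiffAt.prodMk (by fun_prop) (by fun_prop))

theorem uu_sm (h : PS lam u) : ContDiff ℝ ∞ (uu u) := by
  rw [contDiff_iff_contDiffAt]
  intro p
  by_cases h1 : -1 < p.1
  · exact uu_smAt h h1
  · have e : uu u = (uu u) ∘ fun q : ℝ × ℝ => (-q.1, q.2) := by
      ext q; exact (uu_ev1 h q).symm
    rw [e]
    refine ContDiffAt.comp p (uu_smAt h ?_) (by fun_prop)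
    simp; linarith [not_lt.1 h1]

theorem Lap_congr {f g : ℝ × ℝ → ℝ} {p : ℝ × ℝ} (h : f =ᶠ[𝓝 p] g) : Lap f p = Lap g p := by
  have h' := h.eventuallyEq_nhds
  have e1 : D1 f =ᶠ[𝓝 p] D1 g := by filter_upwards [h'] with q hq using (D_congr hq).1
  have e2 : D2 f =ᶠ[𝓝 p] D2 g := by filter_upwards [h'] with q hq using (D_congr hq).2
  unfold Lap; rw [(D_congr e1).1, (D_congr e2).2]

theorem uu_pde_at (h : PS lam u) {p : ℝ × ℝ} (h1 : -1 < p.1) :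
    Lap (uu u) p = lam * rho p * (1 - Real.exp (uu u p)) := by
  rw [Lap_congr (uu_loc h1), mm_Lap h.sm h1, h.pde, uu_pos h1, ← mm_rho h1]; ring

theorem uu_PS (h : PS lam u) : PS lam (uu u) := by
  have hsm := uu_sm h
  have hev2 : ∀ y : ℝ × ℝ, -1 < y.1 → uu u (y.1, -y.2) = uu u y := by
    intro y hy
    rw [uu_pos hy, uu_pos (by simpa using hy), ← h.ev1 (mm y)]
    congr 1
    unfold mm al be ww; ext <;> simp <;> ring
  have hinv : ∀ y : ℝ × ℝ, y ≠ 0 → 0 ≤ y.1 → uu u (inv2 y) = uu u y := by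
    intro y hy0 hy
    have hn := nsq_pos hy0
    have hi : 0 ≤ (inv2 y).1 := by unfold inv2; simp only; positivity
    rw [uu_pos (by linarith), uu_pos (by linarith), ← h.ev2 (mm y)]
    have hw := ww_pos (y := y) (by linarith)
    have e : ww (inv2 y) = ww y / (y.1 ^ 2 + y.2 ^ 2) := by
      unfold ww inv2; field_simp; ring
    congr 1
    unfold mm al be
    rw [e]
    unfold inv2
    ext
    · simp; field_simp
    · simp; field_simp; unfold ww; ring
  refine ⟨hsm, ?_, uu_ev1 h, ?_, ?_⟩
  · intro p
    by_cases h1 : -1 < p.1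
    · exact uu_pde_at h h1
    · have hp : -1 < -p.1 := by linarith [not_lt.1 h1]
      have a1 := fun q => par1 hsm (s := 1) (fun p => by rw [uu_ev1 h, one_mul]) q
      have k1 := par1 (contDiff_D1 hsm) (s := -1) (fun p => by rw [(a1 p).1]; ring) p
      have k2 := par1 (contDiff_D2 hsm) (s := 1) (fun p => by rw [(a1 p).2]) p
      have := uu_pde_at h (p := (-p.1, p.2)) hp
      unfold Lap at this ⊢
      rw [k1.1, k2.2, uu_ev1 h] at this
      have er : rho (-p.1, p.2) = rho p := by unfold rho tau; simp
      rw [er] at this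
      linarith
  · intro y
    by_cases h1 : -1 < y.1
    · exact hev2 y h1
    · have hp : -1 < -y.1 := by linarith [not_lt.1 h1]
      have := hev2 (-y.1, y.2) hp
      rw [uu_ev1 h] at this
      rw [← this]
      exact (uu_ev1 h (y.1, -y.2)).symm
  · intro y hy
    rcases le_total 0 y.1 with h0 | h0
    · exact hinv y hy h0
    · have hne : ((-y.1, y.2) : ℝ × ℝ) ≠ 0 := by
        intro hh; apply hy
        have q1 := congrArg Prod.fst hh
        have q2 := congrArg Prod.snd hh
        simp at q1 q2
        exact Prod.ext q1 q2
      have := hinv (-y.1, y.2) hne (by simpa using h0)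
      rw [uu_ev1 h] at this
      rw [← this, ← uu_ev1 h]
      congr 1
      unfold inv2; ext <;> simp <;> ring

theorem uu_phi (h : PS lam u) {y : ℝ × ℝ} (hy : -1 < y.1) :
    phi1 (uu u) y = phi3 u (mm y) ∧ phi2 (uu u) y = phi1 u (mm y) ∧
    phi3 (uu u) y = phi2 u (mm y) := by
  have hw := ww_pos hy
  obtain ⟨-, c1, c2⟩ := mm_D (sm_diff h.sm) hy
  have k := D_congr (uu_loc (u := u) hy)
  unfold phi1 phi2 phi3
  rw [k.1, k.2, c1, c2]
  have e1 : (1 + y.1) = al y * ww y := by unfold al; field_simp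
  have e2 : y.2 = be y * ww y := by unfold be; field_simp
  have e3 := albe y hy
  have e3' : (al y ^ 2 + be y ^ 2) * ww y = 1 := by rw [e3]; field_simp
  have e1' : y.1 = al y * ww y - 1 := by linarith
  simp only [mm]
  generalize D1 u (2 * be y, 2 * al y - 1) = U1 at *
  generalize D2 u (2 * be y, 2 * al y - 1) = U2 at *
  rw [e1', show y.2 = be y * ww y from e2]
  refine ⟨?_, ?_, ?_⟩
  · linear_combination (((al y ^ 2 + be y ^ 2) * ww y + 1 - 2 * al y) * U1 + 2 * be y * U2) * e3'
  · linear_combination (2 * be y * U1 + (2 * al y - (al y ^ 2 + be y ^ 2) * ww y - 1) * U2) * e3'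
  · linear_combination (2 * al y * U1 - 2 * be y * U2) * e3'
end

open scoped ContDiff Topology

def mmi (p : ℝ × ℝ) : ℝ × ℝ :=
  (2 * (1 + p.2) / (p.1 ^ 2 + (1 + p.2) ^ 2) - 1, 2 * p.1 / (p.1 ^ 2 + (1 + p.2) ^ 2))

theorem mmi_spec {p : ℝ × ℝ} (hp : 0 ≤ p.2) : -1 < (mmi p).1 ∧ mm (mmi p) = p := by
  have h2 : 0 < 1 + p.2 := by linarith
  have hv : 0 < p.1 ^ 2 + (1 + p.2) ^ 2 := by positivity
  have h1 : -1 < (mmi p).1 := by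
    unfold mmi; simp only
    have : 0 < 2 * (1 + p.2) / (p.1 ^ 2 + (1 + p.2) ^ 2) := by positivity
    linarith
  refine ⟨h1, ?_⟩
  have hw : ww (mmi p) = 4 / (p.1 ^ 2 + (1 + p.2) ^ 2) := by
    unfold ww mmi; field_simp; ring
  unfold mm al be
  rw [hw]
  unfold mmi
  ext
  · simp only; field_simp; ring
  · simp only; field_simp; ring

theorem quad_pol {y : ℝ × ℝ} (h0 : y ≠ 0) (h1 : 0 ≤ y.1) (h2 : 0 ≤ y.2) (h3 : y.1 ^ 2 + y.2 ^ 2 < 1) :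
    ∃ s t, s < 0 ∧ 0 ≤ t ∧ t ≤ π / 2 ∧ y = pol s t := by
  obtain ⟨s, x, hx, hy, hn⟩ := ray_rep h0
  have he := Real.exp_pos s
  have x1 : 0 ≤ x.1 := by
    by_contra hc; push Not at hc
    have : y.1 = rexp s * x.1 := by rw [hy]
    nlinarith
  have x2 : 0 ≤ x.2 := by
    by_contra hc; push Not at hc
    have : y.2 = rexp s * x.2 := by rw [hy]
    nlinarith
  refine ⟨s, Real.arccos x.1, ?_, Real.arccos_nonneg _, Real.arccos_le_pi_div_two.2 x1, ?_⟩
  · rw [hn, Real.exp_lt_one_iff] at h3; linarith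
  · rw [hy, pol, Real.cos_arccos (by linarith) (by nlinarith), Real.sin_arccos]
    rw [show 1 - x.1 ^ 2 = x.2 ^ 2 by linarith, Real.sqrt_sq x2]

section
variable {lam : ℝ} {u : ℝ × ℝ → ℝ}

theorem some_zero (h : PS lam u) (l1 : 2 < lam) (l2 : lam ≤ 8) :
    (∀ p, phi1 u p = 0) ∨ (∀ p, phi2 u p = 0) ∨ (∀ p, phi3 u p = 0) := by
  by_contra hc
  push Not at hc
  obtain ⟨n1, n2, n3⟩ := hc
  have hG : GS lam u := ⟨l1, l2, h, n1, n2⟩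
  have hG' : GS lam (uu u) := by
    refine ⟨l1, l2, uu_PS h, ?_, ?_⟩
    · obtain ⟨p, hp⟩ := n3
      obtain ⟨q, hq, hq2⟩ : ∃ q : ℝ × ℝ, phi3 u q ≠ 0 ∧ 0 ≤ q.2 := by
        rcases le_total 0 p.2 with h2 | h2
        · exact ⟨p, hp, h2⟩
        · exact ⟨(p.1, -p.2), by rw [phi3_od2 h]; simpa using hp, by simpa using h2⟩
      obtain ⟨k1, k2⟩ := mmi_spec hq2
      exact ⟨mmi q, by rw [(uu_phi h k1).1, k2]; exact hq⟩
    · obtain ⟨p, hp⟩ := n1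
      obtain ⟨q, hq, hq2⟩ : ∃ q : ℝ × ℝ, phi1 u q ≠ 0 ∧ 0 ≤ q.2 := by
        rcases le_total 0 p.2 with h2 | h2
        · exact ⟨p, hp, h2⟩
        · exact ⟨(p.1, -p.2), by rw [phi1_od2 h]; simpa using hp, by simpa using h2⟩
      obtain ⟨k1, k2⟩ := mmi_spec hq2
      exact ⟨mmi q, by rw [(uu_phi h k1).2.1, k2]; exact hq⟩
  obtain ⟨e1, e2, he1, he2, hs⟩ := hG'.const_signs
  have he : e1 ≠ 0 := by rintro rfl; norm_num at he1
  obtain ⟨p, hp⟩ := n3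
  refine hp (hG.phi3_zero (e3 := e1) (fun s t hs0 ht0 ht1 => ?_) he p)
  have hn := pol_nsq s t
  have hlt : rexp (2 * s) < 1 := by rw [Real.exp_lt_one_iff]; linarith
  set q := pol s t with hq
  have q1 : 0 ≤ q.1 := by
    rw [hq]; unfold pol
    have := Real.cos_nonneg_of_neg_pi_div_two_le_of_le (x := t) (by linarith [Real.pi_pos]) ht1
    simp only; positivity
  have q2 : 0 ≤ q.2 := by
    rw [hq]; unfold pol
    have := Real.sin_nonneg_of_nonneg_of_le_pi ht0 (by linarith [Real.pi_pos])
    simp only; positivity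
  rcases q2.eq_or_lt with h2 | h2
  · have := phi3_od2 h q
    rw [← h2, neg_zero, show ((q.1, (0 : ℝ)) : ℝ × ℝ) = q from Prod.ext rfl h2] at this
    have : phi3 u q = 0 := by linarith
    rw [this, mul_zero]
  · obtain ⟨k1, k2⟩ := mmi_spec q2
    have hw := ww_pos k1
    have hv : 0 < q.1 ^ 2 + (1 + q.2) ^ 2 := by positivity
    have y1 : 0 < (mmi q).1 := by
      unfold mmi
      simp only
      rw [sub_pos, lt_div_iff₀ hv]
      nlinarith
    have y2 : 0 ≤ (mmi q).2 := by unfold mmi; simp only; positivity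
    have y3 : (mmi q).1 ^ 2 + (mmi q).2 ^ 2 < 1 := by
      have e : (mm (mmi q)).2 = q.2 := by rw [k2]
      unfold mm al at e
      simp only at e
      have e' : 2 * (1 + (mmi q).1) - ww (mmi q) = q.2 * ww (mmi q) := by
        rw [← e]; field_simp
      have : 0 < q.2 * ww (mmi q) := by positivity
      rw [← e'] at this
      unfold ww at this
      nlinarith
    have hne : mmi q ≠ 0 := by intro h0; rw [h0] at y1; simp at y1
    obtain ⟨s', t', a1, a2, a3, a4⟩ := quad_pol hne y1.le y2 y3
    have := (hs s' t' a1 a2 a3).1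
    rwa [← a4, (uu_phi h k1).1, k2] at this

theorem const_of_deriv_Icc {f : ℝ → ℝ} {a b : ℝ}
    (hf : ∀ t ∈ Set.Icc a b, HasDerivAt f 0 t) {x y : ℝ} (hx : x ∈ Set.Icc a b)
    (hy : y ∈ Set.Icc a b) : f x = f y := by
  have key := fun z (hz : z ∈ Set.Icc a b) =>
    constant_of_has_deriv_right_zero (f := f) (a := a) (b := b)
    (fun t ht => (hf t ht).continuousAt.continuousWithinAt)
    (fun t ht => (hf t (Set.Ico_subset_Icc_self ht)).hasDerivWithinAt) z hz
  rw [key x hx, key y hy]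

theorem curve_deriv (hs : ContDiff ℝ ∞ u) {a b : ℝ → ℝ} {a' b' t : ℝ} (ha : HasDerivAt a a' t)
    (hb : HasDerivAt b b' t) :
    HasDerivAt (fun t => u (a t, b t)) (D1 u (a t, b t) * a' + D2 u (a t, b t) * b') t := by
  have h := (hasFDerivAt_D (sm_diff hs (a t, b t))).comp_hasDerivAt t (ha.prodMk hb)
  exact h.congr_deriv (by simp)

theorem arc1 (h : PS lam u) (h1 : ∀ p, phi1 u p = 0) {a c : ℝ} (hc : a ^ 2 + c ^ 2 = 1) (hc0 : 0 ≤ c)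
    {t t' : ℝ} (ht : t ∈ Set.Icc 0 π) (ht' : t' ∈ Set.Icc 0 π) :
    u (a / (1 + c * sin t), c * cos t / (1 + c * sin t)) =
    u (a / (1 + c * sin t'), c * cos t' / (1 + c * sin t')) := by
  refine const_of_deriv_Icc (f := fun t => u (a / (1 + c * sin t), c * cos t / (1 + c * sin t)))
    (fun t ht => ?_) ht ht'
  have hsn := Real.sin_nonneg_of_nonneg_of_le_pi ht.1 ht.2
  have hd : 0 < 1 + c * sin t := by positivity
  have d0 : HasDerivAt (fun t => 1 + c * sin t) (c * cos t) t :=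
    ((Real.hasDerivAt_sin t).const_mul c).const_add 1
  have d1 := (hasDerivAt_const t a).div d0 hd.ne'
  have d2 := ((Real.hasDerivAt_cos t).const_mul c).div d0 hd.ne'
  refine (curve_deriv h.sm d1 d2).congr_deriv ?_
  have := h1 (a / (1 + c * sin t), c * cos t / (1 + c * sin t))
  simp only [phi1] at this
  simp only [Pi.div_apply]
  refine Eq.trans ?_ this
  have hcs := Real.sin_sq_add_cos_sq t
  generalize D1 u _ = A at *
  generalize D2 u _ = B at *
  field_simp
  linear_combination B * (-c ^ 2 * hcs - hc)

theorem arc2 (h : PS lam u) (h1 : ∀ p, phi2 u p = 0) {a c : ℝ} (hc : a ^ 2 + c ^ 2 = 1) (hc0 : 0 ≤ c)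
    {t t' : ℝ} (ht : t ∈ Set.Icc 0 π) (ht' : t' ∈ Set.Icc 0 π) :
    u (c * cos t / (1 + c * sin t), a / (1 + c * sin t)) =
    u (c * cos t' / (1 + c * sin t'), a / (1 + c * sin t')) := by
  refine const_of_deriv_Icc (f := fun t => u (c * cos t / (1 + c * sin t), a / (1 + c * sin t)))
    (fun t ht => ?_) ht ht'
  have hsn := Real.sin_nonneg_of_nonneg_of_le_pi ht.1 ht.2
  have hd : 0 < 1 + c * sin t := by positivity
  have d0 : HasDerivAt (fun t => 1 + c * sin t) (c * cos t) t :=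
    ((Real.hasDerivAt_sin t).const_mul c).const_add 1
  have d1 := (hasDerivAt_const t a).div d0 hd.ne'
  have d2 := ((Real.hasDerivAt_cos t).const_mul c).div d0 hd.ne'
  refine (curve_deriv h.sm d2 d1).congr_deriv ?_
  have := h1 (c * cos t / (1 + c * sin t), a / (1 + c * sin t))
  simp only [phi2] at this
  simp only [Pi.div_apply]
  refine neg_eq_zero.1 (Eq.trans ?_ this)
  have hcs := Real.sin_sq_add_cos_sq t
  generalize D1 u _ = A at *
  generalize D2 u _ = B at *
  field_simp
  linear_combination A * (c ^ 2 * hcs + hc)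

theorem arc3 (h : PS lam u) (h1 : ∀ p, phi3 u p = 0) (r t t' : ℝ) :
    u (r * cos t, r * sin t) = u (r * cos t', r * sin t') := by
  refine is_const_of_deriv_eq_zero (f := fun t => u (r * cos t, r * sin t)) ?_ ?_ t t'
  · intro t
    exact (curve_deriv h.sm ((Real.hasDerivAt_cos t).const_mul r)
      ((Real.hasDerivAt_sin t).const_mul r)).differentiableAt
  · intro t
    rw [(curve_deriv h.sm ((Real.hasDerivAt_cos t).const_mul r)
      ((Real.hasDerivAt_sin t).const_mul r)).deriv]
    have := h1 (r * cos t, r * sin t)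
    simp only [phi3] at this
    linarith

theorem stereoS_of {x : Fin 3 → ℝ} (hx : x ∈ sphere3) (h3 : 0 ≤ x 2) :
    stereoS (x 0 / (1 + x 2), x 1 / (1 + x 2)) = x := by
  have hx' : x 0 ^ 2 + x 1 ^ 2 + x 2 ^ 2 = 1 := hx
  have hp : 0 < 1 + x 2 := by linarith
  have e : 1 + (x 0 / (1 + x 2)) ^ 2 + (x 1 / (1 + x 2)) ^ 2 = 2 / (1 + x 2) := by
    field_simp; linarith
  ext i
  fin_cases i
  · simp only [stereoS, e]; simp; field_simp
  · simp only [stereoS, e]; simp; field_simp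
  · simp only [stereoS]
    rw [e]
    simp; field_simp; linarith

theorem half_circ {c p q : ℝ} (hc : 0 < c) (h : p ^ 2 + q ^ 2 = c ^ 2) (hq : 0 ≤ q) :
    ∃ t ∈ Set.Icc 0 π, p = c * cos t ∧ q = c * sin t := by
  refine ⟨Real.arccos (p / c), ⟨Real.arccos_nonneg _, Real.arccos_le_pi _⟩, ?_, ?_⟩
  · have h1 := abs_le_of_sq_le_sq' (a := p) (b := c) (by nlinarith) hc.le
    rw [Real.cos_arccos]
    · field_simp
    · rw [le_div_iff₀ hc]; linarith
    · rw [div_le_iff₀ hc]; linarith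
  · rw [Real.sin_arccos, show 1 - (p / c) ^ 2 = (q / c) ^ 2 by field_simp; linarith,
      Real.sqrt_sq (by positivity)]
    field_simp

theorem final_of_PS {U : (Fin 3 → ℝ) → ℝ} (h : PS lam (fun y => U (stereoS y)))
    (hsym : ∀ x ∈ sphere3, ∀ ε : Fin 3 → ℝ,
      (∀ j : Fin 3, ε j = 1 ∨ ε j = -1) → U (fun j => ε j * x j) = U x)
    (l1 : 2 < lam) (l2 : lam ≤ 8) :
    ∃ i : Fin 3, ∀ x ∈ sphere3, ∀ x' ∈ sphere3, x i = x' i → U x = U x' := by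
  -- reduction to the upper hemisphere
  have red : ∀ x ∈ sphere3, ∃ z ∈ sphere3, U z = U x ∧ z 0 = x 0 ∧ z 1 = x 1 ∧ z 2 = |x 2| := by
    intro x hx
    have hx' : x 0 ^ 2 + x 1 ^ 2 + x 2 ^ 2 = 1 := hx
    rcases le_total 0 (x 2) with h2 | h2
    · exact ⟨x, hx, rfl, rfl, rfl, (abs_of_nonneg h2).symm⟩
    · refine ⟨fun j => (![1, 1, -1] : Fin 3 → ℝ) j * x j, ?_, hsym x hx _ ?_, ?_, ?_, ?_⟩
      · change _ = _
        simpa using hx'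
      · intro j; fin_cases j <;> simp
      · simp
      · simp
      · simp [abs_of_nonpos h2]
  have red2 : ∀ i : Fin 3, (∀ x ∈ sphere3, ∀ x' ∈ sphere3, 0 ≤ x 2 → 0 ≤ x' 2 →
      (x i = x' i) → U x = U x') →
      ∀ x ∈ sphere3, ∀ x' ∈ sphere3, x i = x' i → U x = U x' := by
    intro i hh x hx x' hx' hi
    obtain ⟨z, hz, e, e0, e1, e2⟩ := red x hx
    obtain ⟨z', hz', e', e0', e1', e2'⟩ := red x' hx'
    rw [← e, ← e']
    refine hh z hz z' hz' (by rw [e2]; positivity) (by rw [e2']; positivity) ?_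
    fin_cases i
    · simpa [e0, e0'] using hi
    · simpa [e1, e1'] using hi
    · simp only [Fin.reduceFinMk] at hi ⊢; rw [e2, e2', hi]
  rcases some_zero h l1 l2 with hz | hz | hz
  · refine ⟨0, red2 0 fun x hx x' hx' p p' hi => ?_⟩
    have k : x 0 ^ 2 + x 1 ^ 2 + x 2 ^ 2 = 1 := hx
    have k' : x' 0 ^ 2 + x' 1 ^ 2 + x' 2 ^ 2 = 1 := hx'
    set c := √(1 - x 0 ^ 2) with hcd
    have hcc : c ^ 2 = 1 - x 0 ^ 2 := Real.sq_sqrt (by nlinarith [sq_nonneg (x 1), sq_nonneg (x 2)])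
    have hc0 : 0 ≤ c := Real.sqrt_nonneg _
    rcases hc0.eq_or_lt with hc | hc
    · congr 1
      rw [← hc] at hcc
      rw [← hi] at k'
      have r1 : x 1 = 0 := by nlinarith [sq_nonneg (x 1), sq_nonneg (x 2)]
      have r2 : x 2 = 0 := by nlinarith [sq_nonneg (x 1), sq_nonneg (x 2)]
      have r1' : x' 1 = 0 := by nlinarith [sq_nonneg (x' 1), sq_nonneg (x' 2)]
      have r2' : x' 2 = 0 := by nlinarith [sq_nonneg (x' 1), sq_nonneg (x' 2)]
      ext i; fin_cases i
      · exact hi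
      · exact r1.trans r1'.symm
      · exact r2.trans r2'.symm
    · obtain ⟨t, ht, a1, a2⟩ := half_circ (p := x 1) (q := x 2) hc (by linarith) p
      obtain ⟨t', ht', a1', a2'⟩ := half_circ (p := x' 1) (q := x' 2) hc (by rw [hcc, hi]; linarith) p'
      have := arc1 h hz (a := x 0) (c := c) (by linarith) hc0 ht ht'
      rw [← a1, ← a1', ← a2, ← a2'] at this
      rw [stereoS_of hx p, hi, stereoS_of hx' p'] at this
      exact this
  · refine ⟨1, red2 1 fun x hx x' hx' p p' hi => ?_⟩
    have k : x 0 ^ 2 + x 1 ^ 2 + x 2 ^ 2 = 1 := hx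
    have k' : x' 0 ^ 2 + x' 1 ^ 2 + x' 2 ^ 2 = 1 := hx'
    set c := √(1 - x 1 ^ 2) with hcd
    have hcc : c ^ 2 = 1 - x 1 ^ 2 := Real.sq_sqrt (by nlinarith [sq_nonneg (x 0), sq_nonneg (x 2)])
    have hc0 : 0 ≤ c := Real.sqrt_nonneg _
    rcases hc0.eq_or_lt with hc | hc
    · congr 1
      rw [← hc] at hcc
      rw [← hi] at k'
      have r1 : x 0 = 0 := by nlinarith [sq_nonneg (x 0), sq_nonneg (x 2)]
      have r2 : x 2 = 0 := by nlinarith [sq_nonneg (x 0), sq_nonneg (x 2)]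
      have r1' : x' 0 = 0 := by nlinarith [sq_nonneg (x' 0), sq_nonneg (x' 2)]
      have r2' : x' 2 = 0 := by nlinarith [sq_nonneg (x' 0), sq_nonneg (x' 2)]
      ext i; fin_cases i
      · exact r1.trans r1'.symm
      · exact hi
      · exact r2.trans r2'.symm
    · obtain ⟨t, ht, a1, a2⟩ := half_circ (p := x 0) (q := x 2) hc (by linarith) p
      obtain ⟨t', ht', a1', a2'⟩ := half_circ (p := x' 0) (q := x' 2) hc (by rw [hcc, hi]; linarith) p'
      have := arc2 h hz (a := x 1) (c := c) (by linarith) hc0 ht ht'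
      rw [← a1, ← a1', ← a2, ← a2'] at this
      rw [stereoS_of hx p, hi, stereoS_of hx' p'] at this
      exact this
  · refine ⟨2, red2 2 fun x hx x' hx' p p' hi => ?_⟩
    have k : x 0 ^ 2 + x 1 ^ 2 + x 2 ^ 2 = 1 := hx
    have k' : x' 0 ^ 2 + x' 1 ^ 2 + x' 2 ^ 2 = 1 := hx'
    rw [← hi] at k' p'
    set c := √(1 - x 2 ^ 2) with hcd
    have hcc : c ^ 2 = 1 - x 2 ^ 2 := Real.sq_sqrt (by nlinarith [sq_nonneg (x 0), sq_nonneg (x 1)])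
    have hc0 : 0 ≤ c := Real.sqrt_nonneg _
    rcases hc0.eq_or_lt with hc | hc
    · congr 1
      rw [← hc] at hcc
      have r1 : x 0 = 0 := by nlinarith [sq_nonneg (x 0), sq_nonneg (x 1)]
      have r2 : x 1 = 0 := by nlinarith [sq_nonneg (x 0), sq_nonneg (x 1)]
      have r1' : x' 0 = 0 := by nlinarith [sq_nonneg (x' 0), sq_nonneg (x' 1)]
      have r2' : x' 1 = 0 := by nlinarith [sq_nonneg (x' 0), sq_nonneg (x' 1)]
      ext i; fin_cases i
      · exact r1.trans r1'.symm
      · exact r2.trans r2'.symm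
      · exact hi
    · obtain ⟨t, ht⟩ := circ_rep (p := (x 0 / c, x 1 / c)) (by simp only; field_simp; linarith)
      obtain ⟨t', ht'⟩ := circ_rep (p := (x' 0 / c, x' 1 / c)) (by simp only; field_simp; linarith)
      obtain ⟨c1, c2⟩ := Prod.mk.inj ht
      obtain ⟨c1', c2'⟩ := Prod.mk.inj ht'
      have := arc3 h hz (c / (1 + x 2)) t t'
      have f : ∀ z : ℝ, c / (1 + x 2) * (z / c) = z / (1 + x 2) := by
        intro z; field_simp
      rw [← c1, ← c1', ← c2, ← c2', f, f, f, f] at this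
      rw [stereoS_of hx p, hi, stereoS_of hx' (hi ▸ p')] at this
      exact this
end

open scoped ContDiff Topology

/-- gradient of the fundamental solution -/
def k1 (p : ℝ × ℝ) : ℝ := (2 * π)⁻¹ * (p.1 / (p.1 ^ 2 + p.2 ^ 2))
def k2 (p : ℝ × ℝ) : ℝ := (2 * π)⁻¹ * (p.2 / (p.1 ^ 2 + p.2 ^ 2))

theorem meas_k1 : Measurable k1 := by unfold k1; fun_prop
theorem meas_k2 : Measurable k2 := by unfold k2; fun_prop

theorem norm_sq_le (p : ℝ × ℝ) : ‖p‖ ^ 2 ≤ p.1 ^ 2 + p.2 ^ 2 := by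
  rw [Prod.norm_def]
  rcases max_choice ‖p.1‖ ‖p.2‖ with h | h <;> rw [h, Real.norm_eq_abs, sq_abs] <;>
    nlinarith [sq_nonneg p.1, sq_nonneg p.2]

theorem k_bound (p : ℝ × ℝ) (x : ℝ) (hx : |x| ≤ ‖p‖) :
    ‖(2 * π)⁻¹ * (x / (p.1 ^ 2 + p.2 ^ 2))‖ ≤ ‖p‖⁻¹ := by
  by_cases hp : p = 0
  · subst hp; simp
  have hn := nsq_pos hp
  have hp' : 0 < ‖p‖ := norm_pos_iff.2 hp
  have hsq := norm_sq_le p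
  have hpi : (2 * π)⁻¹ ≤ 1 := by
    apply inv_le_one_of_one_le₀; linarith [Real.pi_gt_three]
  have hpi0 : 0 ≤ (2 * π)⁻¹ := by have := Real.pi_pos; positivity
  rw [norm_mul, norm_div, Real.norm_of_nonneg hpi0, Real.norm_of_nonneg hn.le, Real.norm_eq_abs]
  have : |x| / (p.1 ^ 2 + p.2 ^ 2) ≤ ‖p‖⁻¹ := by
    rw [div_le_iff₀ hn, inv_mul_eq_div, le_div_iff₀ hp']
    nlinarith
  have h0 : 0 ≤ |x| / (p.1 ^ 2 + p.2 ^ 2) := by positivity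
  nlinarith

theorem locInt_inv : LocallyIntegrable (fun p : ℝ × ℝ => ‖p‖⁻¹) := by
  rw [locallyIntegrable_iff]
  intro K hK
  obtain ⟨r, hr⟩ := hK.isBounded.subset_ball 0
  refine IntegrableOn.mono_set ?_ hr
  rw [integrableOn_fun_norm_addHaar (volume : Measure (ℝ × ℝ)) (f := fun y => y⁻¹)]
  have : IntegrableOn (fun _ : ℝ => (1 : ℝ)) (Set.Ioo 0 r) := by
    simp [integrableOn_const_iff]
  refine this.congr_fun (fun y hy => ?_) measurableSet_Ioo
  have : y ≠ 0 := hy.1.ne'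
  simp [this]

theorem locInt_k1 : LocallyIntegrable k1 := by
  refine locInt_inv.mono meas_k1.aestronglyMeasurable (Filter.Eventually.of_forall fun p => ?_)
  rw [norm_inv, norm_norm]
  exact k_bound p p.1 (norm_fst_le p)

theorem locInt_k2 : LocallyIntegrable k2 := by
  refine locInt_inv.mono meas_k2.aestronglyMeasurable (Filter.Eventually.of_forall fun p => ?_)
  rw [norm_inv, norm_norm]
  exact k_bound p p.2 (norm_snd_le p)

theorem strip_int {H : ℝ × ℝ → ℝ} (hH : Continuous H) {R : ℝ} (h0 : ∀ r t, R < r → H (r, t) = 0) :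
    IntegrableOn H (Set.Ioi 0 ×ˢ Set.Ioo (-π) π) := by
  have h1 : IntegrableOn H (Set.Icc 0 R ×ˢ Set.Icc (-π) π) :=
    hH.continuousOn.integrableOn_compact (isCompact_Icc.prod isCompact_Icc)
  refine h1.of_forall_sdiff_eq_zero (measurableSet_Ioi.prod measurableSet_Ioo) ?_
  rintro ⟨r, t⟩ ⟨⟨hr, ht⟩, hn⟩
  apply h0
  by_contra hc
  exact hn ⟨⟨le_of_lt hr, not_lt.1 hc⟩, Set.Ioo_subset_Icc_self ht⟩

section
variable {g : ℝ × ℝ → ℝ}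

theorem contD1 (hg : ContDiff ℝ 1 g) : Continuous (D1 g) := by
  unfold D1; exact (hg.continuous_fderiv (by simp)).clm_apply continuous_const
theorem contD2 (hg : ContDiff ℝ 1 g) : Continuous (D2 g) := by
  unfold D2; exact (hg.continuous_fderiv (by simp)).clm_apply continuous_const

theorem cs_zero (hc : HasCompactSupport g) : ∃ R, 0 < R ∧ ∀ r t, R < r →
    g (r * cos t, r * sin t) = 0 := by
  obtain ⟨R, hR⟩ := hc.isCompact.isBounded.subset_ball (0 : ℝ × ℝ)
  refine ⟨2 * max R 1, by positivity, fun r t hr => ?_⟩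
  by_contra hn
  have hm : (r * cos t, r * sin t) ∈ tsupport g := subset_tsupport _ hn
  have := hR hm
  rw [mem_ball_zero_iff, Prod.norm_def, max_lt_iff, Real.norm_eq_abs, Real.norm_eq_abs] at this
  obtain ⟨a, b⟩ := this
  have a' := sq_lt_sq' (neg_lt_of_abs_lt a) (lt_of_abs_lt a)
  have b' := sq_lt_sq' (neg_lt_of_abs_lt b) (lt_of_abs_lt b)
  have hcs := Real.sin_sq_add_cos_sq t
  have e : (r * cos t) ^ 2 + (r * sin t) ^ 2 = r ^ 2 := by linear_combination r ^ 2 * hcs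
  have m1 : R ≤ max R 1 := le_max_left _ _
  have m2 : 1 ≤ max R 1 := le_max_right _ _
  have hRp : 0 < R := lt_of_le_of_lt (abs_nonneg _) a
  nlinarith

theorem csD1 (hc : HasCompactSupport g) : HasCompactSupport (D1 g) := hc.fderiv_apply ℝ (1, 0)
theorem csD2 (hc : HasCompactSupport g) : HasCompactSupport (D2 g) := hc.fderiv_apply ℝ (0, 1)

theorem curve_deriv1 {a b : ℝ → ℝ} {a' b' t : ℝ} (hs : ContDiff ℝ 1 g) (ha : HasDerivAt a a' t)
    (hb : HasDerivAt b b' t) :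
    HasDerivAt (fun t => g (a t, b t)) (D1 g (a t, b t) * a' + D2 g (a t, b t) * b') t := by
  have h := (hasFDerivAt_D (hs.differentiable (by simp) (a t, b t))).comp_hasDerivAt t (ha.prodMk hb)
  exact h.congr_deriv (by simp)

theorem J1 (hg : ContDiff ℝ 1 g) (hc : HasCompactSupport g) :
    ∫ p, (k1 p * D1 g p + k2 p * D2 g p) = - g 0 := by
  have c1 := contD1 hg
  have c2 := contD2 hg
  obtain ⟨R0, hR0, z0⟩ := cs_zero hc
  obtain ⟨R1, hR1, z1⟩ := cs_zero (csD1 hc)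
  obtain ⟨R2, hR2, z2⟩ := cs_zero (csD2 hc)
  set H : ℝ × ℝ → ℝ := fun p => D1 g (p.1 * cos p.2, p.1 * sin p.2) * cos p.2
    + D2 g (p.1 * cos p.2, p.1 * sin p.2) * sin p.2 with hH
  have hHc : Continuous H := by rw [hH]; fun_prop
  have hH0 : ∀ r t, max R1 R2 < r → H (r, t) = 0 := by
    intro r t hr
    have a1 := z1 r t (lt_of_le_of_lt (le_max_left _ _) hr)
    have a2 := z2 r t (lt_of_le_of_lt (le_max_right _ _) hr)
    simp only [hH, a1, a2]; ring
  have hI := strip_int hHc hH0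
  rw [← integral_comp_polarCoord_symm, polarCoord_target]
  have e1 : ∫ p in Set.Ioi (0 : ℝ) ×ˢ Set.Ioo (-π) π,
      p.1 • (k1 (polarCoord.symm p) * D1 g (polarCoord.symm p)
        + k2 (polarCoord.symm p) * D2 g (polarCoord.symm p))
      = ∫ p in Set.Ioi (0 : ℝ) ×ˢ Set.Ioo (-π) π, (2 * π)⁻¹ * H p := by
    refine setIntegral_congr_fun (measurableSet_Ioi.prod measurableSet_Ioo) ?_
    rintro ⟨r, t⟩ ⟨hr, ht⟩
    have hr' : r ≠ 0 := (Set.mem_Ioi.1 hr).ne'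
    simp only [polarCoord_symm_apply, k1, k2, hH, smul_eq_mul]
    rw [show (r * cos t) ^ 2 + (r * sin t) ^ 2 = r ^ 2 by
      linear_combination r ^ 2 * Real.sin_sq_add_cos_sq t]
    field_simp
  rw [e1, integral_const_mul]
  have e2 : ∫ p in Set.Ioi (0 : ℝ) ×ˢ Set.Ioo (-π) π, H p =
      ∫ t in Set.Ioo (-π) π, ∫ r in Set.Ioi (0 : ℝ), H (r, t) := by
    rw [Measure.volume_eq_prod] at hI ⊢
    rw [IntegrableOn, ← Measure.prod_restrict] at hI
    rw [← Measure.prod_restrict, integral_prod_symm _ hI]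
  rw [e2]
  have e3 : ∀ t, ∫ r in Set.Ioi (0 : ℝ), H (r, t) = - g 0 := by
    intro t
    have hd : ∀ r ∈ Set.Ici (0 : ℝ), HasDerivAt (fun r => g (r * cos t, r * sin t)) (H (r, t)) r := by
      intro r _
      exact curve_deriv1 hg ((hasDerivAt_id r).mul_const _ |>.congr_deriv (by simp))
        ((hasDerivAt_id r).mul_const _ |>.congr_deriv (by simp))
    have hintg : IntegrableOn (fun r => H (r, t)) (Set.Ioi 0) := by
      have h1 : IntegrableOn (fun r => H (r, t)) (Set.Icc 0 (max R1 R2)) :=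
        (show Continuous fun r => H (r, t) by fun_prop).continuousOn.integrableOn_compact isCompact_Icc
      refine h1.of_forall_sdiff_eq_zero measurableSet_Ioi ?_
      rintro r ⟨hr, hn⟩
      apply hH0
      by_contra hcn
      exact hn ⟨le_of_lt hr, not_lt.1 hcn⟩
    have ht : Filter.Tendsto (fun r => g (r * cos t, r * sin t)) Filter.atTop (𝓝 0) := by
      refine tendsto_const_nhds.congr' ?_
      filter_upwards [Filter.eventually_gt_atTop R0] with r hr using (z0 r t hr).symm
    rw [integral_Ioi_of_hasDerivAt_of_tendsto' hd hintg ht]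
    simp [show ((0 : ℝ), (0 : ℝ)) = 0 from rfl]
  simp only [e3]
  rw [setIntegral_const]
  have := Real.pi_pos
  simp only [measureReal_def, Real.volume_Ioo]
  rw [ENNReal.toReal_ofReal (by linarith), smul_eq_mul]
  field_simp
  ring

theorem J2 (hg : ContDiff ℝ 1 g) (hc : HasCompactSupport g) :
    ∫ p, (k1 p * D2 g p - k2 p * D1 g p) = 0 := by
  have c1 := contD1 hg
  have c2 := contD2 hg
  obtain ⟨R1, hR1, z1⟩ := cs_zero (csD1 hc)
  obtain ⟨R2, hR2, z2⟩ := cs_zero (csD2 hc)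
  set H : ℝ × ℝ → ℝ := fun p => D2 g (p.1 * cos p.2, p.1 * sin p.2) * cos p.2
    - D1 g (p.1 * cos p.2, p.1 * sin p.2) * sin p.2 with hH
  have hHc : Continuous H := by rw [hH]; fun_prop
  have hH0 : ∀ r t, max R1 R2 < r → H (r, t) = 0 := by
    intro r t hr
    have a1 := z1 r t (lt_of_le_of_lt (le_max_left _ _) hr)
    have a2 := z2 r t (lt_of_le_of_lt (le_max_right _ _) hr)
    simp only [hH, a1, a2]; ring
  have hI := strip_int hHc hH0
  rw [← integral_comp_polarCoord_symm, polarCoord_target]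
  have e1 : ∫ p in Set.Ioi (0 : ℝ) ×ˢ Set.Ioo (-π) π,
      p.1 • (k1 (polarCoord.symm p) * D2 g (polarCoord.symm p)
        - k2 (polarCoord.symm p) * D1 g (polarCoord.symm p))
      = ∫ p in Set.Ioi (0 : ℝ) ×ˢ Set.Ioo (-π) π, (2 * π)⁻¹ * H p := by
    refine setIntegral_congr_fun (measurableSet_Ioi.prod measurableSet_Ioo) ?_
    rintro ⟨r, t⟩ ⟨hr, ht⟩
    have hr' : r ≠ 0 := (Set.mem_Ioi.1 hr).ne'
    simp only [polarCoord_symm_apply, k1, k2, hH, smul_eq_mul]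
    rw [show (r * cos t) ^ 2 + (r * sin t) ^ 2 = r ^ 2 by
      linear_combination r ^ 2 * Real.sin_sq_add_cos_sq t]
    field_simp
  rw [e1, integral_const_mul]
  have e2 : ∫ p in Set.Ioi (0 : ℝ) ×ˢ Set.Ioo (-π) π, H p =
      ∫ r in Set.Ioi (0 : ℝ), ∫ t in Set.Ioo (-π) π, H (r, t) := by
    rw [Measure.volume_eq_prod] at hI ⊢
    rw [setIntegral_prod _ hI]
  rw [e2]
  have e3 : ∫ r in Set.Ioi (0 : ℝ), ∫ t in Set.Ioo (-π) π, H (r, t) =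
      ∫ r in Set.Ioi (0 : ℝ), (0 : ℝ) := by
    refine setIntegral_congr_fun measurableSet_Ioi fun r hr => ?_
    have hr' : r ≠ 0 := (Set.mem_Ioi.1 hr).ne'
    have hd : ∀ t ∈ Set.uIcc (-π) π, HasDerivAt (fun t => g (r * cos t, r * sin t)) (r * H (r, t)) t := by
      intro t _
      refine (curve_deriv1 hg ((Real.hasDerivAt_cos t).const_mul r)
        ((Real.hasDerivAt_sin t).const_mul r)).congr_deriv ?_
      simp only [hH]; ring
    have hii : IntervalIntegrable (fun t => r * H (r, t)) volume (-π) π :=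
      Continuous.intervalIntegrable (by fun_prop) _ _
    have := intervalIntegral.integral_eq_sub_of_hasDerivAt hd hii
    rw [intervalIntegral.integral_of_le (by linarith [Real.pi_pos]), integral_const_mul,
      integral_Ioc_eq_integral_Ioo] at this
    simp at this
    simpa [hr'] using this
  rw [e3]; simp
end

open scoped ContDiff Topology Convolution

section
variable {k h : ℝ × ℝ → ℝ}

/-- scalar convolution -/
def cv (k h : ℝ × ℝ → ℝ) : ℝ × ℝ → ℝ := k ⋆[ContinuousLinearMap.mul ℝ ℝ, volume] h

theorem cv_apply (x : ℝ × ℝ) : cv k h x = ∫ t, k t * h (x - t) := by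
  unfold cv; rw [convolution_def]; rfl

theorem cv_integrable (hk : LocallyIntegrable k) (hc : HasCompactSupport h) (hh : Continuous h)
    (x : ℝ × ℝ) : Integrable (fun t => k t * h (x - t)) :=
  hc.convolutionExists_right (ContinuousLinearMap.mul ℝ ℝ) hk hh x

theorem cv_D (hk : LocallyIntegrable k) (hc : HasCompactSupport h) (hh : ContDiff ℝ 1 h)
    (x : ℝ × ℝ) : D1 (cv k h) x = cv k (D1 h) x ∧ D2 (cv k h) x = cv k (D2 h) x := by
  have hd := hc.hasFDerivAt_convolution_right (ContinuousLinearMap.mul ℝ ℝ) hk hh x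
  have key : ∀ v : ℝ × ℝ, fderiv ℝ (cv k h) x v = ∫ t, k t * fderiv ℝ h (x - t) v := by
    intro v
    unfold cv
    rw [hd.fderiv, convolution_def, ContinuousLinearMap.integral_apply]
    · rfl
    · exact (hc.fderiv ℝ).convolutionExists_right _ hk (hh.continuous_fderiv (by simp)) x
  constructor
  · rw [D1, key, cv_apply]; rfl
  · rw [D2, key, cv_apply]; rfl

theorem refl_D (hh : ContDiff ℝ 1 h) (x t : ℝ × ℝ) :
    D1 (fun t => h (x - t)) t = - D1 h (x - t) ∧ D2 (fun t => h (x - t)) t = - D2 h (x - t) := by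
  have := (hh.differentiable (by simp) (x - t)).hasFDerivAt.comp t ((hasFDerivAt_id t).const_sub x)
  have e : fderiv ℝ (fun t => h (x - t)) t = _ := this.fderiv
  constructor
  · rw [D1, e]; simp [D1]
  · rw [D2, e]; simp [D2]

theorem cv_div (hc : HasCompactSupport h) (hh : ContDiff ℝ 1 h) (x : ℝ × ℝ) :
    D1 (cv k1 h) x + D2 (cv k2 h) x = h x ∧ D2 (cv k1 h) x - D1 (cv k2 h) x = 0 := by
  set g : ℝ × ℝ → ℝ := fun t => h (x - t) with hg
  have gs : ContDiff ℝ 1 g := hh.comp (contDiff_const.sub contDiff_id)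
  have gc : HasCompactSupport g := hc.comp_homeomorph (Homeomorph.subLeft x)
  have j1 := J1 gs gc
  have j2 := J2 gs gc
  have r := refl_D hh x
  have i11 := cv_integrable locInt_k1 (csD1 hc) (contD1 hh) x
  have i12 := cv_integrable locInt_k1 (csD2 hc) (contD2 hh) x
  have i21 := cv_integrable locInt_k2 (csD1 hc) (contD1 hh) x
  have i22 := cv_integrable locInt_k2 (csD2 hc) (contD2 hh) x
  rw [(cv_D locInt_k1 hc hh x).1, (cv_D locInt_k1 hc hh x).2, (cv_D locInt_k2 hc hh x).1,
    (cv_D locInt_k2 hc hh x).2, cv_apply, cv_apply, cv_apply, cv_apply,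
    ← integral_add i11 i22, ← integral_sub i12 i21]
  constructor
  · have : ∫ t, (k1 t * D1 h (x - t) + k2 t * D2 h (x - t)) =
        ∫ p, -(k1 p * D1 g p + k2 p * D2 g p) := by
      congr 1; ext t; rw [(r t).1, (r t).2]; ring
    rw [this, integral_neg, j1]; simp [hg]
  · have : ∫ t, (k1 t * D2 h (x - t) - k2 t * D1 h (x - t)) =
        ∫ p, -(k1 p * D2 g p - k2 p * D1 g p) := by
      congr 1; ext t; rw [(r t).1, (r t).2]; ring
    rw [this, integral_neg, j2]; simp

theorem cv_sm (hk : LocallyIntegrable k) (hc : HasCompactSupport h) {n : ℕ∞} (hh : ContDiff ℝ n h) :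
    ContDiff ℝ n (cv k h) := by
  unfold cv
  exact hc.contDiff_convolution_right _ hk hh
end

section
variable {u f : ℝ × ℝ → ℝ}

theorem contDiff_D_of {m n : WithTop ℕ∞} (hu : ContDiff ℝ n u) (hmn : m + 1 ≤ n) :
    ContDiff ℝ m (D1 u) ∧ ContDiff ℝ m (D2 u) := by
  unfold D1 D2
  exact ⟨(hu.fderiv_right hmn).clm_apply contDiff_const, (hu.fderiv_right hmn).clm_apply contDiff_const⟩

theorem C2_second (hf : ContDiff ℝ 2 u) (p : ℝ × ℝ) :
    D1 (D2 u) p = D2 (D1 u) p ∧ lap u p = D1 (D1 u) p + D2 (D2 u) p := by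
  have hd : DifferentiableAt ℝ (fderiv ℝ u) p :=
    (hf.fderiv_right (m := 1) (by norm_num)).differentiable (by simp) p
  have h1 : ∀ v w : ℝ × ℝ, fderiv ℝ (fun q => fderiv ℝ u q v) p w
      = fderiv ℝ (fderiv ℝ u) p w v := by
    intro v w
    rw [fderiv_clm_apply hd (differentiableAt_const v)]
    simp
  have hs : IsSymmSndFDerivAt ℝ u p := by
    apply ContDiffAt.isSymmSndFDerivAt (n := 2) hf.contDiffAt
    simp
  constructor
  · unfold D1 D2
    rw [h1, h1]
    exact hs.eq (1, 0) (0, 1)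
  · unfold lap D1 D2
    rw [iteratedFDeriv_two_apply, iteratedFDeriv_two_apply, h1, h1]
    simp

theorem hol_sm {U V : ℝ × ℝ → ℝ} {x : ℝ × ℝ} 
    (hU : ∀ᶠ p in 𝓝 x, DifferentiableAt ℝ U p ∧ DifferentiableAt ℝ V p ∧
      D1 U p = D2 V p ∧ D2 U p = - D1 V p) : ContDiffAt ℝ ∞ U x ∧ ContDiffAt ℝ ∞ V x := by
  set F : ℂ → ℂ := fun z => (U (z.re, z.im) : ℂ) + Complex.I * V (z.re, z.im) with hF
  set z0 : ℂ := ⟨x.1, x.2⟩ with hz0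
  have hcont : Filter.Tendsto (fun z : ℂ => ((z.re, z.im) : ℝ × ℝ)) (𝓝 z0) (𝓝 x) := by
    have : Continuous fun z : ℂ => ((z.re, z.im) : ℝ × ℝ) :=
      Complex.continuous_re.prodMk Complex.continuous_im
    exact this.tendsto z0
  have hdiff : ∀ᶠ z in 𝓝 z0, DifferentiableAt ℂ F z := by
    filter_upwards [hcont.eventually hU] with z hz
    exact (CR_deriv hz.1 hz.2.1 hz.2.2.1 hz.2.2.2).differentiableAt
  have han : AnalyticAt ℂ F z0 := Complex.analyticAt_iff_eventually_differentiableAt.2 hdiff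
  have hcd : ContDiffAt ℝ ∞ F z0 := (han.contDiffAt (n := ∞)).restrict_scalars ℝ
  have hemb : ContDiff ℝ ∞ (fun p : ℝ × ℝ => (⟨p.1, p.2⟩ : ℂ)) := 
    Complex.equivRealProdCLM.symm.contDiff
  have hcomp : ContDiffAt ℝ ∞ (fun p : ℝ × ℝ => F ⟨p.1, p.2⟩) x :=
    ContDiffAt.comp (g := F) x hcd hemb.contDiffAt
  constructor
  · have := Complex.reCLM.contDiff.contDiffAt.comp x hcomp
    refine this.congr_of_eventuallyEq (Filter.Eventually.of_forall fun p => ?_)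
    simp [hF]
  · have := Complex.imCLM.contDiff.contDiffAt.comp x hcomp
    refine this.congr_of_eventuallyEq (Filter.Eventually.of_forall fun p => ?_)
    simp [hF]

theorem reg_step (hu : ContDiff ℝ 2 u) {n : ℕ} (hn : 1 ≤ n) (hf : ContDiff ℝ n f)
    (he : ∀ p, lap u p = f p) : ContDiff ℝ (n + 1) u := by
  obtain ⟨s1, s2⟩ := contDiff_D_of (m := 1) hu (by norm_num)
  have d1 := s1.differentiable (by simp)
  have d2 := s2.differentiable (by simp)
  have key : ∀ x, ContDiffAt ℝ n (D1 u) x ∧ ContDiffAt ℝ n (D2 u) x := by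
    intro x
    let η : ContDiffBump x := ⟨1, 2, by norm_num, by norm_num⟩
    set h : ℝ × ℝ → ℝ := fun p => η p * f p with hh
    have hηs : ContDiff ℝ n (η : ℝ × ℝ → ℝ) := η.contDiff
    have hs : ContDiff ℝ n h := hηs.mul hf
    have hs1 : ContDiff ℝ 1 h := hs.of_le (by exact_mod_cast hn)
    have hc : HasCompactSupport h := η.hasCompactSupport.mul_right
    have v1 : ContDiff ℝ n (cv k1 h) := cv_sm (n := n) locInt_k1 hc hs
    have v2 : ContDiff ℝ n (cv k2 h) := cv_sm (n := n) locInt_k2 hc hs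
    have hn0 : (n : WithTop ℕ∞) ≠ 0 := by
      have : n ≠ 0 := by omega
      exact_mod_cast this
    have w1 := v1.differentiable hn0
    have w2 := v2.differentiable hn0
    have hol := hol_sm (U := fun p => D1 u p - cv k1 h p) (V := fun p => cv k2 h p - D2 u p) (x := x) (by
      filter_upwards [Metric.ball_mem_nhds x one_pos] with p hp
      have hη : h p = f p := by
        simp only [hh]
        rw [η.one_of_mem_closedBall (Metric.ball_subset_closedBall hp), one_mul]
      obtain ⟨q1, q2⟩ := cv_div hc hs1 p
      obtain ⟨r1, r2⟩ := C2_second hu p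
      refine ⟨(d1 p).sub (w1 p), (w2 p).sub (d2 p), ?_, ?_⟩
      · rw [(D_sub_at (d1 p) (w1 p)).1, (D_sub_at (w2 p) (d2 p)).2]
        have := he p
        linarith
      · rw [(D_sub_at (d1 p) (w1 p)).2, (D_sub_at (w2 p) (d2 p)).1]
        linarith)
    have hle : (n : WithTop ℕ∞) ≤ ∞ := by exact_mod_cast le_top
    have a1 := (hol.1.of_le hle).add v1.contDiffAt
    have a2 := v2.contDiffAt.sub (hol.2.of_le hle)
    exact ⟨a1.congr_of_eventuallyEq (Filter.Eventually.of_forall fun p => by simp),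
      a2.congr_of_eventuallyEq (Filter.Eventually.of_forall fun p => by simp)⟩
  have g1 : ContDiff ℝ n (D1 u) := contDiff_iff_contDiffAt.2 fun x => (key x).1
  have g2 : ContDiff ℝ n (D2 u) := contDiff_iff_contDiffAt.2 fun x => (key x).2
  rw [contDiff_succ_iff_fderiv]
  refine ⟨hu.differentiable (by simp), by simp, ?_⟩
  have : fderiv ℝ u = fun p => D1 u p • ContinuousLinearMap.fst ℝ ℝ ℝ
      + D2 u p • ContinuousLinearMap.snd ℝ ℝ ℝ := by
    ext1 p; exact (hasFDerivAt_D (hu.differentiable (by simp) p)).fderiv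
  rw [this]
  exact (g1.smul contDiff_const).add (g2.smul contDiff_const)

theorem reg {lam : ℝ} (hu : ContDiff ℝ 2 u) (he : ∀ p : ℝ × ℝ, lap u p =
    4 * lam * (1 - Real.exp (u p)) / (1 + p.1 ^ 2 + p.2 ^ 2) ^ 2) : ContDiff ℝ ∞ u := by
  have key : ∀ n : ℕ, ContDiff ℝ ((n + 2 : ℕ) : WithTop ℕ∞) u := by
    intro n
    induction n with
    | zero => exact_mod_cast hu
    | succ n ih =>
      have hf : ContDiff ℝ ((n + 2 : ℕ) : WithTop ℕ∞) (fun p : ℝ × ℝ =>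
          4 * lam * (1 - Real.exp (u p)) / (1 + p.1 ^ 2 + p.2 ^ 2) ^ 2) := by
        refine ContDiff.div ?_ (by fun_prop) fun p => ?_
        · exact contDiff_const.mul (contDiff_const.sub ih.exp)
        · have := sig_pos p; positivity
      have := reg_step hu (by omega) hf he
      exact_mod_cast this
  rw [contDiff_infty]
  intro n
  exact (key n).of_le (by exact_mod_cast (by omega : n ≤ n + 2))
end

open scoped ContDiff Topology

theorem stereoS_mem (y : ℝ × ℝ) : stereoS y ∈ sphere3 := by
  have := sig_pos y
  change _ = _
  simp only [stereoS]
  simp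
  field_simp
  ring

theorem octant_symmetric_solution_depends_on_one_coordinate
    (lam : ℝ) (hlam₁ : 2 < lam) (hlam₂ : lam ≤ 8)
    (u : (Fin 3 → ℝ) → ℝ) (hu : IsMFSolution lam u)
    (hsym : ∀ x ∈ sphere3, ∀ ε : Fin 3 → ℝ,
      (∀ j : Fin 3, ε j = 1 ∨ ε j = -1) → u (fun j => ε j * x j) = u x) :
    ∃ i : Fin 3, ∀ x ∈ sphere3, ∀ x' ∈ sphere3, x i = x' i → u x = u x' := by
  obtain ⟨-, -, hC, -, hE⟩ := hu
  refine final_of_PS (lam := lam) ?_ hsym hlam₁ hlam₂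
  refine ⟨reg hC hE, ?_, ?_, ?_, ?_⟩
  · intro p
    have h := (C2_second hC p).2
    rw [Lap, ← h, hE p, rho, tau]
    have hs := sig_pos p
    field_simp
  · intro p
    refine Eq.trans ?_ (hsym (stereoS p) (stereoS_mem p) ![-1, 1, 1] ?_)
    · congr 1
      ext j; fin_cases j <;> simp [stereoS]
      ring
    · intro j; fin_cases j <;> simp
  · intro p
    refine Eq.trans ?_ (hsym (stereoS p) (stereoS_mem p) ![1, -1, 1] ?_)
    · congr 1
      ext j; fin_cases j <;> simp [stereoS]
      ring
    · intro j; fin_cases j <;> simp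
  · intro p hp
    have hn := nsq_pos hp
    have hs := sig_pos p
    have e : 1 + (inv2 p).1 ^ 2 + (inv2 p).2 ^ 2 = (1 + p.1 ^ 2 + p.2 ^ 2) / (p.1 ^ 2 + p.2 ^ 2) := by
      unfold inv2; field_simp; ring
    refine Eq.trans ?_ (hsym (stereoS p) (stereoS_mem p) ![1, 1, -1] ?_)
    · congr 1
      ext j; fin_cases j
      · simp only [stereoS, e]; simp [inv2]; field_simp
      · simp only [stereoS, e]; simp [inv2]; field_simp
      · simp only [stereoS, e]; simp [inv2]; field_simp; ring
    · intro j; fin_cases j <;> simp
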